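/- Let N be a prime with N ≡ 1 (mod 5), F = Q(N^{1/5}), and L = Q(ζ_5, N^{1/5}). Then: if rk_5(Cl(F)) = 1 then rk_5(Cl(L)) ≥ 2; if rk_5(Cl(F)) = 2 then rk_5(Cl(L)) ≥ 3; and if rk_5(Cl(F)) = 3 then rk_5(Cl(L)) ≥ 6. -/

import Mathlib

open NumberField Polynomial

/-- The `p`-rank of a finite abelian group `G`: the `𝔽_p`-dimension of `G ⊗ 𝔽_p`,
equivalently of `G[p]`. -/
noncomputable def pRank (p : ℕ) (G : Type*) [Group G] : ℕ :=
  (Nat.card {g : G // g ^ p = 1}).factorization p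


set_option linter.all false
namespace St14

lemma end_identity {R : Type*} [Ring R] (s : R) (h : 1 + s + s^2 + s^3 + s^4 = 0) :
    ∃ u v : R, u * v = 1 ∧ (s - 1)^4 * u = -5 := by
  refine ⟨-s^2 - 2*s^3 - s^4, s - s^2 + s^3, ?_, ?_⟩
  · have e : ((-X^2 - 2*X^3 - X^4) * (X - X^2 + X^3) : ℤ[X])
      = 1 + (1 + X + X^2 + X^3 + X^4) * (-1 + X - X^3) := by ring
    have := congrArg (aeval s) e
    simpa [h, map_ofNat] using this
  · have e : ((X-1)^4 * (-X^2 - 2*X^3 - X^4) : ℤ[X])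
      = -5 + (1 + X + X^2 + X^3 + X^4) * (5 - 5*X - X^2 + 3*X^3 - X^4) := by ring
    have := congrArg (aeval s) e
    simpa [h, map_ofNat] using this

lemma det_lattice {M : Type*} [AddCommGroup M] [Module.Free ℤ M] [Module.Finite ℤ M]
    (hr : Module.finrank ℤ M = 8) (s : Module.End ℤ M) (h : 1 + s + s^2 + s^3 + s^4 = 0) :
    (LinearMap.det (s - 1)).natAbs = 25 := by
  obtain ⟨u, v, huv, hu⟩ := end_identity s h
  have h1 : LinearMap.det u * LinearMap.det v = 1 := by
    rw [← map_mul, huv, map_one]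
  have h2 : (LinearMap.det (s-1))^4 * LinearMap.det u = 5^8 := by
    rw [← map_pow, ← map_mul, hu]
    have : (-5 : Module.End ℤ M) = (-5 : ℤ) • (1 : Module.End ℤ M) := by
      ext x; simp
    rw [this, LinearMap.det_smul, hr]; simp
  have h3 : (LinearMap.det u).natAbs = 1 := Int.isUnit_iff_natAbs_eq.mp (IsUnit.of_mul_eq_one _ h1)
  have h4 := congrArg Int.natAbs h2
  rw [Int.natAbs_mul, h3, Int.natAbs_pow, mul_one] at h4
  have : (LinearMap.det (s-1)).natAbs^4 = 25^4 := by rw [h4]; norm_num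
  exact Nat.pow_left_injective (n := 4) (by norm_num) this

lemma index_range_lattice {M : Type*} [AddCommGroup M] [Module.Free ℤ M] [Module.Finite ℤ M]
    (n : M →ₗ[ℤ] M) (hn : Function.Injective n) :
    n.range.toAddSubgroup.index = (LinearMap.det n).natAbs := by
  exact (Submodule.natAbs_det_equiv n.range (LinearEquiv.ofInjective n hn)).symm

lemma index_range {A : Type*} [AddCommGroup A] [Module.Finite ℤ A]
    (hr : Module.finrank ℤ A = 8) (s : Module.End ℤ A) (h : 1 + s + s^2 + s^3 + s^4 = 0)
    (hk : Nat.card (LinearMap.ker (s - 1)) = 5) :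
    (LinearMap.range (s - 1)).toAddSubgroup.index = 125 := by
  set n : Module.End ℤ A := s - 1 with hn
  set τ := Submodule.torsion ℤ A with hτ
  have hτs : τ ≤ τ.comap s := by
    intro x hx
    obtain ⟨a, ha⟩ := (Submodule.mem_torsion_iff _).1 hx
    refine (Submodule.mem_torsion_iff _).2 ⟨a, ?_⟩
    rw [Submonoid.smul_def] at ha ⊢
    rw [← map_smul, ha, map_zero]
  haveI : Finite (LinearMap.ker n) := Nat.finite_of_card_ne_zero (by omega)
  haveI : Finite τ := by
    exact Module.finite_of_fg_torsion _ Submodule.torsion_isTorsion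
  have hkt : LinearMap.ker n ≤ τ := by
    intro x hx
    have : addOrderOf (⟨x, hx⟩ : LinearMap.ker n) ≠ 0 := (addOrderOf_pos _).ne'
    refine (Submodule.mem_torsion_iff _).2 ⟨⟨addOrderOf (⟨x, hx⟩ : LinearMap.ker n), ?_⟩, ?_⟩
    · simpa using this
    · have := addOrderOf_nsmul_eq_zero (⟨x, hx⟩ : LinearMap.ker n)
      have := congrArg Subtype.val this
      rw [Submonoid.smul_def]
      simpa using this
  -- quotient
  let sq : Module.End ℤ (A ⧸ τ) := τ.mapQ τ s hτs
  have hsq : ∀ x, sq (Submodule.Quotient.mk x) = Submodule.Quotient.mk (s x) := fun x => rfl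
  have hq : 1 + sq + sq^2 + sq^3 + sq^4 = 0 := by
    ext x
    have := congrArg τ.mkQ (LinearMap.congr_fun h x)
    simpa [pow_succ, hsq] using this
  have hfr : Module.finrank ℤ (A ⧸ τ) = 8 := by
    have := Submodule.finrank_quotient_add_finrank (R := ℤ) τ
    have h0 : Module.finrank ℤ τ = 0 := by
      rw [Module.finrank_eq_zero_iff_isTorsion]
      exact Submodule.torsion_isTorsion
    omega
  have hnq : ∀ x, (sq - 1) (τ.mkQ x) = τ.mkQ (n x) := fun x => by simp [hn, hsq]
  have hinj : Function.Injective ⇑(sq - 1) := by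
    rw [← LinearMap.ker_eq_bot, LinearMap.ker_eq_bot']
    intro y hy
    obtain ⟨x, rfl⟩ := τ.mkQ_surjective y
    rw [hnq] at hy
    rw [Submodule.mkQ_apply, Submodule.Quotient.mk_eq_zero] at hy ⊢
    obtain ⟨a, ha⟩ := (Submodule.mem_torsion_iff _).1 hy
    have : (a : ℤ) • x ∈ τ := by
      apply hkt
      rw [LinearMap.mem_ker, map_smul]; exact ha
    obtain ⟨b, hb⟩ := (Submodule.mem_torsion_iff _).1 this
    refine (Submodule.mem_torsion_iff _).2 ⟨b * a, ?_⟩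
    rw [mul_smul]; exact hb
  have h25 := index_range_lattice (sq - 1) hinj
  rw [det_lattice hfr sq hq] at h25
  set H := (LinearMap.range n).toAddSubgroup with hH
  have e1 : (LinearMap.range (sq - 1)).toAddSubgroup = H.map (τ.mkQ.toAddMonoidHom) := by
    ext y; constructor
    · rintro ⟨z, rfl⟩
      obtain ⟨x, rfl⟩ := τ.mkQ_surjective z
      exact ⟨n x, ⟨x, rfl⟩, (hnq x).symm⟩
    · rintro ⟨_, ⟨x, rfl⟩, rfl⟩
      exact ⟨τ.mkQ x, hnq x⟩
  have hker : τ.mkQ.toAddMonoidHom.ker = τ.toAddSubgroup := by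
    ext x; simp [AddMonoidHom.mem_ker]
  have hrange : τ.mkQ.toAddMonoidHom.range = ⊤ := by
    rw [AddMonoidHom.range_eq_top]; exact τ.mkQ_surjective
  rw [e1, AddSubgroup.index_map, hker, hrange, AddSubgroup.index_top, mul_one] at h25
  have e2 : H.relIndex τ.toAddSubgroup = 5 := by
    -- n maps τ to τ with kernel of order 5
    let nt : τ →+ A := (n.toAddMonoidHom).comp τ.toAddSubgroup.subtype
    have hnt : ∀ x : τ, nt x ∈ τ.toAddSubgroup := fun x => by
      change s x - x ∈ τ
      exact τ.sub_mem (hτs x.2) x.2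
    let nt' : τ →+ τ := nt.codRestrict τ.toAddSubgroup hnt
    have hr1 : nt'.range = H.addSubgroupOf τ.toAddSubgroup := by
      ext y; constructor
      · rintro ⟨x, rfl⟩
        exact ⟨x.1, rfl⟩
      · rintro ⟨x, hx⟩
        have hx' : n x = y.1 := hx
        have : x ∈ τ := by
          have h1 : (sq-1) (τ.mkQ x) = (sq-1) 0 := by
            rw [hnq, map_zero, Submodule.mkQ_apply, Submodule.Quotient.mk_eq_zero, hx']; exact y.2
          have := hinj h1
          rwa [Submodule.mkQ_apply, Submodule.Quotient.mk_eq_zero] at this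
        exact ⟨⟨x, this⟩, Subtype.ext hx⟩
    have hk1 : Nat.card nt'.ker = 5 := by
      rw [← hk]
      refine Nat.card_congr ⟨fun x => ⟨x.1.1, ?_⟩, fun x => ⟨⟨x.1, hkt x.2⟩, ?_⟩, ?_, ?_⟩
      · have := x.2
        have := congrArg Subtype.val ((AddMonoidHom.mem_ker).1 this)
        exact this
      · exact (AddMonoidHom.mem_ker).2 (Subtype.ext x.2)
      · intro x; rfl
      · intro x; rfl
    have c1 := AddSubgroup.index_mul_card nt'.range
    have c2 := AddSubgroup.index_mul_card nt'.ker
    rw [AddSubgroup.index_ker, hk1] at c2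
    have hpos : 0 < Nat.card nt'.range := Nat.card_pos
    have : nt'.range.index = 5 := by
      apply Nat.eq_of_mul_eq_mul_right hpos
      rw [c1, ← c2, mul_comm]
    rw [hr1] at this
    exact this
  have e3 := AddSubgroup.relIndex_mul_index (H := H) (K := H ⊔ τ.toAddSubgroup) le_sup_left
  rw [AddSubgroup.relIndex_sup_left, e2, h25] at e3
  omega

end St14

namespace St14

lemma finrank_range_add_ker {M M' : Type*} [AddCommGroup M] [AddCommGroup M'] [Module.Finite ℤ M]
    (f : M →ₗ[ℤ] M') : Module.finrank ℤ (LinearMap.range f) + Module.finrank ℤ (LinearMap.ker f)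
      = Module.finrank ℤ M := by
  rw [← Submodule.finrank_quotient_add_finrank (LinearMap.ker f), f.quotKerEquivRange.finrank_eq]

/-- abstract Herbrand-type index formula -/
lemma herbrand_abstract {M : Type*} [AddCommGroup M] [Module.Finite ℤ M]
    (h9 : Module.finrank ℤ M = 9) (s : Module.End ℤ M) (hs : s ^ 5 = 1)
    (hk : Module.finrank ℤ (LinearMap.ker (s - 1)) = 1)
    (hc : Nat.card {x : M // s x = x ∧ (5 : ℤ) • x = 0} = 5) :
    (LinearMap.range (s - 1)).toAddSubgroup.relIndex
        (LinearMap.ker (1 + s + s^2 + s^3 + s^4)).toAddSubgroup *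
      ((LinearMap.ker (s - 1)).map (1 + s + s^2 + s^3 + s^4)).toAddSubgroup.relIndex
        (LinearMap.range (1 + s + s^2 + s^3 + s^4)).toAddSubgroup = 125 := by
  set D := s - 1 with hD
  set P := 1 + s + s^2 + s^3 + s^4 with hP
  have hs5 : ∀ x, s (s (s (s (s x)))) = x := fun x => by
    have := LinearMap.congr_fun hs x
    simpa [pow_succ] using this
  have hDx : ∀ x, D x = s x - x := fun x => by simp [hD]
  have hPx : ∀ x, P x = x + s x + s (s x) + s (s (s x)) + s (s (s (s x))) := fun x => by
    simp [hP, pow_succ]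
  have hPD : ∀ x, P (D x) = 0 := fun x => by
    rw [hPx, hDx]; simp only [map_sub, hs5]; abel
  have hDP : ∀ x, D (P x) = 0 := fun x => by
    rw [hPx, hDx]; simp only [map_add, hs5]; abel
  have hPfix : ∀ x, D x = 0 → P x = (5:ℤ) • x := fun x hx => by
    rw [hDx, sub_eq_zero] at hx
    rw [hPx]; simp only [hx]; module
  -- finrank of ker P
  have hrange : Module.finrank ℤ (LinearMap.range P) = 1 := by
    apply le_antisymm
    · rw [← hk]
      apply Submodule.finrank_mono
      rintro _ ⟨x, rfl⟩
      exact hDP x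
    · rw [← hk]
      let f : LinearMap.ker D →ₗ[ℤ] LinearMap.range P :=
        (P.comp (LinearMap.ker D).subtype).codRestrict _ (fun x => ⟨x, rfl⟩)
      have h1 := finrank_range_add_ker f
      have h2 : Module.finrank ℤ (LinearMap.ker f) = 0 := by
        rw [Module.finrank_eq_zero_iff_isTorsion]
        intro x
        refine ⟨⟨5, by simp⟩, ?_⟩
        have h3 : P x.1.1 = 0 := congrArg Subtype.val x.2
        rw [hPfix _ x.1.2] at h3
        exact Subtype.ext (Subtype.ext h3)
      have h3 := Submodule.finrank_le (LinearMap.range f)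
      omega
  have hkerP : Module.finrank ℤ (LinearMap.ker P) = 8 := by
    have := finrank_range_add_ker P
    omega
  -- restrict
  have hsP : ∀ x ∈ LinearMap.ker P, s x ∈ LinearMap.ker P := by
    intro x hx
    rw [LinearMap.mem_ker] at hx ⊢
    have : s x = D x + x := by rw [hDx]; abel
    rw [this, map_add, hPD, hx, add_zero]
  let s' : Module.End ℤ (LinearMap.ker P) := s.restrict hsP
  have hs'x : ∀ x, (s' x : M) = s x := fun x => rfl
  have h0 : 1 + s' + s'^2 + s'^3 + s'^4 = 0 := by
    ext x
    have := x.2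
    rw [LinearMap.mem_ker, hPx] at this
    simpa [pow_succ, hs'x] using this
  have hcard : Nat.card (LinearMap.ker (s' - 1)) = 5 := by
    rw [← hc]
    refine Nat.card_congr ⟨fun x => ⟨x.1.1, ?_, ?_⟩, fun x => ⟨⟨x.1, ?_⟩, ?_⟩, ?_, ?_⟩
    · have : s x.1.1 - x.1.1 = 0 := congrArg Subtype.val (LinearMap.mem_ker.1 x.2)
      exact sub_eq_zero.1 this
    · have : s x.1.1 - x.1.1 = 0 := congrArg Subtype.val (LinearMap.mem_ker.1 x.2)
      have h1 : D x.1.1 = 0 := by rw [hDx]; exact this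
      rw [← hPfix _ h1]; exact x.1.2
    · have h1 : D x.1 = 0 := by rw [hDx, x.2.1, sub_self]
      rw [LinearMap.mem_ker, hPfix _ h1, x.2.2]
    · rw [LinearMap.mem_ker]
      apply Subtype.ext
      simp [hs'x, x.2.1]
    · intro x; rfl
    · intro x; rfl
  have h125 := index_range hkerP s' h0 hcard
  -- relation
  have e1 : (LinearMap.range (s' - 1)).toAddSubgroup =
      (((LinearMap.ker P).map D).toAddSubgroup).addSubgroupOf (LinearMap.ker P).toAddSubgroup := by
    ext y; constructor
    · rintro ⟨x, rfl⟩
      exact ⟨x.1, x.2, by simp [hDx, hs'x]⟩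
    · rintro ⟨x, hx, hxy⟩
      refine ⟨⟨x, hx⟩, Subtype.ext ?_⟩
      rw [← show D x = y.1 from hxy]; simp [hDx, hs'x]
  rw [e1] at h125
  have e2 : ((LinearMap.ker P).map D).toAddSubgroup.relIndex (LinearMap.range D).toAddSubgroup
      = ((LinearMap.ker D).map P).toAddSubgroup.relIndex (LinearMap.range P).toAddSubgroup := by
    have a1 := AddSubgroup.relIndex_map_map D.toAddMonoidHom (LinearMap.ker P).toAddSubgroup ⊤
    have a2 := AddSubgroup.relIndex_map_map P.toAddMonoidHom (LinearMap.ker D).toAddSubgroup ⊤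
    have b1 : D.toAddMonoidHom.ker = (LinearMap.ker D).toAddSubgroup := rfl
    have b2 : P.toAddMonoidHom.ker = (LinearMap.ker P).toAddSubgroup := rfl
    rw [b1, top_sup_eq] at a1
    rw [b2, top_sup_eq, sup_comm] at a2
    rw [← AddMonoidHom.range_eq_map] at a1 a2
    exact a1.trans a2.symm
  rw [← e2, mul_comm]
  rw [AddSubgroup.relIndex_mul_relIndex]
  · exact h125
  · rintro _ ⟨x, hx, rfl⟩; exact ⟨x, rfl⟩
  · rintro _ ⟨x, rfl⟩; exact hPD x
end St14

namespace St14

structure KD {K T : Type} [Field K] [NumberField K] [Field T] [NumberField T] [Algebra K T]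
    (ζ : K) (σ : T ≃ₐ[K] T) (y : T) : Prop where
  hζ : IsPrimitiveRoot ζ 5
  hK : Module.finrank ℚ K = 4
  h5 : Module.finrank K T = 5
  hy0 : y ≠ 0
  hy : σ y = algebraMap K T ζ * y

/-- action of a ring automorphism on the ring of integers -/
noncomputable def oi {T : Type} [Field T] (τ : T ≃+* T) : 𝓞 T ≃+* 𝓞 T :=
  RingOfIntegers.mapRingEquiv τ

@[simp] lemma oi_coe {T : Type} [Field T] (τ : T ≃+* T) (x : 𝓞 T) : ((oi τ x : 𝓞 T) : T) = τ x := rfl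

lemma totallyComplex_of_root {K : Type} [Field K] [NumberField K] {ζ : K} (hζ : IsPrimitiveRoot ζ 5) :
    IsTotallyComplex K := by
  refine ⟨fun v => ?_⟩
  by_contra h
  rw [InfinitePlace.not_isComplex_iff_isReal] at h
  have h1 : ((InfinitePlace.embedding_of_isReal h) ζ)^5 = 1 := by
    rw [← map_pow, hζ.pow_eq_one, map_one]
  have h2 : (InfinitePlace.embedding_of_isReal h) ζ = 1 := by
    have : Odd 5 := by decide
    exact (this.strictMono_pow (R := ℝ)).injective (by simpa using h1)
  have h3 : ζ = 1 := by
    apply (InfinitePlace.embedding_of_isReal h).injective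
    rw [h2, map_one]
  exact hζ.ne_one (by norm_num) h3

lemma unit_rank {K : Type} [Field K] [NumberField K] {ζ : K} (hζ : IsPrimitiveRoot ζ 5) :
    2 * (Units.rank K + 1) = Module.finrank ℚ K := by
  have := totallyComplex_of_root hζ
  have h1 := IsTotallyComplex.finrank (K := K)
  have h2 := InfinitePlace.card_eq_nrRealPlaces_add_nrComplexPlaces K
  have h3 := IsTotallyComplex.nrRealPlaces_eq_zero K
  have h4 : 0 < Fintype.card (InfinitePlace K) := Fintype.card_pos
  unfold Units.rank
  omega

namespace KD
variable {K T : Type} [Field K] [NumberField K] [Field T] [NumberField T] [Algebra K T]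
    {ζ : K} {σ : T ≃ₐ[K] T} {y : T}

lemma pow_y (h : KD ζ σ y) (n : ℕ) : (σ^n) y = (algebraMap K T ζ)^n * y := by
  induction n with
  | zero => simp
  | succ n ih =>
    rw [pow_succ', AlgEquiv.mul_apply, ih, map_mul, map_pow, AlgEquiv.commutes, h.hy]; ring

lemma orderOf (h : KD ζ σ y) : orderOf σ = 5 := by
  have h1 : 5 ∣ _root_.orderOf σ := by
    have := h.pow_y (_root_.orderOf σ)
    rw [pow_orderOf_eq_one, AlgEquiv.one_apply] at this
    have h2 : (algebraMap K T ζ)^(_root_.orderOf σ) = 1 := by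
      apply mul_right_cancel₀ h.hy0; rw [← this, one_mul]
    rw [← map_pow, ← map_one (algebraMap K T)] at h2
    exact h.hζ.dvd_of_pow_eq_one _ ((algebraMap K T).injective h2)
  have h2 : _root_.orderOf σ ≤ 5 := by
    rw [← h.h5]
    have a1 : _root_.orderOf σ ≤ Nat.card (T ≃ₐ[K] T) := orderOf_le_card
    have a2 : Nat.card (T ≃ₐ[K] T) ≤ Module.finrank K T := by
      rw [Nat.card_congr (algEquivEquivAlgHom K T).toEquiv]
      exact card_algHom_le_finrank K T T
    omega
  have h3 : 0 < _root_.orderOf σ := orderOf_pos σ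
  obtain ⟨k, hk⟩ := h1
  omega

lemma card_aut (h : KD ζ σ y) : Nat.card (T ≃ₐ[K] T) = 5 := by
  have a1 : _root_.orderOf σ ≤ Nat.card (T ≃ₐ[K] T) := orderOf_le_card
  have a2 : Nat.card (T ≃ₐ[K] T) ≤ Module.finrank K T := by
    rw [Nat.card_congr (algEquivEquivAlgHom K T).toEquiv]
    exact card_algHom_le_finrank K T T
  rw [h.orderOf] at a1
  rw [h.h5] at a2
  omega

lemma galois (h : KD ζ σ y) : IsGalois K T := by
  apply IsGalois.of_card_aut_eq_finrank
  rw [h.h5, h.card_aut]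

lemma zpow (h : KD ζ σ y) (g : T ≃ₐ[K] T) : g ∈ Subgroup.zpowers σ := by
  have : Subgroup.zpowers σ = ⊤ := by
    apply Subgroup.eq_top_of_card_eq
    rw [Nat.card_zpowers, h.orderOf, h.card_aut]
  rw [this]; trivial

lemma exists_pow (h : KD ζ σ y) (g : T ≃ₐ[K] T) : ∃ n < 5, g = σ^n := by
  classical
  have := h.zpow g
  rw [mem_zpowers_iff_mem_range_orderOf, Finset.mem_image] at this
  obtain ⟨n, hn, rfl⟩ := this
  rw [h.orderOf, Finset.mem_range] at hn
  exact ⟨n, hn, rfl⟩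

lemma s5 (h : KD ζ σ y) (x : T) : σ (σ (σ (σ (σ x)))) = x := by
  have h1 : σ^5 = 1 := by rw [← h.orderOf]; exact pow_orderOf_eq_one σ
  have := AlgEquiv.congr_fun h1 x
  simpa [pow_succ] using this

lemma fixed (h : KD ζ σ y) {x : T} (hx : σ x = x) : ∃ k : K, algebraMap K T k = x := by
  have := h.galois
  refine (IsGalois.mem_range_algebraMap_iff_fixed x).2 ?_
  intro g
  obtain ⟨n, hn, rfl⟩ := h.exists_pow g
  clear hn
  induction n with
  | zero => simp
  | succ n ih => rw [pow_succ, AlgEquiv.mul_apply, hx, ih]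

lemma norm_eq (h : KD ζ σ y) (x : T) :
    algebraMap K T (Algebra.norm K x) = x * σ x * σ (σ x) * σ (σ (σ x)) * σ (σ (σ (σ x))) := by
  have := h.galois
  rw [Algebra.norm_eq_prod_automorphisms]
  have hinj : ∀ i ∈ Finset.range 5, ∀ j ∈ Finset.range 5, σ^i = σ^j → i = j := by
    intro i hi j hj hij
    rw [Finset.mem_range] at hi hj
    exact pow_injOn_Iio_orderOf (by simpa [h.orderOf] using hi) (by simpa [h.orderOf] using hj) hij
  classical
  have : (Finset.univ : Finset (T ≃ₐ[K] T)) = (Finset.range 5).image (fun i => σ^i) := by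
    ext g; simp
    obtain ⟨n, hn, rfl⟩ := h.exists_pow g
    exact ⟨n, hn, rfl⟩
  rw [this, Finset.prod_image (fun i hi j hj hij => hinj i hi j hj hij)]
  simp [Finset.prod_range_succ, pow_succ]

lemma hilbert90 (h : KD ζ σ y) {x : T} (hx : Algebra.norm K x = 1) :
    ∃ t : T, t ≠ 0 ∧ x * σ t = t := by
  have := h.galois
  have : IsCyclic (T ≃ₐ[K] T) := ⟨σ, h.zpow⟩
  obtain ⟨t, ht⟩ := groupCohomology.exists_div_of_norm_eq_one h.zpow hx
  refine ⟨t, t.ne_zero, ?_⟩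
  have : σ (t : T) ≠ 0 := by simp
  rw [← ht]; field_simp

end KD
end St14

namespace St14

variable {K T : Type} [Field K] [NumberField K] [Field T] [NumberField T] [Algebra K T]

/-- norm on units -/
noncomputable def nU (K T : Type) [Field K] [NumberField K] [Field T] [NumberField T] [Algebra K T] :
    (𝓞 T)ˣ →* (𝓞 K)ˣ := Units.map (RingOfIntegers.norm K)

noncomputable def uS (τ : T ≃+* T) : (𝓞 T)ˣ →* (𝓞 T)ˣ := Units.map (oi τ : 𝓞 T →* 𝓞 T)

/-- `e ↦ σ e / e` -/
noncomputable def dU (τ : T ≃+* T) : (𝓞 T)ˣ →* (𝓞 T)ˣ := uS τ / MonoidHom.id _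

noncomputable def jU (K T : Type) [Field K] [NumberField K] [Field T] [NumberField T] [Algebra K T] :
    (𝓞 K)ˣ →* (𝓞 T)ˣ := Units.map (algebraMap (𝓞 K) (𝓞 T))

lemma uext {a b : (𝓞 T)ˣ} (h : ((a : 𝓞 T) : T) = ((b : 𝓞 T) : T)) : a = b :=
  Units.ext (RingOfIntegers.ext h)

@[simp] lemma nU_coe (e : (𝓞 T)ˣ) : (((nU K T e : (𝓞 K)ˣ) : 𝓞 K) : K) = Algebra.norm K ((e : 𝓞 T) : T) := rfl
@[simp] lemma uS_coe (τ : T ≃+* T) (e : (𝓞 T)ˣ) : (((uS τ e : (𝓞 T)ˣ) : 𝓞 T) : T) = τ ((e : 𝓞 T) : T) := rfl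
@[simp] lemma jU_coe (e : (𝓞 K)ˣ) : (((jU K T e : (𝓞 T)ˣ) : 𝓞 T) : T) = algebraMap K T ((e : 𝓞 K) : K) := rfl
lemma dU_apply (τ : T ≃+* T) (e : (𝓞 T)ˣ) : dU τ e = uS τ e / e := rfl

lemma jU_inj : Function.Injective (jU K T) := by
  intro a b hab
  have := congrArg (fun e : (𝓞 T)ˣ => ((e : 𝓞 T) : T)) hab
  simp only [jU_coe] at this
  exact uext ((algebraMap K T).injective this)

namespace KD
variable {ζ : K} {σ : T ≃ₐ[K] T} {y : T}

lemma int_fixed (h : KD ζ σ y) {x : 𝓞 T} (hx : σ (x : T) = x) :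
    ∃ k : 𝓞 K, algebraMap (𝓞 K) (𝓞 T) k = x := by
  obtain ⟨k, hk⟩ := h.fixed hx
  have : IsIntegral ℤ k := by
    rw [← isIntegral_algebraMap_iff (algebraMap K T).injective (B := T), hk]
    exact x.isIntegral_coe
  exact ⟨⟨k, this⟩, RingOfIntegers.ext hk⟩

lemma unit_fixed (h : KD ζ σ y) {x : (𝓞 T)ˣ} (hx : uS σ.toRingEquiv x = x) :
    ∃ k : (𝓞 K)ˣ, jU K T k = x := by
  have h1 : ∀ x : (𝓞 T)ˣ, uS σ.toRingEquiv x = x → ∃ k : 𝓞 K, algebraMap (𝓞 K) (𝓞 T) k = x := by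
    intro x hx
    apply h.int_fixed
    exact congrArg (fun e : (𝓞 T)ˣ => ((e : 𝓞 T) : T)) hx
  obtain ⟨k, hk⟩ := h1 x hx
  obtain ⟨k', hk'⟩ := h1 x⁻¹ (by rw [map_inv, hx])
  have : k * k' = 1 := by
    apply FaithfulSMul.algebraMap_injective (𝓞 K) (𝓞 T)
    rw [map_mul, hk, hk', map_one, Units.mul_inv]
  exact ⟨Units.mkOfMulEqOne k k' this, Units.ext hk⟩

theorem herbrand (h : KD ζ σ y) :
    (dU σ.toRingEquiv).range.relIndex (nU K T).ker *
      (powMonoidHom 5 : (𝓞 K)ˣ →* (𝓞 K)ˣ).range.relIndex (nU K T).range = 125 := by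
  let s : Module.End ℤ (Additive (𝓞 T)ˣ) := (MonoidHom.toAdditive (uS σ.toRingEquiv)).toIntLinearMap
  have hsx : ∀ x : (𝓞 T)ˣ, s (Additive.ofMul x) = Additive.ofMul (uS σ.toRingEquiv x) := fun x => rfl
  have hζT : IsPrimitiveRoot (algebraMap K T ζ) 5 := h.hζ.map_of_injective (algebraMap K T).injective
  have h9 : Module.finrank ℤ (Additive (𝓞 T)ˣ) = 9 := by
    rw [NumberField.Units.finrank_eq]
    have h1 := unit_rank hζT
    have h2 := Module.finrank_mul_finrank ℚ K T
    rw [h.hK, h.h5] at h2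
    omega
  have hs5 : s ^ 5 = 1 := by
    ext x
    induction x using Additive.rec with | _ x
    have : uS σ.toRingEquiv (uS σ.toRingEquiv (uS σ.toRingEquiv (uS σ.toRingEquiv (uS σ.toRingEquiv x)))) = x :=
      uext (h.s5 _)
    simp [pow_succ, hsx, this]
  have hP : ∀ x : (𝓞 T)ˣ, (1 + s + s^2 + s^3 + s^4 : Module.End ℤ (Additive (𝓞 T)ˣ)) (Additive.ofMul x)
      = Additive.ofMul (jU K T (nU K T x)) := by
    intro x
    have : jU K T (nU K T x) = x * uS σ.toRingEquiv x * uS σ.toRingEquiv (uS σ.toRingEquiv x) *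
      uS σ.toRingEquiv (uS σ.toRingEquiv (uS σ.toRingEquiv x)) *
      uS σ.toRingEquiv (uS σ.toRingEquiv (uS σ.toRingEquiv (uS σ.toRingEquiv x))) :=
      uext (h.norm_eq _)
    rw [this]
    simp [pow_succ, hsx]
  have hker : LinearMap.ker (s - 1) = (jU K T).range.toAddSubgroup.toIntSubmodule := by
    ext x
    induction x using Additive.rec with | _ x
    rw [LinearMap.mem_ker, LinearMap.sub_apply, sub_eq_zero]
    constructor
    · intro hx
      have hx' : uS σ.toRingEquiv x = x := hx
      obtain ⟨k, hk⟩ := h.unit_fixed hx'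
      exact ⟨k, hk⟩
    · rintro ⟨k, hk⟩
      have hk' : jU K T k = x := hk
      change uS σ.toRingEquiv x = x
      rw [← hk']
      exact uext (by simp)
  have hk : Module.finrank ℤ (LinearMap.ker (s - 1)) = 1 := by
    rw [hker]
    have e : (Additive (𝓞 K)ˣ) ≃+ (jU K T).range.toAddSubgroup := MulEquiv.toAdditive (MonoidHom.ofInjective jU_inj)
    have := e.toIntLinearEquiv.finrank_eq
    rw [NumberField.Units.finrank_eq] at this
    have h1 := unit_rank h.hζ
    rw [h.hK] at h1
    have h2 : Units.rank K = 1 := by omega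
    rw [h2] at this
    exact this.symm
  have hc : Nat.card {x : Additive (𝓞 T)ˣ // s x = x ∧ (5 : ℤ) • x = 0} = 5 := by
    have h1 := (hζT.toInteger_isPrimitiveRoot).card_rootsOfUnity
    rw [← h1]
    refine Nat.card_congr ⟨fun x => ⟨x.1.toMul, ?_⟩, fun x => ⟨Additive.ofMul x.1, ?_, ?_⟩, ?_, ?_⟩
    · rw [mem_rootsOfUnity]
      have := x.2.2
      have h2 := congrArg Additive.toMul this
      simpa using h2
    · rw [hsx]
      congr 1
      apply uext
      have h3 := (mem_rootsOfUnity _ _).1 x.2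
      have h4 : ((x.1 : 𝓞 T) : T) ^ 5 = 1 := by
        exact congrArg (fun e : (𝓞 T)ˣ => ((e : 𝓞 T) : T)) h3
      obtain ⟨i, hi, hi2⟩ := hζT.eq_pow_of_pow_eq_one h4
      rw [uS_coe, ← hi2]
      simp
    · have h3 := (mem_rootsOfUnity _ _).1 x.2
      have := congrArg Additive.ofMul h3
      rw [ofMul_pow, ofMul_one] at this
      rw [← this]; norm_cast
    · intro x; rfl
    · intro x; rfl
  have key := herbrand_abstract h9 s hs5 hk hc
  have c1 : (LinearMap.range (s - 1)).toAddSubgroup = (dU σ.toRingEquiv).range.toAddSubgroup := by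
    ext x; constructor
    · rintro ⟨z, rfl⟩; exact ⟨z.toMul, rfl⟩
    · rintro ⟨z, rfl⟩; exact ⟨Additive.ofMul z, rfl⟩
  have c2 : (LinearMap.ker (1 + s + s^2 + s^3 + s^4)).toAddSubgroup = (nU K T).ker.toAddSubgroup := by
    ext x
    induction x using Additive.rec with | _ x
    change (1 + s + s^2 + s^3 + s^4 : Module.End ℤ (Additive (𝓞 T)ˣ)) (Additive.ofMul x) = 0 ↔ nU K T x = 1
    rw [hP, ← (jU_inj (K := K) (T := T)).eq_iff, map_one]; rfl
  have c3 : (LinearMap.range (1 + s + s^2 + s^3 + s^4)).toAddSubgroup =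
      ((nU K T).range.map (jU K T)).toAddSubgroup := by
    ext x
    induction x using Additive.rec with | _ x
    constructor
    · rintro ⟨z, hz⟩
      exact ⟨nU K T z.toMul, ⟨z.toMul, rfl⟩, by rw [← hz]; exact (hP z.toMul).symm⟩
    · rintro ⟨_, ⟨z, rfl⟩, hz⟩
      exact ⟨Additive.ofMul z, (hP z).trans hz⟩
  have hnj : ∀ k, nU K T (jU K T k) = k^5 := by
    intro k
    apply uext
    rw [nU_coe, jU_coe, Algebra.norm_algebraMap, h.h5]; rfl
  have c4 : ((LinearMap.ker (s - 1)).map (1 + s + s^2 + s^3 + s^4)).toAddSubgroup =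
      ((powMonoidHom 5 : (𝓞 K)ˣ →* (𝓞 K)ˣ).range.map (jU K T)).toAddSubgroup := by
    rw [hker]
    ext x
    constructor
    · rintro ⟨_, ⟨k, rfl⟩, rfl⟩
      refine ⟨k^5, ⟨k, rfl⟩, ?_⟩
      rw [← hnj]
      exact (hP _).symm
    · rintro ⟨_, ⟨k, rfl⟩, rfl⟩
      refine ⟨Additive.ofMul (jU K T k), ⟨k, rfl⟩, ?_⟩
      rw [hP, hnj]; rfl
  rw [c1, c2, c3, c4, Subgroup.relIndex_toAddSubgroup, Subgroup.relIndex_toAddSubgroup,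
    Subgroup.relIndex_map_map_of_injective _ _ jU_inj] at key
  exact key

end KD
end St14

namespace St14

variable {K T : Type} [Field K] [NumberField K] [Field T] [NumberField T] [Algebra K T]

/-- action of a ring automorphism on ideals -/
noncomputable def iS (τ : T ≃+* T) : Ideal (𝓞 T) →+* Ideal (𝓞 T) := Ideal.mapHom (oi τ : 𝓞 T →+* 𝓞 T)

lemma iS_def (τ : T ≃+* T) (I : Ideal (𝓞 T)) : iS τ I = Ideal.map (oi τ) I := rfl

lemma mem_iS {τ : T ≃+* T} {I : Ideal (𝓞 T)} {x : 𝓞 T} : x ∈ iS τ I ↔ ∃ z ∈ I, oi τ z = x := by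
  rw [iS_def]; exact Ideal.mem_map_of_equiv (oi τ) x

lemma iS_mem {τ : T ≃+* T} {I : Ideal (𝓞 T)} {x : 𝓞 T} (hx : x ∈ I) : oi τ x ∈ iS τ I := mem_iS.2 ⟨x, hx, rfl⟩

lemma iS_comp (τ ρ : T ≃+* T) (I : Ideal (𝓞 T)) : iS τ (iS ρ I) = iS (τ * ρ) I := by
  ext x
  simp only [mem_iS]
  constructor
  · rintro ⟨_, ⟨z, hz, rfl⟩, rfl⟩; exact ⟨z, hz, rfl⟩
  · rintro ⟨z, hz, rfl⟩; exact ⟨_, ⟨z, hz, rfl⟩, rfl⟩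

lemma iS_one (I : Ideal (𝓞 T)) : iS (1 : T ≃+* T) I = I := by
  ext x
  simp only [mem_iS]
  constructor
  · rintro ⟨z, hz, rfl⟩; exact hz
  · intro hx; exact ⟨x, hx, rfl⟩

lemma iS_inj (τ : T ≃+* T) : Function.Injective (iS τ) := by
  intro I J h
  have := congrArg (iS τ⁻¹) h
  rwa [iS_comp, iS_comp, inv_mul_cancel, iS_one, iS_one] at this

lemma iS_span (τ : T ≃+* T) (x : 𝓞 T) : iS τ (Ideal.span {x}) = Ideal.span {oi τ x} := by
  rw [iS_def, Ideal.map_span, Set.image_singleton]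

lemma iS_prime (τ : T ≃+* T) {P : Ideal (𝓞 T)} (hP : P.IsPrime) : (iS τ P).IsPrime := by
  rw [iS_def]; exact Ideal.map_isPrime_of_equiv (oi τ)

lemma iS_ne_bot (τ : T ≃+* T) {P : Ideal (𝓞 T)} (hP : P ≠ ⊥) : iS τ P ≠ ⊥ := by
  intro h
  exact hP (iS_inj τ (by rw [h]; exact (map_zero (iS τ)).symm))

lemma iS_absNorm (τ : T ≃+* T) (I : Ideal (𝓞 T)) : Ideal.absNorm (iS τ I) = Ideal.absNorm I := by
  rw [Ideal.absNorm_apply, Ideal.absNorm_apply, Submodule.cardQuot_apply, Submodule.cardQuot_apply]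
  exact (Nat.card_congr (Ideal.quotientEquiv I (iS τ I) (oi τ) rfl).toEquiv).symm

/-- extension of ideals -/
noncomputable def iJ (K T : Type) [Field K] [NumberField K] [Field T] [NumberField T] [Algebra K T] :
    Ideal (𝓞 K) →+* Ideal (𝓞 T) := Ideal.mapHom (algebraMap (𝓞 K) (𝓞 T))

lemma iJ_def (I : Ideal (𝓞 K)) : iJ K T I = I.map (algebraMap (𝓞 K) (𝓞 T)) := rfl

lemma iJ_span (x : 𝓞 K) : iJ K T (Ideal.span {x}) = Ideal.span {algebraMap (𝓞 K) (𝓞 T) x} := by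
  rw [iJ_def, Ideal.map_span, Set.image_singleton]

lemma nI_span (x : 𝓞 T) : Ideal.relNorm (𝓞 K) (Ideal.span {x}) = Ideal.span {RingOfIntegers.norm K x} := by
  rw [Ideal.relNorm_singleton]
  congr 2
  apply RingOfIntegers.ext
  exact (Algebra.algebraMap_intNorm (A := 𝓞 K) (K := K) (L := T) x)

lemma ideal_pow_inj {A : Type} [CommRing A] [IsDomain A] [IsDedekindDomain A] {I J : Ideal A} {n : ℕ} (hn : n ≠ 0) (h : I^n = J^n) : I = J := by
  apply le_antisymm
  · rw [← Ideal.dvd_iff_le, ← UniqueFactorizationMonoid.pow_dvd_pow_iff_dvd hn, h]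
  · rw [← Ideal.dvd_iff_le, ← UniqueFactorizationMonoid.pow_dvd_pow_iff_dvd hn, h]

lemma finrank_int : Module.finrank (𝓞 K) (𝓞 T) = Module.finrank K T :=
  (IsFractionRing.finrank_eq (𝓞 K) K (𝓞 T) T).symm

namespace KD
variable {ζ : K} {σ : T ≃ₐ[K] T} {y : T}

lemma nI_iJ (h : KD ζ σ y) (I : Ideal (𝓞 K)) : Ideal.relNorm (𝓞 K) (iJ K T I) = I^5 := by
  rw [iJ_def, Ideal.relNorm_algebraMap, finrank_int, h.h5]

lemma nI_iS (I : Ideal (𝓞 T)) : Ideal.relNorm (𝓞 K) (iS σ.toRingEquiv I) = Ideal.relNorm (𝓞 K) I := by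
  have := Ideal.relNorm_map_algEquiv (RingOfIntegers.mapAlgEquiv σ : 𝓞 T ≃ₐ[𝓞 K] 𝓞 T) I
  exact this

lemma iS_iJ (I : Ideal (𝓞 K)) : iS σ.toRingEquiv (iJ K T I) = iJ K T I := by
  rw [iS_def, iJ_def]
  change Ideal.map (oi σ.toRingEquiv : 𝓞 T →+* 𝓞 T) _ = _
  rw [Ideal.map_map]
  congr 1
  ext x
  exact σ.commutes _

lemma iJ_nI (h : KD ζ σ y) (I : Ideal (𝓞 T)) : iJ K T (Ideal.relNorm (𝓞 K) I) =
    I * iS σ.toRingEquiv I * iS σ.toRingEquiv (iS σ.toRingEquiv I) *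
    iS σ.toRingEquiv (iS σ.toRingEquiv (iS σ.toRingEquiv I)) *
    iS σ.toRingEquiv (iS σ.toRingEquiv (iS σ.toRingEquiv (iS σ.toRingEquiv I))) := by
  by_cases hI : I = ⊥
  · subst hI
    rw [Ideal.relNorm_bot, ← Ideal.zero_eq_bot, map_zero, ← Ideal.zero_eq_bot, zero_mul, zero_mul, zero_mul, zero_mul]
  set B := I * iS σ.toRingEquiv I * iS σ.toRingEquiv (iS σ.toRingEquiv I) *
    iS σ.toRingEquiv (iS σ.toRingEquiv (iS σ.toRingEquiv I)) *
    iS σ.toRingEquiv (iS σ.toRingEquiv (iS σ.toRingEquiv (iS σ.toRingEquiv I))) with hB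
  have hle : iJ K T (Ideal.relNorm (𝓞 K) I) ≤ B := by
    rw [Ideal.relNorm_apply, iJ_def, Ideal.map_span, Ideal.span_le]
    rintro _ ⟨_, ⟨x, hx, rfl⟩, rfl⟩
    have : algebraMap (𝓞 K) (𝓞 T) (Algebra.intNorm (𝓞 K) (𝓞 T) x) = x * oi σ.toRingEquiv x *
      oi σ.toRingEquiv (oi σ.toRingEquiv x) * oi σ.toRingEquiv (oi σ.toRingEquiv (oi σ.toRingEquiv x)) *
      oi σ.toRingEquiv (oi σ.toRingEquiv (oi σ.toRingEquiv (oi σ.toRingEquiv x))) := by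
      apply RingOfIntegers.ext
      have h1 := h.norm_eq (x : T)
      rw [← Algebra.algebraMap_intNorm (A := 𝓞 K) (K := K) (L := T) x] at h1
      exact h1
    rw [this]
    exact Ideal.mul_mem_mul (Ideal.mul_mem_mul (Ideal.mul_mem_mul (Ideal.mul_mem_mul hx (iS_mem hx)) (iS_mem (iS_mem hx)))
      (iS_mem (iS_mem (iS_mem hx)))) (iS_mem (iS_mem (iS_mem (iS_mem hx))))
  obtain ⟨C, hC⟩ := Ideal.dvd_iff_le.2 hle
  have h1 : Ideal.absNorm (iJ K T (Ideal.relNorm (𝓞 K) I)) = Ideal.absNorm I ^ 5 := by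
    rw [iJ_def, Ideal.absNorm_algebraMap, finrank_int, h.h5, Ideal.absNorm_relNorm]
  have h2 : Ideal.absNorm B = Ideal.absNorm I ^ 5 := by
    simp only [hB, map_mul, iS_absNorm]; ring
  have h3 : Ideal.absNorm I ≠ 0 := by rwa [Ne, Ideal.absNorm_eq_zero_iff]
  have h4 : Ideal.absNorm C = 1 := by
    have := congrArg Ideal.absNorm hC
    rw [h1, map_mul, h2] at this
    have h5 : Ideal.absNorm I ^ 5 ≠ 0 := pow_ne_zero _ h3
    exact (mul_eq_left₀ h5).1 this.symm
  rw [Ideal.absNorm_eq_one_iff] at h4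
  rw [hC, h4, Ideal.mul_top]

lemma iJ_inj (h : KD ζ σ y) : Function.Injective (iJ K T) := by
  intro I J hIJ
  have h2 := congrArg (Ideal.relNorm (𝓞 K)) hIJ
  rw [h.nI_iJ, h.nI_iJ] at h2
  exact ideal_pow_inj (by norm_num) h2

lemma iS5 (h : KD ζ σ y) (I : Ideal (𝓞 T)) :
    iS σ.toRingEquiv (iS σ.toRingEquiv (iS σ.toRingEquiv (iS σ.toRingEquiv (iS σ.toRingEquiv I)))) = I := by
  simp only [iS_comp]
  convert iS_one I
  ext x
  exact h.s5 x

lemma distinct (h : KD ζ σ y) {P : Ideal (𝓞 T)} (hP : iS σ.toRingEquiv P ≠ P) :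
    iS σ.toRingEquiv (iS σ.toRingEquiv P) ≠ P ∧ iS σ.toRingEquiv (iS σ.toRingEquiv (iS σ.toRingEquiv P)) ≠ P ∧
    iS σ.toRingEquiv (iS σ.toRingEquiv (iS σ.toRingEquiv (iS σ.toRingEquiv P))) ≠ P := by
  have h5 := h.iS5 P
  refine ⟨fun h2 => hP ?_, fun h2 => hP ?_, fun h2 => hP ?_⟩
  · rw [h2, h2] at h5; exact h5
  · rw [h2] at h5
    rw [h5] at h2; exact h2
  · rw [h2] at h5; exact h5

lemma prime_cases (h : KD ζ σ y) {P : Ideal (𝓞 T)} (hP : P.IsPrime) (hP0 : P ≠ ⊥) :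
    (iS σ.toRingEquiv P = P ∧ P^5 = iJ K T (P.comap (algebraMap (𝓞 K) (𝓞 T))) ∧
      Ideal.relNorm (𝓞 K) P = P.comap (algebraMap (𝓞 K) (𝓞 T))) ∨
    (P = iJ K T (P.comap (algebraMap (𝓞 K) (𝓞 T)))) ∨
    (iS σ.toRingEquiv P ≠ P ∧ iJ K T (P.comap (algebraMap (𝓞 K) (𝓞 T))) =
      P * iS σ.toRingEquiv P * iS σ.toRingEquiv (iS σ.toRingEquiv P) *
      iS σ.toRingEquiv (iS σ.toRingEquiv (iS σ.toRingEquiv P)) *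
      iS σ.toRingEquiv (iS σ.toRingEquiv (iS σ.toRingEquiv (iS σ.toRingEquiv P))) ∧
      Ideal.relNorm (𝓞 K) P = P.comap (algebraMap (𝓞 K) (𝓞 T))) := by
  set p := P.comap (algebraMap (𝓞 K) (𝓞 T)) with hp
  have hpp : p.IsPrime := Ideal.comap_isPrime _ _
  have : P.LiesOver p := ⟨rfl⟩
  have hPprime : Prime P := Ideal.prime_of_isPrime hP0 hP
  obtain ⟨s, hs⟩ := Ideal.exists_relNorm_eq_pow_of_isPrime P p
  have hle : P ∣ iJ K T p := Ideal.dvd_iff_le.2 Ideal.map_comap_le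
  have key := h.iJ_nI P
  rw [hs, map_pow] at key
  have hs0 : s ≠ 0 := by
    rintro rfl
    rw [pow_zero] at key
    simp only [mul_assoc] at key
    exact hPprime.not_unit (isUnit_of_dvd_one ⟨_, key⟩)
  by_cases hSP : iS σ.toRingEquiv P = P
  · simp only [hSP] at key
    have key' : (iJ K T p)^s = P^5 := by rw [key]; ring
    have hd : iJ K T p ∣ P^5 := by rw [← key']; exact dvd_pow_self _ hs0
    obtain ⟨i, hi, hi2⟩ := (dvd_prime_pow hPprime _).1 hd
    rw [associated_iff_eq] at hi2
    rw [hi2, ← pow_mul] at key'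
    have h5 : i * s = 5 := (pow_inj_of_not_isUnit hPprime.not_unit hPprime.ne_zero).1 key'
    have : i ∣ 5 := ⟨s, h5.symm⟩
    rcases (Nat.dvd_prime (by norm_num)).1 this with rfl | rfl
    · right; left; rw [hi2, pow_one]
    · left
      have : s = 1 := by omega
      subst this
      exact ⟨hSP, hi2.symm, by rw [hs, pow_one]⟩
  · right; right
    have hs1 : s = 1 := by
      by_contra hs1
      have h2 : 2 ≤ s := by omega
      have h3 : P^2 ∣ (iJ K T p)^s := (pow_dvd_pow_of_dvd hle 2).trans (pow_dvd_pow _ h2)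
      rw [key, pow_two, mul_assoc, mul_assoc, mul_assoc] at h3
      have h4 := (mul_dvd_mul_iff_left hPprime.ne_zero).1 h3
      have hmax : ∀ Q : Ideal (𝓞 T), Q.IsPrime → Q ≠ ⊥ → P ∣ Q → Q = P := by
        intro Q hQ hQ0 hd
        have := hQ.isMaximal hQ0
        exact this.eq_of_le hP.ne_top (Ideal.dvd_iff_le.1 hd)
      obtain ⟨d2, d3, d4⟩ := h.distinct hSP
      rcases hPprime.dvd_or_dvd h4 with h4 | h4
      · exact hSP (hmax _ (iS_prime _ hP) (iS_ne_bot _ hP0) h4)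
      rcases hPprime.dvd_or_dvd h4 with h4 | h4
      · exact d2 (hmax _ (iS_prime _ (iS_prime _ hP)) (iS_ne_bot _ (iS_ne_bot _ hP0)) h4)
      rcases hPprime.dvd_or_dvd h4 with h4 | h4
      · exact d3 (hmax _ (iS_prime _ (iS_prime _ (iS_prime _ hP))) (iS_ne_bot _ (iS_ne_bot _ (iS_ne_bot _ hP0))) h4)
      · exact d4 (hmax _ (iS_prime _ (iS_prime _ (iS_prime _ (iS_prime _ hP)))) (iS_ne_bot _ (iS_ne_bot _ (iS_ne_bot _ (iS_ne_bot _ hP0)))) h4)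
    subst hs1
    rw [pow_one] at key hs
    exact ⟨hSP, key, hs⟩

end KD

/-- totally ramified prime -/
def Ram (K : Type) {T : Type} [Field K] [NumberField K] [Field T] [NumberField T] [Algebra K T]
    (P : Ideal (𝓞 T)) : Prop :=
  P.IsPrime ∧ P ≠ ⊥ ∧ P^5 = iJ K T (P.comap (algebraMap (𝓞 K) (𝓞 T)))

namespace KD
variable {ζ : K} {σ : T ≃ₐ[K] T} {y : T}

lemma comap_iS (P : Ideal (𝓞 T)) : (iS σ.toRingEquiv P).comap (algebraMap (𝓞 K) (𝓞 T)) = P.comap (algebraMap (𝓞 K) (𝓞 T)) := by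
  ext k
  rw [Ideal.mem_comap, Ideal.mem_comap]
  have : ∀ k : 𝓞 K, oi σ.toRingEquiv (algebraMap (𝓞 K) (𝓞 T) k) = algebraMap (𝓞 K) (𝓞 T) k :=
    fun k => RingOfIntegers.ext (σ.commutes _)
  constructor
  · intro hk
    obtain ⟨z, hz, hz2⟩ := mem_iS.1 hk
    rw [← this k] at hz2
    rwa [← (oi σ.toRingEquiv).injective hz2]
  · intro hk
    rw [← this k]; exact iS_mem hk

lemma ram_fixed (h : KD ζ σ y) {P : Ideal (𝓞 T)} (hP : Ram K P) : iS σ.toRingEquiv P = P := by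
  have h1 : (iS σ.toRingEquiv P)^5 = P^5 := by rw [← map_pow, hP.2.2, iS_iJ]
  exact ideal_pow_inj (by norm_num) h1

lemma ram_norm (h : KD ζ σ y) {P : Ideal (𝓞 T)} (hP : Ram K P) :
    Ideal.relNorm (𝓞 K) P = P.comap (algebraMap (𝓞 K) (𝓞 T)) := by
  rcases h.prime_cases hP.1 hP.2.1 with h1 | h1 | h1
  · exact h1.2.2
  · have h2 := hP.2.2
    rw [← h1] at h2
    have hPprime : Prime P := Ideal.prime_of_isPrime hP.2.1 hP.1
    have := (pow_inj_of_not_isUnit hPprime.not_unit hPprime.ne_zero (n := 1) (m := 5)).1 (by rw [h2, pow_one])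
    omega
  · exact h1.2.2

lemma ram_comap_ne (hP : Ram K (T := T) P) : P.comap (algebraMap (𝓞 K) (𝓞 T)) ≠ ⊥ := by
  intro h1
  have := hP.2.2
  rw [h1, ← Ideal.zero_eq_bot, map_zero] at this
  exact hP.2.1 (eq_zero_of_pow_eq_zero this)

/-- residue fields of a prime whose norm is its restriction -/
lemma resid {P : Ideal (𝓞 T)} (hP0 : P ≠ ⊥)
    (hn : Ideal.relNorm (𝓞 K) P = P.comap (algebraMap (𝓞 K) (𝓞 T))) (x : 𝓞 T) :
    ∃ k : 𝓞 K, x - algebraMap (𝓞 K) (𝓞 T) k ∈ P := by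
  have hc := Ideal.absNorm_relNorm (𝓞 K) (𝓞 T) P
  rw [hn] at hc
  rw [Ideal.absNorm_apply, Ideal.absNorm_apply, Submodule.cardQuot_apply, Submodule.cardQuot_apply] at hc
  have hfin : Finite (𝓞 T ⧸ P) := Ideal.finiteQuotientOfFreeOfNeBot P hP0
  let f : (𝓞 K ⧸ P.comap (algebraMap (𝓞 K) (𝓞 T))) →+* (𝓞 T ⧸ P) := Ideal.quotientMap P (algebraMap (𝓞 K) (𝓞 T)) le_rfl
  have hf : Function.Injective f := Ideal.quotientMap_injective
  have hb : Function.Bijective f := by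
    have : Finite (𝓞 K ⧸ P.comap (algebraMap (𝓞 K) (𝓞 T))) := Finite.of_injective f hf
    exact (Nat.bijective_iff_injective_and_card f).2 ⟨hf, hc⟩
  obtain ⟨k, hk⟩ := hb.2 (Ideal.Quotient.mk P x)
  obtain ⟨k, rfl⟩ := Ideal.Quotient.mk_surjective k
  refine ⟨k, ?_⟩
  rw [Ideal.quotientMap_mk] at hk
  exact Ideal.Quotient.eq.1 hk.symm

lemma ram_sub (h : KD ζ σ y) {P : Ideal (𝓞 T)} (hP : Ram K P) (x : 𝓞 T) :
    oi σ.toRingEquiv x - x ∈ P := by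
  obtain ⟨k, hk⟩ := resid hP.2.1 (h.ram_norm hP) x
  have h1 := iS_mem (τ := σ.toRingEquiv) hk
  rw [h.ram_fixed hP, map_sub] at h1
  have : oi σ.toRingEquiv (algebraMap (𝓞 K) (𝓞 T) k) = algebraMap (𝓞 K) (𝓞 T) k := RingOfIntegers.ext (σ.commutes _)
  rw [this] at h1
  have := P.sub_mem h1 hk
  simpa using this

end KD
end St14

namespace St14

variable {K T : Type} [Field K] [NumberField K] [Field T] [NumberField T] [Algebra K T]

lemma mul_dvd_of_prime {I J P : Ideal (𝓞 T)} (hP : Prime P) (h1 : P ∣ I) (h2 : J ∣ I) (h3 : ¬ P ∣ J) : J * P ∣ I := by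
  obtain ⟨C, rfl⟩ := h2
  exact mul_dvd_mul_left J ((hP.dvd_or_dvd h1).resolve_left h3)

lemma prime_dvd_prime_eq {P Q : Ideal (𝓞 T)} (hP : Prime P) (hQ : Prime Q) (h : P ∣ Q) : P = Q :=
  associated_iff_eq.1 (hP.associated_of_dvd hQ h)

lemma iS_Prime (τ : T ≃+* T) {P : Ideal (𝓞 T)} (hP : Prime P) : Prime (iS τ P) :=
  Ideal.prime_of_isPrime (iS_ne_bot τ hP.ne_zero) (iS_prime τ (Ideal.isPrime_of_prime hP))

namespace KD
variable {ζ : K} {σ : T ≃ₐ[K] T} {y : T}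

/-- invariant ideals are products of ramified primes and an ideal from below -/
lemma ambig [IsPrincipalIdealRing (𝓞 K)] (h : KD ζ σ y) (n : ℕ) : ∀ (I : Ideal (𝓞 T)), I ≠ ⊥ →
    iS σ.toRingEquiv I = I → Ideal.absNorm I = n →
    ∃ k : 𝓞 K, k ≠ 0 ∧ ∃ m : Multiset (Ideal (𝓞 T)), (∀ P ∈ m, Ram K P) ∧
      I = Ideal.span {algebraMap (𝓞 K) (𝓞 T) k} * m.prod := by
  induction n using Nat.strong_induction_on with
  | _ n ih =>
  intro I hI hSI hn
  by_cases htop : I = ⊤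
  · exact ⟨1, one_ne_zero, 0, by simp, by simp [htop]⟩
  obtain ⟨P, hPm, hIP⟩ := Ideal.exists_le_maximal I htop
  have hP0 : P ≠ ⊥ := by
    rintro rfl
    exact hI (le_bot_iff.1 hIP)
  have hPp : Prime P := Ideal.prime_of_isPrime hP0 hPm.isPrime
  have hPI : P ∣ I := Ideal.dvd_iff_le.2 hIP
  have step : ∀ Q : Ideal (𝓞 T), iS σ.toRingEquiv Q = Q → Q ≠ ⊤ → Q ∣ I →
    ∃ J : Ideal (𝓞 T), I = Q * J ∧ ∃ k : 𝓞 K, k ≠ 0 ∧ ∃ m : Multiset (Ideal (𝓞 T)), (∀ P ∈ m, Ram K P) ∧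
      J = Ideal.span {algebraMap (𝓞 K) (𝓞 T) k} * m.prod := by
    rintro Q hQ hQt ⟨J, hJ⟩
    have hQ0 : Q ≠ ⊥ := by rintro rfl; exact hI (by rw [hJ, Ideal.bot_mul])
    have hJ0 : J ≠ ⊥ := by rintro rfl; exact hI (by rw [hJ, Ideal.mul_bot])
    refine ⟨J, hJ, ih (Ideal.absNorm J) ?_ J hJ0 ?_ rfl⟩
    · rw [← hn, hJ, map_mul]
      have a1 : Ideal.absNorm J ≠ 0 := by rwa [Ne, Ideal.absNorm_eq_zero_iff]
      have a2 : Ideal.absNorm Q ≠ 0 := by rwa [Ne, Ideal.absNorm_eq_zero_iff]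
      have a3 : Ideal.absNorm Q ≠ 1 := by rwa [Ne, Ideal.absNorm_eq_one_iff]
      have : 2 ≤ Ideal.absNorm Q := by omega
      nlinarith [Nat.pos_of_ne_zero a1]
    · rw [hJ, map_mul, hQ] at hSI
      exact mul_left_cancel₀ hQ0 hSI
  have stepK : ∀ p : Ideal (𝓞 K), iJ K T p ≠ ⊤ → iJ K T p ∣ I → ∃ k : 𝓞 K, k ≠ 0 ∧ ∃ m : Multiset (Ideal (𝓞 T)), (∀ P ∈ m, Ram K P) ∧
      I = Ideal.span {algebraMap (𝓞 K) (𝓞 T) k} * m.prod := by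
    intro p hpt hpI
    obtain ⟨J, hJ, k, hk, m, hm, hm2⟩ := step _ (iS_iJ p) hpt hpI
    obtain ⟨k0, hk0⟩ := IsPrincipalIdealRing.principal p
    rw [Ideal.submodule_span_eq] at hk0
    have hk00 : k0 ≠ 0 := by
      rintro rfl
      rw [hk0, Ideal.span_singleton_zero, ← Ideal.zero_eq_bot, map_zero] at hJ
      exact hI (by rw [hJ, zero_mul]; rfl)
    refine ⟨k0 * k, mul_ne_zero hk00 hk, m, hm, ?_⟩
    rw [hJ, hm2, hk0, iJ_span, map_mul, ← Ideal.span_singleton_mul_span_singleton, mul_assoc]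
  rcases h.prime_cases hPm.isPrime hP0 with h1 | h1 | h1
  · obtain ⟨J, hJ, k, hk, m, hm, hm2⟩ := step P h1.1 hPm.ne_top hPI
    refine ⟨k, hk, P ::ₘ m, ?_, ?_⟩
    · intro Q hQ
      rcases Multiset.mem_cons.1 hQ with rfl | hQ
      · exact ⟨hPm.isPrime, hP0, h1.2.1⟩
      · exact hm Q hQ
    · rw [Multiset.prod_cons, hJ, hm2]; ring
  · exact stepK _ (by rw [← h1]; exact hPm.ne_top) (by rw [← h1]; exact hPI)
  · refine stepK (P.comap (algebraMap (𝓞 K) (𝓞 T))) ?_ ?_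
    · intro ht
      apply hPm.ne_top
      rw [eq_top_iff, ← ht]
      exact Ideal.map_comap_le
    · obtain ⟨d1, d2, -⟩ := h1
      obtain ⟨e2, e3, e4⟩ := h.distinct d1
      rw [d2]
      set s := iS σ.toRingEquiv with hs
      have p1 := iS_Prime σ.toRingEquiv hPp
      have p2 := iS_Prime σ.toRingEquiv p1
      have p3 := iS_Prime σ.toRingEquiv p2
      have p4 := iS_Prime σ.toRingEquiv p3
      have dv : ∀ Q, Q ∣ I → s Q ∣ I := by
        rintro Q hQ
        have := map_dvd s hQ
        rwa [hSI] at this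
      have inj : Function.Injective s := iS_inj _
      have q1 := dv _ hPI
      have q2 := dv _ q1
      have q3 := dv _ q2
      have q4 := dv _ q3
      have f : ∀ {Q R : Ideal (𝓞 T)}, Prime Q → Prime R → R ≠ Q → ¬ Q ∣ R := by
        intro Q R hQ hR hne hd
        exact hne (prime_dvd_prime_eq hQ hR hd).symm
      refine mul_dvd_of_prime p4 q4 (mul_dvd_of_prime p3 q3 (mul_dvd_of_prime p2 q2 (mul_dvd_of_prime p1 q1 hPI ?_) ?_) ?_) ?_
      · exact f p1 hPp (Ne.symm d1)
      · rw [p2.dvd_mul]; push Not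
        exact ⟨f p2 hPp (Ne.symm e2), f p2 p1 (fun e => d1 (inj e).symm)⟩
      · rw [p3.dvd_mul, p3.dvd_mul]; push Not
        exact ⟨⟨f p3 hPp (Ne.symm e3), f p3 p1 (fun e => e2 (inj e).symm)⟩, f p3 p2 (fun e => d1 (inj (inj e)).symm)⟩
      · rw [p4.dvd_mul, p4.dvd_mul, p4.dvd_mul]; push Not
        exact ⟨⟨⟨f p4 hPp (Ne.symm e4), f p4 p1 (fun e => e3 (inj e).symm)⟩, f p4 p2 (fun e => e2 (inj (inj e)).symm)⟩,
          f p4 p3 (fun e => d1 (inj (inj (inj e))).symm)⟩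

lemma rel_unit {I : Ideal (𝓞 T)} (hI : I ≠ ⊥) {a b : 𝓞 T}
    (hab : Ideal.span {a} * iS σ.toRingEquiv I = Ideal.span {b} * I) :
    ∃ u : (𝓞 K)ˣ, RingOfIntegers.norm K b = u * RingOfIntegers.norm K a := by
  have h1 := congrArg (Ideal.relNorm (𝓞 K)) hab
  rw [map_mul, map_mul, nI_iS, nI_span, nI_span] at h1
  have h0 : Ideal.relNorm (𝓞 K) I ≠ 0 := by
    rw [Ne, Ideal.zero_eq_bot, Ideal.relNorm_eq_bot_iff]; exact hI
  have h2 := mul_right_cancel₀ h0 h1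
  rw [Ideal.span_singleton_eq_span_singleton] at h2
  obtain ⟨u, hu⟩ := h2
  exact ⟨u, by rw [← hu, mul_comm]⟩

lemma clear_den (t : T) : ∃ n : ℤ, n ≠ 0 ∧ ∃ s : 𝓞 T, (s : T) = n * t := by
  have h1 : IsAlgebraic ℤ t := by
    rw [IsFractionRing.isAlgebraic_iff ℤ ℚ T]
    exact Algebra.IsAlgebraic.isAlgebraic t
  obtain ⟨n, hn, hi⟩ := h1.exists_integral_multiple
  exact ⟨n, hn, ⟨_, hi⟩, by simp⟩

lemma norm_div (a b : T) (hb : b ≠ 0) : Algebra.norm K (a / b) = Algebra.norm K a / Algebra.norm K b := by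
  have : Algebra.norm K b ≠ 0 := by rwa [Ne, Algebra.norm_eq_zero_iff]
  rw [eq_div_iff this, ← map_mul, div_mul_cancel₀ _ hb]

/-- an ideal with `(a) σ I = (b) I` and `N b = N w * N a`, `w` unit, is equivalent to an invariant ideal -/
lemma rel_amb (h : KD ζ σ y) {I : Ideal (𝓞 T)} (hI : I ≠ ⊥) {a b : 𝓞 T} (ha : a ≠ 0) (hb : b ≠ 0)
    (hab : Ideal.span {a} * iS σ.toRingEquiv I = Ideal.span {b} * I) (w : (𝓞 T)ˣ)
    (hw : RingOfIntegers.norm K b = nU K T w * RingOfIntegers.norm K a) :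
    ∃ t : 𝓞 T, t ≠ 0 ∧ iS σ.toRingEquiv (Ideal.span {t} * I) = Ideal.span {t} * I := by
  have ha' : (a : T) ≠ 0 := by simpa using ha
  have hb' : (b : T) ≠ 0 := by simpa using hb
  have hw' : ((w : 𝓞 T) : T) ≠ 0 := by simp
  have hn : Algebra.norm K ((b : T) / (w * a)) = 1 := by
    rw [norm_div _ _ (mul_ne_zero hw' ha'), map_mul]
    have := congrArg (fun e : 𝓞 K => (e : K)) hw
    simp only [map_mul] at this
    have h2 : Algebra.norm K (b : T) = Algebra.norm K ((w : 𝓞 T) : T) * Algebra.norm K (a : T) := this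
    rw [h2, div_self]
    rw [← map_mul]
    rw [Ne, Algebra.norm_eq_zero_iff]
    exact mul_ne_zero hw' ha'
  obtain ⟨t, ht0, ht⟩ := h.hilbert90 hn
  obtain ⟨n, hn0, s, hs⟩ := clear_den t
  have hs0 : s ≠ 0 := by
    intro h0
    rw [h0] at hs
    simp [hn0, ht0] at hs
  refine ⟨s, hs0, ?_⟩
  have key : b * oi σ.toRingEquiv s = w * a * s := by
    apply RingOfIntegers.ext
    have hs' : σ (s : T) = n * σ t := by rw [hs, map_mul, map_intCast]
    have e1 : (b : T) * σ (s : T) = w * a * s := by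
      rw [div_mul_eq_mul_div, div_eq_iff (mul_ne_zero hw' ha')] at ht
      rw [hs', hs]
      linear_combination (n : T) * ht
    exact e1
  have h3 : Ideal.span {b} * Ideal.span {oi σ.toRingEquiv s} = Ideal.span {a} * Ideal.span {s} := by
    rw [Ideal.span_singleton_mul_span_singleton, Ideal.span_singleton_mul_span_singleton, key, mul_assoc,
      Ideal.span_singleton_mul_left_unit w.isUnit]
  have ha0 : Ideal.span {a} ≠ 0 := by simpa using ha
  apply mul_left_cancel₀ ha0
  rw [map_mul, iS_span]
  calc _ = Ideal.span {oi σ.toRingEquiv s} * (Ideal.span {a} * iS σ.toRingEquiv I) := by ring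
    _ = (Ideal.span {b} * Ideal.span {oi σ.toRingEquiv s}) * I := by rw [hab]; ring
    _ = _ := by rw [h3]; ring

end KD
end St14

namespace St14

/-- valuation of an ideal at a prime -/
noncomputable def vv {M : Type} [Field M] [NumberField M] (P I : Ideal (𝓞 M)) : ℕ := multiplicity P I

section
variable {M : Type} [Field M] [NumberField M] {P I J : Ideal (𝓞 M)}

lemma vv_fin (hP : Prime P) (hI : I ≠ 0) : FiniteMultiplicity P I := FiniteMultiplicity.of_prime_left hP hI

lemma vv_mul (hP : Prime P) (hI : I ≠ 0) (hJ : J ≠ 0) : vv P (I * J) = vv P I + vv P J :=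
  multiplicity_mul hP (vv_fin hP (mul_ne_zero hI hJ))

lemma vv_self (hP : Prime P) : vv P P = 1 := by
  have := vv_fin hP hP.ne_zero
  exact multiplicity_self

lemma vv_zero (h : ¬ P ∣ I) : vv P I = 0 := multiplicity_eq_zero.2 h

lemma vv_one (hP : Prime P) : vv P 1 = 0 := vv_zero (fun h => hP.not_unit (isUnit_of_dvd_one h))

lemma vv_pow (hP : Prime P) (hI : I ≠ 0) (n : ℕ) : vv P (I^n) = n * vv P I := by
  induction n with
  | zero => rw [pow_zero, vv_one hP, zero_mul]
  | succ n ih => rw [pow_succ, vv_mul hP (pow_ne_zero _ hI) hI, ih]; ring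

lemma vv_dec (hP : Prime P) (hI : I ≠ 0) : ∃ J, I = P^(vv P I) * J ∧ ¬ P ∣ J :=
  (vv_fin hP hI).exists_eq_pow_mul_and_not_dvd

lemma vv_prod (hP : Prime P) {ι : Type} (s : Finset ι) (f : ι → Ideal (𝓞 M)) (hf : ∀ i, f i ≠ 0) :
    vv P (∏ i ∈ s, f i) = ∑ i ∈ s, vv P (f i) := by
  classical
  induction s using Finset.induction_on with
  | empty => rw [Finset.prod_empty, Finset.sum_empty, vv_one hP]
  | insert a s ha ih =>
    rw [Finset.prod_insert ha, Finset.sum_insert ha, vv_mul hP (hf a) (Finset.prod_ne_zero_iff.2 fun i _ => hf i), ih]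

lemma vv_ne {Q : Ideal (𝓞 M)} (hP : Prime P) (hQ : Prime Q) (h : P ≠ Q) : vv P Q = 0 :=
  vv_zero (fun hd => h (associated_iff_eq.1 (hP.associated_of_dvd hQ hd)))

end

variable {K T : Type} [Field K] [NumberField K] [Field T] [NumberField T] [Algebra K T]

lemma iJ_ne_zero {I : Ideal (𝓞 K)} (hI : I ≠ 0) : iJ K T I ≠ 0 := by
  rw [iJ_def, Ideal.zero_eq_bot, Ne, Ideal.map_eq_bot_iff_of_injective (FaithfulSMul.algebraMap_injective (𝓞 K) (𝓞 T))]
  exact hI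

namespace Ram
variable {P : Ideal (𝓞 T)}

lemma prime (hP : Ram K P) : Prime P := Ideal.prime_of_isPrime hP.2.1 hP.1

lemma primeK (hP : Ram K P) : Prime (P.comap (algebraMap (𝓞 K) (𝓞 T))) :=
  have := hP.1
  Ideal.prime_of_isPrime (KD.ram_comap_ne hP) (Ideal.comap_isPrime _ _)

lemma vv_iJ (hP : Ram K P) {I : Ideal (𝓞 K)} (hI : I ≠ 0) :
    vv P (iJ K T I) = 5 * vv (P.comap (algebraMap (𝓞 K) (𝓞 T))) I := by
  obtain ⟨J, hJ, hJ2⟩ := vv_dec hP.primeK hI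
  have hJ0 : J ≠ 0 := by rintro rfl; exact hJ2 (dvd_zero _)
  conv_lhs => rw [hJ]
  rw [map_mul, map_pow, ← hP.2.2, vv_mul hP.prime (pow_ne_zero _ (pow_ne_zero _ hP.prime.ne_zero)) (iJ_ne_zero hJ0),
    vv_pow hP.prime (pow_ne_zero _ hP.prime.ne_zero), vv_pow hP.prime hP.prime.ne_zero, vv_self hP.prime, vv_zero (I := iJ K T J)]
  · ring
  · intro hd
    apply hJ2
    rw [Ideal.dvd_iff_le] at hd ⊢
    exact Ideal.map_le_iff_le_comap.1 hd

end Ram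

namespace KD
variable {ζ : K} {σ : T ≃ₐ[K] T} {y : T} {P : Ideal (𝓞 T)}

lemma dvd_iS (h : KD ζ σ y) (hP : Ram K P) {I : Ideal (𝓞 T)} : P ∣ iS σ.toRingEquiv I ↔ P ∣ I := by
  constructor
  · rintro ⟨J, hJ⟩
    refine ⟨iS σ.toRingEquiv⁻¹ J, ?_⟩
    apply iS_inj σ.toRingEquiv
    rw [hJ, map_mul, h.ram_fixed hP, iS_comp, mul_inv_cancel, iS_one]
  · intro hd
    have := map_dvd (iS σ.toRingEquiv) hd
    rwa [h.ram_fixed hP] at this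

lemma vv_nI (h : KD ζ σ y) (hP : Ram K P) {I : Ideal (𝓞 T)} (hI : I ≠ 0) :
    vv (P.comap (algebraMap (𝓞 K) (𝓞 T))) (Ideal.relNorm (𝓞 K) I) = vv P I := by
  obtain ⟨J, hJ, hJ2⟩ := vv_dec hP.prime hI
  have hJ0 : J ≠ 0 := by rintro rfl; exact hJ2 (dvd_zero _)
  have hn0 : Ideal.relNorm (𝓞 K) J ≠ 0 := by rw [Ideal.zero_eq_bot, Ne, Ideal.relNorm_eq_bot_iff]; exact hJ0
  conv_lhs => rw [hJ]
  rw [map_mul, map_pow, h.ram_norm hP, vv_mul hP.primeK (pow_ne_zero _ hP.primeK.ne_zero) hn0,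
    vv_pow hP.primeK hP.primeK.ne_zero, vv_self hP.primeK, vv_zero (I := Ideal.relNorm (𝓞 K) J)]
  · ring
  · intro hd
    apply hJ2
    have h1 : P ∣ iJ K T (Ideal.relNorm (𝓞 K) J) := by
      rw [Ideal.dvd_iff_le] at hd ⊢
      exact Ideal.map_le_iff_le_comap.2 hd
    rw [h.iJ_nI, hP.prime.dvd_mul, hP.prime.dvd_mul, hP.prime.dvd_mul, hP.prime.dvd_mul] at h1
    simpa only [h.dvd_iS hP, or_self] using h1

/-- local condition: a norm which is a unit at a ramified prime is a fifth power there -/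
lemma local_norm [IsPrincipalIdealRing (𝓞 K)] (h : KD ζ σ y) (hP : Ram K P) {u : 𝓞 K}
    (hu : u ∉ P.comap (algebraMap (𝓞 K) (𝓞 T))) {x : T} (hx : Algebra.norm K x = u) :
    ∃ k : 𝓞 K, u - k^5 ∈ P.comap (algebraMap (𝓞 K) (𝓞 T)) := by
  set p := P.comap (algebraMap (𝓞 K) (𝓞 T)) with hp
  have hpP : Prime p := hP.primeK
  have hpp : p.IsPrime := Ideal.isPrime_of_prime hpP
  have hpm : p.IsMaximal := hpp.isMaximal hpP.ne_zero
  obtain ⟨n, hn, a, ha⟩ := clear_den x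
  have hu0 : u ≠ 0 := by rintro rfl; exact hu p.zero_mem
  have hx0 : x ≠ 0 := by
    rintro rfl
    rw [Algebra.norm_zero] at hx
    exact hu0 (RingOfIntegers.ext (by rw [← hx]; rfl))
  have ha0 : a ≠ 0 := by
    rintro rfl
    simp [hn, hx0] at ha
  have hna : RingOfIntegers.norm K a = (n : 𝓞 K)^5 * u := by
    apply RingOfIntegers.ext
    have : Algebra.norm K (a : T) = (n : K)^5 * u := by
      rw [ha, map_mul, hx]
      congr 1
      have := Algebra.norm_algebraMap (S := T) (n : K)
      rw [h.h5, map_intCast] at this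
      exact this
    simpa using this
  have hn0 : (n : 𝓞 K) ≠ 0 := by exact_mod_cast hn
  have hsn0 : Ideal.span {(n : 𝓞 K)} ≠ 0 := by simpa using hn0
  have hsu0 : Ideal.span {u} ≠ 0 := by simpa using hu0
  have hsa0 : Ideal.span {a} ≠ 0 := by simpa using ha0
  have hv : vv P (Ideal.span {a}) = 5 * vv p (Ideal.span {(n : 𝓞 K)}) := by
    rw [← h.vv_nI hP hsa0, nI_span, hna, ← Ideal.span_singleton_mul_span_singleton, ← Ideal.span_singleton_pow,
      vv_mul hpP (pow_ne_zero _ hsn0) hsu0, vv_pow hpP hsn0, vv_zero (I := Ideal.span {u}), add_zero]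
    rw [Ideal.dvd_span_singleton]; exact hu
  obtain ⟨π, hπ⟩ := IsPrincipalIdealRing.principal p
  rw [Ideal.submodule_span_eq] at hπ
  set w := vv p (Ideal.span {(n : 𝓞 K)}) with hw
  obtain ⟨J, hJ, -⟩ := vv_dec hP.prime hsa0
  rw [hv, pow_mul, hP.2.2, ← hp, hπ, iJ_span, Ideal.span_singleton_pow] at hJ
  obtain ⟨J', hJ', hJ2'⟩ := vv_dec hpP hsn0
  rw [← hw] at hJ'
  have hJn := hJ'
  rw [hπ, Ideal.span_singleton_pow] at hJ'
  have hda : algebraMap (𝓞 K) (𝓞 T) π ^ w ∣ a := by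
    rw [← Ideal.span_singleton_le_span_singleton, ← Ideal.dvd_iff_le]; exact ⟨J, hJ⟩
  have hdn : π ^ w ∣ (n : 𝓞 K) := by
    rw [← Ideal.span_singleton_le_span_singleton, ← Ideal.dvd_iff_le]; exact ⟨J', hJ'⟩
  obtain ⟨a', ha'⟩ := hda
  obtain ⟨n', hn'⟩ := hdn
  have hπ0 : π ≠ 0 := by
    rintro rfl
    rw [Ideal.span_singleton_zero] at hπ
    exact hpP.ne_zero hπ
  have hn'p : n' ∉ p := by
    intro hn'p
    have : Ideal.span {n'} = J' := by
      rw [hn', ← Ideal.span_singleton_mul_span_singleton] at hJ'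
      exact mul_left_cancel₀ (by simpa using pow_ne_zero w hπ0) hJ'
    apply hJ2'
    rw [← this, Ideal.dvd_span_singleton]; exact hn'p
  have hna' : RingOfIntegers.norm K a' = n'^5 * u := by
    rw [ha', map_mul, ← map_pow, RingOfIntegers.norm_algebraMap, h.h5, hn'] at hna
    apply mul_left_cancel₀ (pow_ne_zero 5 (pow_ne_zero w hπ0))
    rw [hna]; ring
  obtain ⟨k, hk⟩ := resid hP.2.1 (h.ram_norm hP) a'
  have hs : ∀ z, z - algebraMap (𝓞 K) (𝓞 T) k ∈ P → oi σ.toRingEquiv z - algebraMap (𝓞 K) (𝓞 T) k ∈ P := by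
    intro z hz
    have := P.add_mem (h.ram_sub hP z) hz
    simpa using this
  have hk1 := hs _ hk
  have hk2 := hs _ hk1
  have hk3 := hs _ hk2
  have hk4 := hs _ hk3
  have hN : algebraMap (𝓞 K) (𝓞 T) (RingOfIntegers.norm K a') = a' * oi σ.toRingEquiv a' *
      oi σ.toRingEquiv (oi σ.toRingEquiv a') * oi σ.toRingEquiv (oi σ.toRingEquiv (oi σ.toRingEquiv a')) *
      oi σ.toRingEquiv (oi σ.toRingEquiv (oi σ.toRingEquiv (oi σ.toRingEquiv a'))) :=
    RingOfIntegers.ext (h.norm_eq (a' : T))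
  have hmem : n'^5 * u - k^5 ∈ p := by
    rw [hp, Ideal.mem_comap, map_sub, ← hna', hN, map_pow]
    rw [← Ideal.Quotient.eq] at hk hk1 hk2 hk3 hk4 ⊢
    simp only [map_mul, hk, hk1, hk2, hk3, hk4, map_pow]
    ring
  -- invert n'
  obtain ⟨m, hm⟩ := Ideal.Quotient.exists_inv (I := p) (a := Ideal.Quotient.mk p n')
    (by rwa [Ne, Ideal.Quotient.eq_zero_iff_mem])
  obtain ⟨m, rfl⟩ := Ideal.Quotient.mk_surjective m
  refine ⟨k * m, ?_⟩
  rw [← Ideal.Quotient.eq] at hmem ⊢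
  simp only [map_mul, map_pow] at hmem ⊢
  rw [mul_pow, ← hmem]
  calc _ = (Ideal.Quotient.mk p n' * Ideal.Quotient.mk p m)^5 * Ideal.Quotient.mk p u := by rw [hm]; ring
    _ = _ := by ring

end KD
end St14

namespace St14
variable {K T : Type} [Field K] [NumberField K] [Field T] [NumberField T] [Algebra K T]

lemma dU_coe (τ : T ≃+* T) (e : (𝓞 T)ˣ) : (((dU τ e : (𝓞 T)ˣ) : 𝓞 T) : T) * ((e : 𝓞 T) : T) = τ ((e : 𝓞 T) : T) := by
  have : dU τ e * e = uS τ e := by rw [dU_apply, div_mul_cancel]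
  have := congrArg (fun e : (𝓞 T)ˣ => ((e : 𝓞 T) : T)) this
  simpa using this

namespace KD
variable {ζ : K} {σ : T ≃ₐ[K] T} {y : T} {P : Ideal (𝓞 T)}

lemma ram_pow_principal [IsPrincipalIdealRing (𝓞 K)] (hP : Ram K P) :
    ∃ k : 𝓞 K, k ≠ 0 ∧ P^5 = Ideal.span {algebraMap (𝓞 K) (𝓞 T) k} := by
  obtain ⟨k, hk⟩ := IsPrincipalIdealRing.principal (P.comap (algebraMap (𝓞 K) (𝓞 T)))
  rw [Ideal.submodule_span_eq] at hk
  refine ⟨k, ?_, by rw [hP.2.2, hk, iJ_span]⟩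
  rintro rfl
  rw [Ideal.span_singleton_zero] at hk
  exact ram_comap_ne hP hk

variable {ι : Type} [Fintype ι]

lemma ms_prod (𝔓 : ι → Ideal (𝓞 T)) (hall : ∀ P, Ram K P → ∃ i, P = 𝔓 i) (m : Multiset (Ideal (𝓞 T)))
    (hm : ∀ P ∈ m, Ram K P) : ∃ f : ι → ℕ, m.prod = ∏ i, 𝔓 i ^ f i := by
  classical
  induction m using Multiset.induction_on with
  | empty => exact ⟨fun _ => 0, by simp only [pow_zero, Finset.prod_const_one, Multiset.prod_zero]⟩
  | cons P m ih =>
    obtain ⟨f, hf⟩ := ih (fun Q hQ => hm Q (Multiset.mem_cons_of_mem hQ))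
    obtain ⟨i, hi⟩ := hall P (hm P (Multiset.mem_cons_self _ _))
    refine ⟨fun j => (if j = i then 1 else 0) + f j, ?_⟩
    rw [Multiset.prod_cons, hf, hi]
    simp only [pow_add, Finset.prod_mul_distrib]
    congr 1
    simp only [pow_ite, pow_one, pow_zero, Finset.prod_ite_eq', Finset.mem_univ, if_true]

lemma ambig_fin [IsPrincipalIdealRing (𝓞 K)] (h : KD ζ σ y) (𝔓 : ι → Ideal (𝓞 T))
    (hall : ∀ P, Ram K P → ∃ i, P = 𝔓 i) (hram : ∀ i, Ram K (𝔓 i)) {I : Ideal (𝓞 T)} (hI : I ≠ ⊥)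
    (hS : iS σ.toRingEquiv I = I) :
    ∃ k : 𝓞 K, k ≠ 0 ∧ ∃ f : ι → Fin 5, I = Ideal.span {algebraMap (𝓞 K) (𝓞 T) k} * ∏ i, 𝔓 i ^ (f i).val := by
  obtain ⟨k, hk, m, hm, hm2⟩ := h.ambig _ I hI hS rfl
  obtain ⟨f, hf⟩ := ms_prod 𝔓 hall m hm
  choose c hc hc2 using fun i => ram_pow_principal (hram i)
  refine ⟨k * ∏ i, c i ^ (f i / 5), mul_ne_zero hk (Finset.prod_ne_zero_iff.2 fun i _ => pow_ne_zero _ (hc i)),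
    fun i => ⟨f i % 5, Nat.mod_lt _ (by norm_num)⟩, ?_⟩
  rw [hm2, hf, map_mul, ← Ideal.span_singleton_mul_span_singleton, mul_assoc, map_prod, ← Ideal.prod_span_singleton,
    ← Finset.prod_mul_distrib]
  congr 1
  apply Finset.prod_congr rfl
  intro i _
  rw [map_pow, ← Ideal.span_singleton_pow, ← hc2, ← pow_mul, ← pow_add, Nat.div_add_mod]

lemma h90_unit (h : KD ζ σ y) {e : (𝓞 T)ˣ} (he : e ∈ (nU K T).ker) :
    ∃ x : 𝓞 T, x ≠ 0 ∧ oi σ.toRingEquiv x = e * x := by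
  have hn : Algebra.norm K (((e⁻¹ : (𝓞 T)ˣ) : 𝓞 T) : T) = 1 := by
    have : nU K T e⁻¹ = 1 := by rw [map_inv, MonoidHom.mem_ker.1 he, inv_one]
    have := congrArg (fun e : (𝓞 K)ˣ => ((e : 𝓞 K) : K)) this
    exact this
  obtain ⟨t, ht, ht2⟩ := h.hilbert90 hn
  obtain ⟨n, hn, s, hs⟩ := clear_den t
  refine ⟨s, ?_, ?_⟩
  · rintro rfl
    simp [hn, ht] at hs
  · apply RingOfIntegers.ext
    have he' : ((e : 𝓞 T) : T) * (((e⁻¹ : (𝓞 T)ˣ) : 𝓞 T) : T) = 1 := by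
      rw [← map_mul, Units.mul_inv, map_one]
    have : σ (s : T) = e * s := by
      rw [hs, map_mul, map_intCast]
      linear_combination (n * σ t) * (-he') + (n * ((e : 𝓞 T) : T)) * ht2
    simpa using this

theorem index_upper [IsPrincipalIdealRing (𝓞 K)] (h : KD ζ σ y) (𝔓 : ι → Ideal (𝓞 T))
    (hall : ∀ P, Ram K P → ∃ i, P = 𝔓 i) (hram : ∀ i, Ram K (𝔓 i)) :
    (dU σ.toRingEquiv).range.relIndex (nU K T).ker ≤ 5 ^ Fintype.card ι ∧
    ((dU σ.toRingEquiv).range.relIndex (nU K T).ker = 5 ^ Fintype.card ι → ∀ i, ∃ x, 𝔓 i = Ideal.span {x}) := by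
  classical
  have key : ∀ e : (nU K T).ker, ∃ x : 𝓞 T, x ≠ 0 ∧ oi σ.toRingEquiv x = ((e : (𝓞 T)ˣ) : 𝓞 T) * x ∧ ∃ k : 𝓞 K, k ≠ 0 ∧
      ∃ f : ι → Fin 5, Ideal.span {x} = Ideal.span {algebraMap (𝓞 K) (𝓞 T) k} * ∏ i, 𝔓 i ^ (f i).val := by
    rintro ⟨e, he⟩
    obtain ⟨x, hx, hx2⟩ := h.h90_unit he
    refine ⟨x, hx, hx2, h.ambig_fin 𝔓 hall hram (by simpa using hx) ?_⟩
    rw [iS_span, hx2, Ideal.span_singleton_mul_left_unit e.isUnit]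
  choose x hx0 hx k hk f hf using key
  let Q := (nU K T).ker ⧸ ((dU σ.toRingEquiv).range.subgroupOf (nU K T).ker)
  have hcard : (dU σ.toRingEquiv).range.relIndex (nU K T).ker = Nat.card Q := rfl
  let g : Q → (ι → Fin 5) := fun q => f q.out
  have hg : Function.Injective g := by
    intro q q' hqq
    have hqq' : f q.out = f q'.out := hqq
    rw [← Quotient.out_eq' q, ← Quotient.out_eq' q']
    rw [QuotientGroup.eq, Subgroup.mem_subgroupOf]
    set e := q.out
    set e' := q'.out
    have h1 : Ideal.span {x e' * algebraMap (𝓞 K) (𝓞 T) (k e)} = Ideal.span {x e * algebraMap (𝓞 K) (𝓞 T) (k e')} := by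
      rw [← Ideal.span_singleton_mul_span_singleton, ← Ideal.span_singleton_mul_span_singleton, hf, hf, hqq']
      ring
    rw [Ideal.span_singleton_eq_span_singleton] at h1
    obtain ⟨w, hw⟩ := h1.symm
    refine ⟨w, ?_⟩
    have h2 := congrArg (oi σ.toRingEquiv) hw
    have hfx : ∀ k : 𝓞 K, oi σ.toRingEquiv (algebraMap (𝓞 K) (𝓞 T) k) = algebraMap (𝓞 K) (𝓞 T) k := fun k => RingOfIntegers.ext (σ.commutes _)
    rw [map_mul, map_mul, map_mul, hfx, hfx, hx, hx] at h2
    have h3 : ((e : (𝓞 T)ˣ) : 𝓞 T) * oi σ.toRingEquiv w = ((e' : (𝓞 T)ˣ) : 𝓞 T) * w := by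
      have : x e * algebraMap (𝓞 K) (𝓞 T) (k e') ≠ 0 := by
        refine mul_ne_zero (hx0 _) ?_
        rw [Ne, FaithfulSMul.algebraMap_eq_zero_iff]
        exact hk _
      apply mul_left_cancel₀ this
      linear_combination h2 - (e' : (𝓞 T)ˣ) * hw
    have h4 : (e : (𝓞 T)ˣ) * uS σ.toRingEquiv w = (e' : (𝓞 T)ˣ) * w := Units.ext h3
    rw [dU_apply]
    change uS σ.toRingEquiv w / w = (e : (𝓞 T)ˣ)⁻¹ * (e' : (𝓞 T)ˣ)
    rw [div_eq_iff_eq_mul, mul_assoc, ← h4, inv_mul_cancel_left]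
  have hfin : Finite Q := Finite.of_injective g hg
  have hcf : Nat.card (ι → Fin 5) = 5 ^ Fintype.card ι := by simp
  refine ⟨?_, ?_⟩
  · rw [hcard, ← hcf]
    exact Nat.card_le_card_of_injective g hg
  · intro heq i
    rw [hcard, ← hcf] at heq
    have hbij : Function.Bijective g := (Nat.bijective_iff_injective_and_card g).2 ⟨hg, heq⟩
    obtain ⟨q, hq⟩ := hbij.2 (Pi.single i 1)
    have h1 := hf q.out
    have hq' : f q.out = Pi.single i 1 := hq
    rw [hq'] at h1
    have h2 : ∏ j, 𝔓 j ^ ((Pi.single i 1 : ι → Fin 5) j).val = 𝔓 i := by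
      rw [Finset.prod_eq_single i]
      · simp
      · intro j _ hj; simp [hj]
      · simp
    rw [h2] at h1
    have hd : algebraMap (𝓞 K) (𝓞 T) (k q.out) ∣ x q.out := by
      rw [← Ideal.span_singleton_le_span_singleton, ← Ideal.dvd_iff_le]; exact ⟨_, h1⟩
    obtain ⟨z, hz⟩ := hd
    refine ⟨z, ?_⟩
    rw [hz, ← Ideal.span_singleton_mul_span_singleton] at h1
    refine (mul_left_cancel₀ ?_ h1).symm
    rw [Ne, Ideal.zero_eq_bot, Ideal.span_singleton_eq_bot, FaithfulSMul.algebraMap_eq_zero_iff]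
    exact hk _

theorem index_lower (h : KD ζ σ y) (𝔓 : ι → Ideal (𝓞 T))
    (hinj : Function.Injective 𝔓) (hram : ∀ i, Ram K (𝔓 i)) (hp : ∀ i, ∃ x, 𝔓 i = Ideal.span {x}) :
    5 ^ Fintype.card ι ≤ 125 := by
  classical
  choose x hx using hp
  have hx0 : ∀ i, x i ≠ 0 := by
    intro i hi
    apply (hram i).2.1
    rw [hx, hi, Ideal.span_singleton_zero]
  have he : ∀ i, ∃ e : (𝓞 T)ˣ, oi σ.toRingEquiv (x i) = e * x i := by
    intro i
    have h1 := h.ram_fixed (hram i)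
    rw [hx, iS_span, Ideal.span_singleton_eq_span_singleton] at h1
    obtain ⟨e, he⟩ := h1.symm
    exact ⟨e, by rw [← he, mul_comm]⟩
  choose e he using he
  have hek : ∀ i, e i ∈ (nU K T).ker := by
    intro i
    rw [MonoidHom.mem_ker]
    apply uext
    rw [nU_coe]
    have hx0' : ((x i : 𝓞 T) : T) ≠ 0 := by simpa using hx0 i
    have h1 : ((e i : 𝓞 T) : T) = σ (x i) / x i := by
      rw [eq_div_iff hx0']
      have := congrArg (fun e : 𝓞 T => (e : T)) (he i)
      simpa using this.symm
    rw [h1, norm_div _ _ hx0', Algebra.norm_eq_of_algEquiv, div_self]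
    · simp
    · rwa [Ne, Algebra.norm_eq_zero_iff]
  let Q := (nU K T).ker ⧸ ((dU σ.toRingEquiv).range.subgroupOf (nU K T).ker)
  have hcard : (dU σ.toRingEquiv).range.relIndex (nU K T).ker = Nat.card Q := rfl
  have hher := h.herbrand
  rw [hcard] at hher
  have hQ0 : Nat.card Q ≠ 0 := by intro h0; rw [h0] at hher; omega
  have hQle : Nat.card Q ≤ 125 := Nat.le_of_dvd (by norm_num) ⟨_, hher.symm⟩
  have hfin : Finite Q := Nat.finite_of_card_ne_zero hQ0
  let g : (ι → Fin 5) → Q := fun m => QuotientGroup.mk (⟨∏ i, e i ^ (m i).val, Subgroup.prod_mem _ fun i _ => Subgroup.pow_mem _ (hek i) _⟩ : (nU K T).ker)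
  have hg : Function.Injective g := by
    intro m m' hmm
    have h1 := QuotientGroup.eq.1 hmm
    rw [Subgroup.mem_subgroupOf] at h1
    obtain ⟨w, hw⟩ := h1
    have hw' : dU σ.toRingEquiv w = (∏ i, e i ^ (m i).val)⁻¹ * (∏ i, e i ^ (m' i).val) := hw
    rw [dU_apply, div_eq_iff_eq_mul] at hw'
    have hw2 : (∏ i, e i ^ (m i).val) * uS σ.toRingEquiv w = (∏ i, e i ^ (m' i).val) * w := by
      rw [hw']; group
    have hw3 : (∏ i, (e i : 𝓞 T) ^ (m i).val) * oi σ.toRingEquiv w = (∏ i, (e i : 𝓞 T) ^ (m' i).val) * w := by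
      have := congrArg (fun e : (𝓞 T)ˣ => (e : 𝓞 T)) hw2
      simp only [Units.val_mul, Units.coe_prod, Units.val_pow_eq_pow_val] at this
      exact this
    have hX : ∀ m : ι → Fin 5, oi σ.toRingEquiv (∏ i, x i ^ (m i).val) = (∏ i, (e i : 𝓞 T) ^ (m i).val) * ∏ i, x i ^ (m i).val := by
      intro m
      rw [map_prod, ← Finset.prod_mul_distrib]
      apply Finset.prod_congr rfl
      intro i _
      rw [map_pow, he, mul_pow]
    have hX0 : ∀ m : ι → Fin 5, ∏ i, x i ^ (m i).val ≠ 0 := fun m => Finset.prod_ne_zero_iff.2 fun i _ => pow_ne_zero _ (hx0 i)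
    -- the quotient is fixed
    set X := ∏ i, x i ^ (m i).val with hXd
    set X' := ∏ i, x i ^ (m' i).val with hXd'
    have hXX := hX m
    have hXX' := hX m'
    rw [← hXd] at hXX
    rw [← hXd'] at hXX'
    have c1 : oi σ.toRingEquiv X * oi σ.toRingEquiv w * X' = oi σ.toRingEquiv X' * (X * w) := by
      rw [hXX, hXX']
      linear_combination (X * X') * hw3
    have t0 : (X' : T) ≠ 0 := by simpa using hX0 m'
    have t1 : (X : T) ≠ 0 := by simpa using hX0 m
    have t2 : ((w : 𝓞 T) : T) ≠ 0 := by simp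
    have hfixed : σ ((X : T) * w / X') = X * w / X' := by
      have c2 : σ (X : T) * σ ((w : 𝓞 T) : T) * X' = σ (X' : T) * (X * w) := by
        have := congrArg (fun e : 𝓞 T => (e : T)) c1
        simpa using this
      have t0' : σ (X' : T) ≠ 0 := by simpa using t0
      rw [map_div₀, map_mul, div_eq_div_iff t0' t0]
      linear_combination c2
    obtain ⟨κ, hκ⟩ := h.fixed hfixed
    obtain ⟨n, hn, s, hs⟩ := clear_den κ
    have hκ0 : κ ≠ 0 := by
      rintro rfl
      rw [map_zero] at hκ
      have := div_ne_zero (mul_ne_zero t1 t2) t0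
      exact this hκ.symm
    have hs0 : s ≠ 0 := by
      rintro rfl
      simp [hn, hκ0] at hs
    have hn0 : (n : 𝓞 K) ≠ 0 := by exact_mod_cast hn
    have heq : algebraMap (𝓞 K) (𝓞 T) (n : 𝓞 K) * X * w = algebraMap (𝓞 K) (𝓞 T) s * X' := by
      apply RingOfIntegers.ext
      have : (n : T) * X * w = algebraMap K T s * X' := by
        rw [hs, map_mul, map_intCast, hκ]
        field_simp
      have h4 : algebraMap K T s = ((algebraMap (𝓞 K) (𝓞 T) s : 𝓞 T) : T) := rfl
      rw [h4] at this
      simpa using this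
    have hid : iJ K T (Ideal.span {(n : 𝓞 K)}) * ∏ i, 𝔓 i ^ (m i).val = iJ K T (Ideal.span {s}) * ∏ i, 𝔓 i ^ (m' i).val := by
      simp only [hx, Ideal.span_singleton_pow, Ideal.prod_span_singleton, iJ_span, Ideal.span_singleton_mul_span_singleton]
      rw [← hXd, ← hXd', ← heq, Ideal.span_singleton_mul_right_unit w.isUnit]
    funext i
    have h5 := congrArg (vv (𝔓 i)) hid
    have hpr : ∀ m : ι → Fin 5, ∏ i, 𝔓 i ^ (m i).val ≠ 0 := fun m => Finset.prod_ne_zero_iff.2 fun i _ => pow_ne_zero _ (hram i).prime.ne_zero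
    have hvp : ∀ m : ι → Fin 5, vv (𝔓 i) (∏ j, 𝔓 j ^ (m j).val) = (m i).val := by
      intro m
      rw [vv_prod (hram i).prime _ _ (fun j => pow_ne_zero _ (hram j).prime.ne_zero), Finset.sum_eq_single i]
      · rw [vv_pow (hram i).prime (hram i).prime.ne_zero, vv_self (hram i).prime, mul_one]
      · intro j _ hj
        rw [vv_pow (hram i).prime (hram j).prime.ne_zero, vv_ne (hram i).prime (hram j).prime, mul_zero]
        exact fun h => hj (hinj h).symm
      · simp
    have hsn0 : Ideal.span {(n : 𝓞 K)} ≠ 0 := by simpa using hn0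
    have hss0 : Ideal.span {s} ≠ 0 := by simpa using hs0
    rw [vv_mul (hram i).prime (iJ_ne_zero hsn0) (hpr m), vv_mul (hram i).prime (iJ_ne_zero hss0) (hpr m'),
      hvp, hvp, (hram i).vv_iJ hsn0, (hram i).vv_iJ hss0] at h5
    have b1 := (m i).isLt
    have b2 := (m' i).isLt
    apply Fin.ext
    omega
  have := Nat.card_le_card_of_injective g hg
  have hcf : Nat.card (ι → Fin 5) = 5 ^ Fintype.card ι := by simp
  rw [hcf] at this
  omega

end KD
end St14

namespace St14

structure CK {K : Type} [Field K] [NumberField K] (z : 𝓞 K) (d : 𝓞 K ≃+* 𝓞 K) : Prop where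
  hz : IsPrimitiveRoot (z : K) 5
  hK : Module.finrank ℚ K = 4
  hd : d z = z ^ 2

namespace CK
variable {K : Type} [Field K] [NumberField K] {z : 𝓞 K} {d : 𝓞 K ≃+* 𝓞 K}

lemma cyc (h : CK z d) : IsCyclotomicExtension {5} ℚ K := by
  have h1 : IntermediateField.adjoin ℚ {(z : K)} = ⊤ := by
    apply IntermediateField.eq_of_le_of_finrank_eq le_top
    rw [IntermediateField.finrank_top', h.hK]
    rw [IntermediateField.adjoin.finrank (h.hz.isIntegral (by norm_num)).tower_top]
    rw [← cyclotomic_eq_minpoly_rat h.hz (by norm_num), natDegree_cyclotomic]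
    decide
  have h2 := h.hz.intermediateField_adjoin_isCyclotomicExtension ℚ
  rw [h1] at h2
  exact IsCyclotomicExtension.equiv {5} ℚ _ IntermediateField.topEquiv

lemma pid (h : CK z d) : IsPrincipalIdealRing (𝓞 K) := by
  have := h.cyc
  exact IsCyclotomicExtension.Rat.five_pid K

lemma hzI (h : CK z d) : IsPrimitiveRoot z 5 := by
  have : Function.Injective (algebraMap (𝓞 K) K) := RingOfIntegers.coe_injective
  exact IsPrimitiveRoot.of_map_of_injective (f := algebraMap (𝓞 K) K) h.hz this

lemma z5 (h : CK z d) : z ^ 5 = 1 := h.hzI.pow_eq_one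

lemma zne (h : CK z d) : z ≠ 1 := h.hzI.ne_one (by norm_num)

lemma zsum (h : CK z d) : 1 + z + z^2 + z^3 + z^4 = 0 := by
  have h1 : (z - 1) * (1 + z + z^2 + z^3 + z^4) = 0 := by
    linear_combination h.z5
  rcases mul_eq_zero.1 h1 with h2 | h2
  · exact absurd (sub_eq_zero.1 h2) h.zne
  · exact h2

lemma basis (h : CK z d) : ∃ b : Module.Basis (Fin 4) ℤ (𝓞 K), ∀ i, b i = z ^ (i : ℕ) := by
  have := h.cyc
  have e : h.hz.integralPowerBasis.dim = 4 := by
    rw [IsPrimitiveRoot.integralPowerBasis_dim]; decide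
  refine ⟨h.hz.integralPowerBasis.basis.reindex (finCongr e), fun i => ?_⟩
  have : h.hz.toInteger = z := RingOfIntegers.ext rfl
  simp [this]

lemma rep (h : CK z d) (x : 𝓞 K) : ∃ a b c e : ℤ, x = a + b * z + c * z^2 + e * z^3 := by
  obtain ⟨b, hb⟩ := h.basis
  refine ⟨b.repr x 0, b.repr x 1, b.repr x 2, b.repr x 3, ?_⟩
  conv_lhs => rw [← b.sum_repr x]
  simp [Fin.sum_univ_four, hb]

lemma rep_zero (h : CK z d) {a b c e : ℤ} (hx : (a + b * z + c * z^2 + e * z^3 : 𝓞 K) = 0) :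
    a = 0 ∧ b = 0 ∧ c = 0 ∧ e = 0 := by
  obtain ⟨B, hB⟩ := h.basis
  have h1 := B.linearIndependent
  rw [Fintype.linearIndependent_iff] at h1
  have h2 := h1 ![a, b, c, e] (by simp [Fin.sum_univ_four, hB]; linear_combination hx)
  exact ⟨h2 0, h2 1, h2 2, h2 3⟩

lemma dvd_rep (h : CK z d) {n a b c e : ℤ} (hx : (n : 𝓞 K) ∣ (a + b * z + c * z^2 + e * z^3 : 𝓞 K)) :
    n ∣ a ∧ n ∣ b ∧ n ∣ c ∧ n ∣ e := by
  obtain ⟨y, hy⟩ := hx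
  obtain ⟨a', b', c', e', rfl⟩ := h.rep y
  have := h.rep_zero (a := a - n * a') (b := b - n * b') (c := c - n * c') (e := e - n * e')
    (by push_cast; linear_combination hy)
  refine ⟨⟨a', by omega⟩, ⟨b', by omega⟩, ⟨c', by omega⟩, ⟨e', by omega⟩⟩

lemma dvd_int (h : CK z d) {n a : ℤ} (hx : (n : 𝓞 K) ∣ (a : 𝓞 K)) : n ∣ a :=
  (h.dvd_rep (b := 0) (c := 0) (e := 0) (by simpa using hx)).1

/-- Frobenius style congruence -/
lemma frob (h : CK z d) (p : ℕ) [Fact p.Prime] (x : 𝓞 K) :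
    ∃ a b c e : ℤ, x = a + b * z + c * z^2 + e * z^3 ∧
      (p : 𝓞 K) ∣ x ^ p - (a + b * z^p + c * (z^p)^2 + e * (z^p)^3) := by
  obtain ⟨a, b, c, e, hx⟩ := h.rep x
  refine ⟨a, b, c, e, hx, ?_⟩
  rw [← Ideal.mem_span_singleton, ← Ideal.Quotient.eq_zero_iff_mem]
  set q := Ideal.Quotient.mk (Ideal.span {(p : 𝓞 K)})
  have hp0 : ((p : ℕ) : 𝓞 K ⧸ Ideal.span {(p : 𝓞 K)}) = 0 := by
    rw [← map_natCast q]
    exact Ideal.Quotient.eq_zero_iff_mem.2 (Ideal.mem_span_singleton_self _)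
  have hnt : Nontrivial (𝓞 K ⧸ Ideal.span {(p : 𝓞 K)}) := by
    apply Ideal.Quotient.nontrivial_iff.2
    intro ht
    rw [Ideal.span_singleton_eq_top] at ht
    have := h.dvd_int (n := p) (a := 1) (by simpa using ht.dvd)
    have h2 : (p:ℤ).natAbs = 1 := Int.natAbs_eq_iff.2 (by
      rcases Int.isUnit_iff.1 (isUnit_of_dvd_one this) with h | h <;> simp [h])
    exact (Fact.out : p.Prime).one_lt.ne' (by simpa using h2)
  have : CharP (𝓞 K ⧸ Ideal.span {(p : 𝓞 K)}) p := by
    have := CharP.exists (𝓞 K ⧸ Ideal.span {(p : 𝓞 K)})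
    obtain ⟨c, hc⟩ := this
    have h1 := (CharP.cast_eq_zero_iff _ c p).1 hp0
    rcases (Nat.dvd_prime Fact.out).1 h1 with h2 | h2
    · subst h2
      exact (CharP.false_of_nontrivial_of_char_one (R := 𝓞 K ⧸ Ideal.span {(p : 𝓞 K)})).elim
    · exact h2 ▸ hc
  have hfr : ∀ n : ℤ, ((n : 𝓞 K ⧸ Ideal.span {(p : 𝓞 K)}))^p = n := fun n => by
    have := map_intCast (frobenius (𝓞 K ⧸ Ideal.span {(p : 𝓞 K)}) p) n
    rwa [frobenius_def] at this
  have : ExpChar (𝓞 K ⧸ Ideal.span {(p : 𝓞 K)}) p := ExpChar.prime Fact.out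
  rw [hx]
  simp only [map_sub, map_add, map_mul, map_pow, map_intCast, add_pow_expChar, mul_pow, hfr]
  rw [sub_eq_zero]
  simp only [← pow_mul, mul_comm p]

lemma frob5 (h : CK z d) (x : 𝓞 K) : ∃ n : ℤ, (5 : 𝓞 K) ∣ x ^ 5 - n := by
  have : Fact (Nat.Prime 5) := ⟨by norm_num⟩
  obtain ⟨a, b, c, e, hx, h1⟩ := h.frob 5 x
  refine ⟨a + b + c + e, ?_⟩
  rw [h.z5] at h1
  have h2 : ((5 : ℕ) : 𝓞 K) = 5 := by norm_num
  rw [h2] at h1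
  have h3 : x ^ 5 - ((a + b + c + e : ℤ) : 𝓞 K) = x ^ 5 - (↑a + ↑b * 1 + ↑c * 1 ^ 2 + ↑e * 1 ^ 3) := by
    push_cast; ring
  rw [h3]; exact h1

/-- p ≡ 1 mod 5 -/
lemma frob_one (h : CK z d) {p : ℕ} (hp : p.Prime) (h5 : p % 5 = 1) (x : 𝓞 K) :
    (p : 𝓞 K) ∣ x ^ p - x := by
  have : Fact (Nat.Prime p) := ⟨hp⟩
  obtain ⟨a, b, c, e, hx, h1⟩ := h.frob p x
  have : z ^ p = z := by
    rw [← Nat.div_add_mod p 5, h5, pow_add, pow_mul, h.z5]; simp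
  rw [this, ← hx] at h1
  exact h1

lemma d_rep (h : CK z d) (a b c e : ℤ) : d (a + b * z + c * z^2 + e * z^3) = a + b * z^2 + c * z^4 + e * z := by
  simp only [map_add, map_mul, map_pow, map_intCast, h.hd]
  have := h.z5
  linear_combination (e * z : 𝓞 K) * this

lemma d4 (h : CK z d) (x : 𝓞 K) : d (d (d (d x))) = x := by
  obtain ⟨a, b, c, e, rfl⟩ := h.rep x
  simp only [map_add, map_mul, map_pow, map_intCast, h.hd]
  have : z ^ 16 = z := by
    calc z^16 = (z^5)^3 * z := by ring
      _ = z := by rw [h.z5]; ring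
  have e2 : (((z ^ 2) ^ 2) ^ 2) ^ 2 = z := by rw [← pow_mul, ← pow_mul, ← pow_mul]; exact this
  rw [e2]

/-- p ≡ 4 mod 5 -/
lemma frob_four (h : CK z d) {p : ℕ} (hp : p.Prime) (h5 : p % 5 = 4) (x : 𝓞 K) :
    (p : 𝓞 K) ∣ x ^ p - d (d x) := by
  have : Fact (Nat.Prime p) := ⟨hp⟩
  obtain ⟨a, b, c, e, hx, h1⟩ := h.frob p x
  have : z ^ p = z ^ 4 := by
    rw [← Nat.div_add_mod p 5, h5, pow_add, pow_mul, h.z5]; simp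
  rw [this] at h1
  convert h1 using 2
  rw [hx]
  simp only [map_add, map_mul, map_pow, map_intCast, h.hd]
  ring

end CK
end St14

namespace St14

def eps {K : Type} [Field K] (z : 𝓞 K) : 𝓞 K := -(z^2+z^3)

namespace CK
variable {K : Type} [Field K] [NumberField K] {z : 𝓞 K} {d : 𝓞 K ≃+* 𝓞 K}

lemma zunit (h : CK z d) : IsUnit z := h.hzI.isUnit (by norm_num)

lemma eps_d (h : CK z d) : eps z * d (eps z) = -1 := by
  unfold eps
  simp only [map_neg, map_add, map_pow, h.hd]
  linear_combination (1 - z + z^5) * h.zsum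

lemma eps_unit (h : CK z d) : IsUnit (eps z) :=
  IsUnit.of_mul_eq_one (-(d (eps z))) (by linear_combination -h.eps_d)

lemma lam4 (h : CK z d) : ∃ u : (𝓞 K)ˣ, (5 : 𝓞 K) = (1 - z)^4 * u := by
  have hs := h.zsum
  have h1 : IsUnit (1 + z) := IsUnit.of_mul_eq_one (-(z + z^3)) (by linear_combination -h.zsum)
  have h2 : IsUnit (1 + z + z^2) := IsUnit.of_mul_eq_one (1 + z^3) (by linear_combination z*h.zsum)
  have h3 : IsUnit (1 + z + z^2 + z^3) := by
    have : 1 + z + z^2 + z^3 = - z^4 := by linear_combination h.zsum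
    rw [this]; exact (h.zunit.pow 4).neg
  refine ⟨((h1.mul h2).mul h3).unit, ?_⟩
  rw [IsUnit.unit_spec]
  linear_combination (4 - 3*z - z^3 + 2*z^5 - z^6) * hs

lemma lam_ne (h : CK z d) : 1 - z ≠ 0 := fun h1 => h.zne (sub_eq_zero.1 h1).symm

lemma lam4_dvd (h : CK z d) : (1 - z)^4 ∣ (5 : 𝓞 K) := by
  obtain ⟨u, hu⟩ := h.lam4
  exact ⟨u, hu⟩

lemma five_dvd (h : CK z d) : (5 : 𝓞 K) ∣ (1 - z)^4 := by
  obtain ⟨u, hu⟩ := h.lam4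
  refine ⟨(u⁻¹ : (𝓞 K)ˣ), ?_⟩
  rw [hu, mul_assoc, Units.mul_inv, mul_one]

lemma lam_int (h : CK z d) {n : ℤ} (hn : (1 - z) ∣ (n : 𝓞 K)) : 5 ∣ n := by
  have h1 : (5 : 𝓞 K) ∣ (n : 𝓞 K)^4 := h.five_dvd.trans (pow_dvd_pow_of_dvd hn 4)
  have h2 : (5:ℤ) ∣ n^4 := h.dvd_int (by push_cast; exact h1)
  exact Int.Prime.dvd_pow' (by norm_num) h2

lemma int_lam (h : CK z d) {n : ℤ} (hn : 5 ∣ n) : (1 - z)^4 ∣ (n : 𝓞 K) := by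
  obtain ⟨m, rfl⟩ := hn
  push_cast
  exact (h.lam4_dvd).mul_right _

lemma lam_rep (h : CK z d) (x : 𝓞 K) : ∃ n : ℤ, (1 - z) ∣ x - n := by
  obtain ⟨a, b, c, e, rfl⟩ := h.rep x
  refine ⟨a + b + c + e, ⟨-b - c*(1+z) - e*(1+z+z^2), by push_cast; ring⟩⟩

lemma lam_prime (h : CK z d) : Prime (1 - z) := by
  refine ⟨h.lam_ne, fun hu => ?_, fun x y hxy => ?_⟩
  · have := h.lam_int (n := 1) hu.dvd
    norm_num at this
  · obtain ⟨a, c, ha⟩ := h.lam_rep x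
    obtain ⟨b, e, hb⟩ := h.lam_rep y
    have h1 : (1 - z) ∣ ((a * b : ℤ) : 𝓞 K) := by
      have : ((a * b : ℤ) : 𝓞 K) = x * y - (1-z) * (c * b + x * e) := by
        push_cast
        have e1 : x = a + (1-z)*c := by linear_combination ha
        have e2 : y = b + (1-z)*e := by linear_combination hb
        rw [e1, e2]; ring
      rw [this]
      exact dvd_sub hxy (dvd_mul_right _ _)
    rcases Int.Prime.dvd_mul' (by norm_num) (h.lam_int h1) with h2 | h2
    · left
      have := (dvd_pow_self (1-z) (by norm_num : (4:ℕ) ≠ 0)).trans (h.int_lam h2)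
      have e1 : x = a + (1-z)*c := by linear_combination ha
      rw [e1]; exact dvd_add this (dvd_mul_right _ _)
    · right
      have := (dvd_pow_self (1-z) (by norm_num : (4:ℕ) ≠ 0)).trans (h.int_lam h2)
      have e1 : y = b + (1-z)*e := by linear_combination hb
      rw [e1]; exact dvd_add this (dvd_mul_right _ _)

lemma d_lam (h : CK z d) : d (1 - z) = (1 - z) * (1 + z) := by
  rw [map_sub, map_one, h.hd]; ring

lemma lam_step (h : CK z d) {k : ℕ} (hk : 1 ≤ k) (hk2 : ¬ (5:ℤ) ∣ 1 + 2^k) {w : 𝓞 K}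
    (h1 : (1-z)^k ∣ w - 1) (h2 : (1-z)^(k+1) ∣ w * d w - 1) : (1-z)^(k+1) ∣ w - 1 := by
  obtain ⟨c, hc⟩ := h1
  obtain ⟨m, c', hm⟩ := h.lam_rep c
  have ew : w = 1 + (1-z)^k * c := by linear_combination hc
  have ec : c = m + (1-z) * c' := by linear_combination hm
  have edc : d c = m + (1-z) * ((1+z) * d c') := by
    rw [ec, map_add, map_mul, h.d_lam, map_intCast]; ring
  have edw : d w = 1 + (1-z)^k * (1+z)^k * d c := by
    rw [ew, map_add, map_mul, map_pow, h.d_lam, map_one, mul_pow]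
  obtain ⟨s, hs⟩ := sub_dvd_pow_sub_pow (1+z) 2 k
  have es : (1+z)^k = 2^k - (1-z) * s := by linear_combination hs
  obtain ⟨k', rfl⟩ : ∃ k', k = k'+1 := ⟨k-1, by omega⟩
  have h3 : (1-z) ∣ c + (1+z)^(k'+1) * d c + (1-z)^(k'+1) * c * (1+z)^(k'+1) * d c := by
    apply (mul_dvd_mul_iff_left (pow_ne_zero (k'+1) h.lam_ne)).1
    rw [← pow_succ]
    convert h2 using 1
    rw [edw, ew]; ring
  have h4 : (1 - z) ∣ ((m * (1+2^(k'+1)) : ℤ) : 𝓞 K) := by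
    have : ((m * (1+2^(k'+1)) : ℤ) : 𝓞 K) = (c + (1+z)^(k'+1) * d c + (1-z)^(k'+1) * c * (1+z)^(k'+1) * d c)
      - (1-z) * (c' + 2^(k'+1) * ((1+z) * d c') - s * d c + (1-z)^k' * c * (1+z)^(k'+1) * d c) := by
      push_cast
      have e1 : (1-z)^(k'+1) * c * (1+z)^(k'+1) * d c = (1-z) * ((1-z)^k' * c * (1+z)^(k'+1) * d c) := by ring
      rw [e1, es]
      linear_combination -ec - 2^(k'+1) * edc
    rw [this]
    exact dvd_sub h3 (dvd_mul_right _ _)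
  have h5 : 5 ∣ m := by
    rcases Int.Prime.dvd_mul' (by norm_num) (h.lam_int h4) with h2 | h2
    · exact h2
    · exact absurd h2 hk2
  have h6 : (1 - z) ∣ c := by
    have := (dvd_pow_self (1-z) (by norm_num : (4:ℕ) ≠ 0)).trans (h.int_lam h5)
    rw [ec]; exact dvd_add this (dvd_mul_right _ _)
  rw [hc, pow_succ]
  exact mul_dvd_mul_left _ h6

lemma eps4 (h : CK z d) : (1-z)^3 ∣ (eps z)^4 - (1 + 3*(1-z)^2) := by
  obtain ⟨t, ht⟩ := h.lam4_dvd
  have e1 : eps z = -2 + (1-z)^2 + (1-z)^3 * ((1-z)^2*t - (1-z)^3*t + 1) := by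
    unfold eps
    linear_combination (1-z-(1-z)^2) * ht
  have : (1-z)^3 ∣ (eps z)^4 - (-2 + (1-z)^2)^4 := by
    refine dvd_trans ?_ (sub_dvd_pow_sub_pow _ _ 4)
    rw [e1]; exact ⟨(1 - z) ^ 2 * t - (1 - z) ^ 3 * t + 1, by ring⟩
  have h2 : (1-z)^3 ∣ (-2 + (1-z)^2)^4 - (1 + 3*(1-z)^2) := by
    refine ⟨(1-z)*t*3 - (1-z)^3*t*7+ (1-z)*24 - (1-z)^3*8 + (1-z)^5, ?_⟩
    linear_combination (3 - 7*(1-z)^2) * ht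
  have := dvd_add this h2
  convert this using 1; ring

lemma eps4j (h : CK z d) (j : ℕ) : (1-z)^3 ∣ (eps z)^(4*j) - (1 + 3*j*(1-z)^2) := by
  obtain ⟨s, hs⟩ := h.eps4
  induction j with
  | zero => simp
  | succ j ih =>
    obtain ⟨t, ht⟩ := ih
    refine ⟨t * (eps z)^4 + (1 + 3*j*(1-z)^2)*s + 9 * j * (1-z), ?_⟩
    rw [mul_add, pow_add, mul_one]
    push_cast
    linear_combination (eps z)^4 * ht + (1 + 3*j*(1-z)^2) * hs

theorem one_mod (h : CK z d) {z0 : 𝓞 K} {n : ℤ} (hn : ¬ 5 ∣ n) (hz0 : z0 * d z0 = (n : 𝓞 K)^5) :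
    ∃ j : ℕ, (1-z)^5 ∣ z0^4 * (eps z)^(4*j) - 1 := by
  have h20 : (1-z)^8 ∣ (n : 𝓞 K)^20 - 1 := by
    have h1 : (25 : ℤ) ∣ n^20 - 1 := by
      have h25 : ∀ x : ZMod 25, x^20 = 1 ∨ 5*x = 0 := by decide
      rcases h25 n with h0 | h0
      · have := (ZMod.intCast_zmod_eq_zero_iff_dvd (n^20-1) 25).1 (by push_cast; rw [h0, sub_self])
        exact_mod_cast this
      · have := (ZMod.intCast_zmod_eq_zero_iff_dvd (5*n) 25).1 (by push_cast; exact h0)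
        push_cast at this; omega
    obtain ⟨m, hm⟩ := h1
    have h2 : (n : 𝓞 K)^20 - 1 = 5 * 5 * m := by
      have := congrArg (Int.cast (R := 𝓞 K)) hm
      push_cast at this; linear_combination this
    rw [h2]
    have := (mul_dvd_mul h.lam4_dvd h.lam4_dvd)
    rw [← pow_add] at this
    exact this.mul_right _
  have hw : ∀ j : ℕ, (1-z)^8 ∣ (z0^4 * (eps z)^(4*j)) * d (z0^4 * (eps z)^(4*j)) - 1 := by
    intro j
    have : (z0^4 * (eps z)^(4*j)) * d (z0^4 * (eps z)^(4*j)) = (n : 𝓞 K)^20 := by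
      rw [map_mul, map_pow, map_pow]
      calc _ = (z0 * d z0)^4 * (eps z * d (eps z))^(4*j) := by ring
        _ = (n : 𝓞 K)^20 * ((-1)^4)^j := by rw [hz0, h.eps_d, ← pow_mul, ← pow_mul]
        _ = _ := by norm_num
    rw [this]; exact h20
  have hle : ∀ {k : ℕ} {x : 𝓞 K}, k ≤ 8 → (1-z)^8 ∣ x → (1-z)^k ∣ x := fun hk hx =>
    (pow_dvd_pow _ hk).trans hx
  -- mod lam
  have hx1 : (1-z)^1 ∣ z0^4 - 1 := by
    obtain ⟨a, ha⟩ := h.lam_rep z0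
    have ha5 : ¬ 5 ∣ a := by
      intro h5
      have h1 : (1-z) ∣ z0 := by
        have h2 := (dvd_pow_self (1-z) (by norm_num : (4:ℕ) ≠ 0)).trans (h.int_lam h5)
        have := dvd_add ha h2
        simpa using this
      have h2 : (1-z) ∣ ((n^5 : ℤ) : 𝓞 K) := by
        push_cast; rw [← hz0]; exact h1.mul_right _
      exact hn (Int.Prime.dvd_pow' (by norm_num) (h.lam_int h2))
    have h1 : 5 ∣ a^4 - 1 := by
      have h25 : ∀ x : ZMod 5, x^4 = 1 ∨ x = 0 := by decide
      rcases h25 a with h0 | h0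
      · have := (ZMod.intCast_zmod_eq_zero_iff_dvd (a^4-1) 5).1 (by push_cast; rw [h0, sub_self])
        exact_mod_cast this
      · have := (ZMod.intCast_zmod_eq_zero_iff_dvd a 5).1 h0
        exact absurd (by exact_mod_cast this) ha5
    have h2 := (pow_dvd_pow (1-z) (by norm_num : 1 ≤ 4)).trans (h.int_lam h1)
    have h3 := ha.trans (sub_dvd_pow_sub_pow z0 (a : 𝓞 K) 4)
    rw [pow_one] at h2 ⊢
    have := dvd_add h2 h3
    push_cast at this
    convert this using 1; ring
  have hx2 : (1-z)^2 ∣ z0^4 - 1 := by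
    have := hw 0
    rw [mul_zero, pow_zero, mul_one] at this
    exact h.lam_step le_rfl (by norm_num) hx1 (hle (by norm_num) this)
  obtain ⟨c, hc⟩ := hx2
  obtain ⟨m, c', hm⟩ := h.lam_rep c
  -- choose j with m + 3 j = 0 mod 5
  obtain ⟨j, hj⟩ : ∃ j : ℕ, (5:ℤ) ∣ m + 3 * j := by
    refine ⟨((3 * m) % 5).toNat, ?_⟩
    have : (((3*m) % 5).toNat : ℤ) = (3*m) % 5 := Int.toNat_of_nonneg (Int.emod_nonneg _ (by norm_num))
    rw [this]; omega
  refine ⟨j, ?_⟩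
  set w := z0^4 * (eps z)^(4*j) with hwdef
  have hw3 : (1-z)^3 ∣ w - 1 := by
    obtain ⟨t, ht⟩ := h.eps4j j
    obtain ⟨s, hs⟩ := h.int_lam hj
    push_cast at hs
    refine ⟨t * z0^4 + c' + (1-z)^3 * s  + (1-z) * (3*j*c), ?_⟩
    rw [hwdef]
    linear_combination z0^4 * ht + (1 + 3*j*(1-z)^2) * hc + (1-z)^2 * hm + (1-z)^2 * hs
  have hw4 := h.lam_step (by norm_num) (by norm_num) hw3 (hle (by norm_num) (hw j))
  exact h.lam_step (by norm_num) (by norm_num) hw4 (hle (by norm_num) (hw j))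

end CK
end St14

namespace St14

/-- Bezout in a group whose fifth powers lie in H -/
lemma mem_of_zpow {G : Type*} [CommGroup G] (H : Subgroup G) (h5 : ∀ g : G, g^5 ∈ H) {x : G} {a : ℤ}
    (ha : ¬ 5 ∣ a) (hx : x^a ∈ H) : x ∈ H := by
  have hc : IsCoprime a 5 := ((Nat.prime_iff_prime_int.1 Nat.prime_five).coprime_iff_not_dvd.2 ha).symm
  obtain ⟨u, v, huv⟩ := hc
  have : x = (x^a)^u * ((x^5)^v) := by
    rw [← zpow_natCast x 5, ← zpow_mul, ← zpow_mul, ← zpow_add]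
    conv_lhs => rw [← zpow_one x, ← huv]
    congr 1; push_cast; ring
  rw [this]
  exact H.mul_mem (H.zpow_mem hx _) (H.zpow_mem (h5 x) _)

lemma mem_of_pow {G : Type*} [CommGroup G] (H : Subgroup G) (h5 : ∀ g : G, g^5 ∈ H) {x : G} {a : ℕ}
    (ha : ¬ 5 ∣ a) (hx : x^a ∈ H) : x ∈ H :=
  mem_of_zpow H h5 (a := a) (by exact_mod_cast ha) (by simpa using hx)

/-- fifth powers -/
def P5 (G : Type*) [CommGroup G] : Subgroup G := (powMonoidHom 5 : G →* G).range

lemma mem_P5 {G : Type*} [CommGroup G] {x : G} : x ∈ P5 G ↔ ∃ e, e^5 = x := by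
  unfold P5; simp [MonoidHom.mem_range]

lemma P5_pow {G : Type*} [CommGroup G] (g : G) : g^5 ∈ P5 G := mem_P5.2 ⟨g, rfl⟩

namespace CK
variable {K : Type} [Field K] [NumberField K] {z : 𝓞 K} {d : 𝓞 K ≃+* 𝓞 K}

noncomputable def zU (h : CK z d) : (𝓞 K)ˣ := h.zunit.unit
noncomputable def eU (h : CK z d) : (𝓞 K)ˣ := h.eps_unit.unit
@[simp] lemma zU_coe (h : CK z d) : (h.zU : 𝓞 K) = z := h.zunit.unit_spec
@[simp] lemma eU_coe (h : CK z d) : (h.eU : 𝓞 K) = eps z := h.eps_unit.unit_spec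

lemma zU5 (h : CK z d) : h.zU^5 = 1 := by
  ext; simp [h.z5]

lemma d_zU (h : CK z d) : Units.map (d : 𝓞 K →* 𝓞 K) h.zU = h.zU^2 := by
  apply Units.ext; simp [h.hd]

lemma d_eU (h : CK z d) : Units.map (d : 𝓞 K →* 𝓞 K) h.eU = -h.eU⁻¹ := by
  have : h.eU * Units.map (d : 𝓞 K →* 𝓞 K) h.eU = -1 := by
    apply Units.ext; simp [h.eps_d]
  rw [← mul_right_inj h.eU, this]; simp

lemma z_not_P5 (h : CK z d) : h.zU ∉ P5 _ := by
  intro hm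
  obtain ⟨e, he⟩ := mem_P5.1 hm
  obtain ⟨n, hn⟩ := h.frob5 (e : 𝓞 K)
  have : (e : 𝓞 K)^5 = z := by rw [← h.zU_coe, ← he]; simp
  rw [this] at hn
  have := h.dvd_rep (n := 5) (a := -n) (b := 1) (c := 0) (e := 0) (by
    push_cast; convert hn using 1; ring)
  omega

lemma e_not_P5 (h : CK z d) : h.eU ∉ P5 _ := by
  intro hm
  obtain ⟨e, he⟩ := mem_P5.1 hm
  obtain ⟨n, hn⟩ := h.frob5 (e : 𝓞 K)
  have : (e : 𝓞 K)^5 = eps z := by rw [← h.eU_coe, ← he]; simp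
  rw [this] at hn
  have := h.dvd_rep (n := 5) (a := -n) (b := 0) (c := -1) (e := -1) (by
    push_cast; convert hn using 1; unfold eps; ring)
  omega

lemma neg_one_P5 : (-1 : (𝓞 K)ˣ) ∈ P5 _ := mem_P5.2 ⟨-1, by norm_num [pow_succ]⟩

lemma indep (h : CK z d) {a b : ℤ} (hab : h.zU^a * h.eU^b ∈ P5 _) : 5 ∣ a ∧ 5 ∣ b := by
  have ha : 5 ∣ a := by
    by_contra ha
    have h1 : Units.map (d : 𝓞 K →* 𝓞 K) (h.zU^a * h.eU^b) ∈ P5 _ := by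
      obtain ⟨e, he⟩ := mem_P5.1 hab
      exact mem_P5.2 ⟨Units.map (d : 𝓞 K →* 𝓞 K) e, by rw [← map_pow, he]⟩
    have h2 := (P5 _).mul_mem hab h1
    rw [map_mul, map_zpow, map_zpow, h.d_zU, h.d_eU] at h2
    have h3 : h.zU ^ (3*a) ∈ P5 _ := by
      have h4 : h.zU ^ (3*a) = (h.zU ^ a * h.eU ^ b * ((h.zU ^ 2) ^ a * (-h.eU⁻¹) ^ b)) * (-1)^b := by
        have e1 : (-h.eU⁻¹) = (-1) * h.eU⁻¹ := by simp
        rw [e1, mul_zpow, inv_zpow]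
        have e2 : ((-1 : (𝓞 K)ˣ)^b) * (-1)^b = 1 := by
          rw [← mul_zpow]; simp
        have e3 : h.zU^(3*a) = h.zU^a * (h.zU^2)^a := by
          rw [← mul_zpow, ← pow_succ', zpow_mul]; norm_num
        rw [e3]
        calc _ = h.zU^a * (h.zU^2)^a * (((-1 : (𝓞 K)ˣ)^b) * (-1)^b) * (h.eU^b * (h.eU^b)⁻¹) := by
              rw [e2]; simp
          _ = _ := by ac_rfl
      rw [h4]
      exact (P5 _).mul_mem h2 ((P5 _).zpow_mem neg_one_P5 _)
    exact h.z_not_P5 (mem_of_zpow (P5 _) P5_pow (by omega) h3)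
  refine ⟨ha, ?_⟩
  by_contra hb
  obtain ⟨c, rfl⟩ := ha
  apply h.e_not_P5
  apply mem_of_zpow (P5 _) P5_pow hb
  rw [zpow_mul] at hab
  have : h.zU^(5:ℤ) = 1 := by have := h.zU5; exact_mod_cast this
  simpa [this] using hab

theorem unit_form (h : CK z d) (u : (𝓞 K)ˣ) : ∃ a b : ℤ, ∃ e : (𝓞 K)ˣ, u = h.zU^a * h.eU^b * e^5 := by
  have hcyc := h.cyc
  have hr : Units.rank K = 1 := by
    have := unit_rank h.hz
    rw [h.hK] at this; omega
  have key : ∃ f : (𝓞 K)ˣ, ∀ u : (𝓞 K)ˣ, ∃ a b : ℤ, ∃ e : (𝓞 K)ˣ, u = h.zU^a * f^b * e^5 := by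
    refine ⟨Units.fundSystem K (finCongr hr.symm 0), fun u => ?_⟩
    obtain ⟨⟨t, x⟩, h1, h2⟩ := Units.exist_unique_eq_mul_prod K u
    have h3 : IsOfFinOrder (((t : (𝓞 K)ˣ) : 𝓞 K) : K) := by
      have := (CommGroup.mem_torsion _).1 t.2
      rw [isOfFinOrder_iff_pow_eq_one] at this ⊢
      obtain ⟨n, hn, h4⟩ := this
      refine ⟨n, hn, ?_⟩
      have := congrArg (fun u : (𝓞 K)ˣ => ((u : 𝓞 K) : K)) h4
      simpa using this
    obtain ⟨r, hr2⟩ := h.hz.exists_neg_pow_of_isOfFinOrder (by decide) h3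
    refine ⟨r, x (finCongr hr.symm 0), (-1)^r, ?_⟩
    have h4 : (t : (𝓞 K)ˣ) = h.zU^r * (-1)^r := by
      apply uext
      rw [hr2, neg_pow]; simp; ring
    have h6 : ∏ i, Units.fundSystem K i ^ x i = Units.fundSystem K (finCongr hr.symm 0) ^ x (finCongr hr.symm 0) := by
      rw [← (finCongr hr.symm).prod_comp]; simp
    rw [h1]
    simp only [h6, h4]
    have : (((-1 : (𝓞 K)ˣ)^r)^5) = (-1)^r := by
      rw [← pow_mul, mul_comm, pow_mul]; norm_num [pow_succ]
    rw [this, zpow_natCast, mul_right_comm]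
  obtain ⟨f, hf⟩ := key
  -- f in terms of eps
  have hf2 : ∃ a b : ℤ, ∃ e : (𝓞 K)ˣ, f = h.zU^a * h.eU^b * e^5 := by
    obtain ⟨a, b, e, he⟩ := hf h.eU
    have hb : ¬ 5 ∣ b := by
      rintro ⟨c, rfl⟩
      have : h.zU^(-a) * h.eU^(1:ℤ) ∈ P5 _ := by
        refine mem_P5.2 ⟨f^c * e, ?_⟩
        rw [he, zpow_one, mul_pow, zpow_mul f, zpow_neg]
        rw [← zpow_natCast (f^c), ← zpow_mul, ← zpow_mul, mul_comm c]
        simp [mul_assoc]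
      have := (h.indep this).2
      omega
    have hc : IsCoprime b 5 := ((Nat.prime_iff_prime_int.1 Nat.prime_five).coprime_iff_not_dvd.2 hb).symm
    obtain ⟨u, v, huv⟩ := hc
    refine ⟨-a*u, u, f^v * (e⁻¹)^u, ?_⟩
    have e1 : f = f^(u*b) * f^(v*5) := by rw [← zpow_add, huv, zpow_one]
    have e2 : f^b = h.zU^(-a) * h.eU * (e⁻¹)^5 := by
      rw [he, zpow_neg, inv_pow]
      have : (h.zU ^ a)⁻¹ * (h.zU ^ a * f ^ b * e ^ 5) * (e ^ 5)⁻¹ = ((h.zU ^ a)⁻¹ * h.zU ^ a) * (e^5 * (e ^ 5)⁻¹) * f^b := by ac_rfl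
      rw [this]; simp
    have e3 : f^(u*b) = h.zU^(-a*u) * h.eU^u * ((e⁻¹)^u)^5 := by
      rw [mul_comm u, zpow_mul, e2, mul_zpow, mul_zpow, ← zpow_mul]
      congr 1
      rw [← zpow_natCast, ← zpow_natCast, ← zpow_mul, ← zpow_mul, mul_comm]
    conv_lhs => rw [e1]
    rw [e3, mul_pow, zpow_mul f]
    have : (f^v)^(5:ℤ) = (f^v)^5 := zpow_natCast (f^v) 5
    rw [this]; ac_rfl
  obtain ⟨a', b', e', he'⟩ := hf2
  obtain ⟨a, b, e, he⟩ := hf u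
  refine ⟨a + a' * b, b' * b, e'^b * e, ?_⟩
  rw [he, he', mul_zpow, mul_zpow, zpow_add, zpow_mul, zpow_mul, mul_pow]
  have : (e'^5)^b = (e'^b)^5 := by
    rw [← zpow_natCast, ← zpow_natCast, ← zpow_mul, ← zpow_mul, mul_comm]
  rw [this]; ac_rfl

theorem unit_index (h : CK z d) : (P5 (𝓞 K)ˣ).index = 25 := by
  have hb : Function.Bijective (fun p : Fin 5 × Fin 5 =>
      (QuotientGroup.mk (h.zU^((p.1 : ℕ) : ℤ) * h.eU^((p.2 : ℕ) : ℤ)) : (𝓞 K)ˣ ⧸ P5 (𝓞 K)ˣ)) := by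
    constructor
    · rintro ⟨a, b⟩ ⟨a', b'⟩ hab
      rw [QuotientGroup.eq] at hab
      have h1 : h.zU^((a' : ℕ) - (a : ℕ) : ℤ) * h.eU^((b' : ℕ) - (b : ℕ) : ℤ) ∈ P5 (𝓞 K)ˣ := by
        convert hab using 1
        simp only [zpow_sub, mul_inv]; ac_rfl
      have := h.indep h1
      ext <;> simp <;> omega
    · intro q
      obtain ⟨u, rfl⟩ := QuotientGroup.mk_surjective q
      obtain ⟨a, b, e, rfl⟩ := h.unit_form u
      refine ⟨(⟨(a % 5).toNat, by omega⟩, ⟨(b % 5).toNat, by omega⟩), ?_⟩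
      rw [QuotientGroup.eq]
      have ea : a = ((a % 5).toNat : ℤ) + (a / 5) * 5 := by omega
      have eb : b = ((b % 5).toNat : ℤ) + (b / 5) * 5 := by omega
      refine mem_P5.2 ⟨h.zU^(a/5) * h.eU^(b/5) * e, ?_⟩
      simp only
      generalize ((a % 5).toNat : ℤ) = a0 at *
      generalize ((b % 5).toNat : ℤ) = b0 at *
      generalize a / 5 = a1 at *
      generalize b / 5 = b1 at *
      subst ea eb
      rw [zpow_add, zpow_add, zpow_mul, zpow_mul, mul_pow, mul_pow]
      have : ∀ x : (𝓞 K)ˣ, x^(5:ℤ) = x^5 := fun x => zpow_natCast x 5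
      rw [this, this, eq_inv_mul_iff_mul_eq]; ac_rfl
  rw [Subgroup.index, ← Nat.card_eq_of_bijective _ hb]
  simp

end CK
end St14

namespace St14

lemma int_of_pow_eq {F : Type} [Field F] {p : ℕ} (hp : p.Prime) (hp0 : (p : F) = 0) {x : F} (hx : x^p = x) :
    ∃ n : ℤ, (n : F) = x := by
  have : Fact p.Prime := ⟨hp⟩
  have : CharP F p := by
    obtain ⟨c, hc⟩ := CharP.exists F
    have h1 := (CharP.cast_eq_zero_iff F c p).1 hp0
    rcases (Nat.dvd_prime hp).1 h1 with h2 | h2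
    · subst h2
      exact (CharP.false_of_nontrivial_of_char_one (R := F)).elim
    · exact h2 ▸ hc
  have h1 : x ∈ (⊥ : Subfield F) := (Subfield.mem_bot_iff_pow_eq_self F p).2 hx
  exact (_root_.mem_bot_iff_intCast p F).1 h1

namespace CK
variable {K : Type} [Field K] [NumberField K] {z : 𝓞 K} {d : 𝓞 K ≃+* 𝓞 K}

lemma exists_prime (h : CK z d) {p : ℕ} (hp : p.Prime) : ∃ g : 𝓞 K, Prime g ∧ g ∣ (p : 𝓞 K) := by
  have := h.pid
  have h1 : ¬ IsUnit (p : 𝓞 K) := by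
    intro hu
    have := h.dvd_int (n := p) (a := 1) (by simpa using hu.dvd)
    have h2 := Int.isUnit_iff.1 (isUnit_of_dvd_one this)
    have := hp.two_le
    omega
  have h2 : (p : 𝓞 K) ≠ 0 := by exact_mod_cast hp.ne_zero
  obtain ⟨g, hg, hgp⟩ := WfDvdMonoid.exists_irreducible_factor h1 h2
  exact ⟨g, hg.prime, hgp⟩

/-- a prime dividing `p` meets ℤ in `p` -/
lemma prime_int (h : CK z d) {p : ℕ} (hp : p.Prime) {g : 𝓞 K} (hg : Prime g) (hgp : g ∣ (p : 𝓞 K))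
    {n : ℤ} (hn : g ∣ (n : 𝓞 K)) : (p : ℤ) ∣ n := by
  by_contra hc
  have hc : IsCoprime (p : ℤ) n := (Nat.prime_iff_prime_int.1 hp).coprime_iff_not_dvd.2 hc
  obtain ⟨u, v, huv⟩ := hc
  apply hg.not_unit
  apply isUnit_of_dvd_one
  have : (1 : 𝓞 K) = u * p + v * n := by
    have := congrArg (Int.cast (R := 𝓞 K)) huv
    push_cast at this; exact this.symm
  rw [this]
  exact dvd_add (hgp.mul_left _) (hn.mul_left _)

lemma not_dvd_lam (h : CK z d) {p : ℕ} (hp : p.Prime) (hp5 : p ≠ 5) {g : 𝓞 K} (hg : Prime g) (hgp : g ∣ (p : 𝓞 K)) :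
    ¬ g ∣ (1 - z) := by
  intro hc
  have h1 : g ∣ ((5 : ℤ) : 𝓞 K) := by
    push_cast
    exact (hc.trans (dvd_pow_self _ (by norm_num))).trans h.lam4_dvd
  have := h.prime_int hp hg hgp h1
  have : p ∣ 5 := by exact_mod_cast this
  exact hp5 ((Nat.prime_dvd_prime_iff_eq hp Nat.prime_five).1 this)

lemma res_int (h : CK z d) {p : ℕ} (hp : p.Prime) {g : 𝓞 K} (hg : Prime g) (hgp : g ∣ (p : 𝓞 K))
    {x : 𝓞 K} (hx : g ∣ x^p - x) : ∃ n : ℤ, g ∣ x - n := by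
  have := h.pid
  have hmax : (Ideal.span {g}).IsMaximal :=
    PrincipalIdealRing.isMaximal_of_irreducible hg.irreducible
  letI := Ideal.Quotient.field (Ideal.span {g})
  have hp0 : ((p : ℕ) : 𝓞 K ⧸ Ideal.span {g}) = 0 := by
    rw [← map_natCast (Ideal.Quotient.mk (Ideal.span {g}))]
    exact Ideal.Quotient.eq_zero_iff_mem.2 (Ideal.mem_span_singleton.2 hgp)
  obtain ⟨n, hn⟩ := int_of_pow_eq hp hp0 (x := Ideal.Quotient.mk (Ideal.span {g}) x) (by
    rw [← map_pow, Ideal.Quotient.eq, Ideal.mem_span_singleton]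
    exact hx)
  refine ⟨n, ?_⟩
  rw [← Ideal.mem_span_singleton, ← Ideal.Quotient.eq, ← hn, map_intCast]

/-- congruences modulo a prime: order argument -/
lemma gcd_pow {g k : 𝓞 K} (hg : Prime g) (hk : ¬ g ∣ k) {m n : ℕ} (hm : g ∣ k^m - 1) (hn : g ∣ k^n - 1) :
    g ∣ k^(Nat.gcd m n) - 1 := by
  rw [← Ideal.mem_span_singleton, ← Ideal.Quotient.eq, map_pow, map_one] at *
  exact pow_gcd_eq_one.2 ⟨hm, hn⟩

lemma fermat {g k : 𝓞 K} (hg : Prime g) (hk : ¬ g ∣ k) {m : ℕ} (hm : 1 ≤ m) (h1 : g ∣ k^m - k) : g ∣ k^(m-1) - 1 := by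
  obtain ⟨m, rfl⟩ : ∃ m', m = m'+1 := ⟨m-1, by omega⟩
  have : k^(m+1) - k = k * (k^m - 1) := by ring
  rw [this] at h1
  exact (hg.dvd_or_dvd h1).resolve_left hk

lemma zeta_not_fifth (h : CK z d) {p m : ℕ} (hp : p.Prime) (hp5 : p ≠ 5) {g : 𝓞 K} (hg : Prime g) (hgp : g ∣ (p : 𝓞 K))
    (hm : 1 ≤ m) (hm25 : ¬ 25 ∣ m - 1) (hm0 : ∀ k : 𝓞 K, g ∣ k^m - k) (k : 𝓞 K) {a : ℤ} (ha : ¬ 5 ∣ a) {u : 𝓞 K}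
    (hu : u = ((h.zU^a : (𝓞 K)ˣ) : 𝓞 K)) : ¬ g ∣ u - k^5 := by
  intro hc
  have hu5 : u^5 = 1 := by
    rw [hu, ← Units.val_pow_eq_pow_val, ← zpow_natCast, ← zpow_mul, mul_comm, zpow_mul, zpow_natCast, h.zU5]; simp
  have hk25 : g ∣ k^25 - 1 := by
    have h1 : g ∣ u^5 - (k^5)^5 := hc.trans (sub_dvd_pow_sub_pow _ _ 5)
    rw [hu5, ← pow_mul] at h1
    rw [← neg_sub]; exact (dvd_neg).2 h1
  have hk : ¬ g ∣ k := by
    intro hk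
    have h1 : g ∣ k^25 := hk.trans (dvd_pow_self _ (by norm_num))
    apply hg.not_unit
    apply isUnit_of_dvd_one
    have := dvd_sub h1 hk25
    simpa using this
  have h1 := gcd_pow hg hk hk25 (fermat hg hk hm (hm0 k))
  have h2 : g ∣ k^5 - 1 := by
    have hd : Nat.gcd 25 (m-1) ∣ 5 := by
      have h3 : Nat.gcd 25 (m-1) ∣ 5^2 := Nat.gcd_dvd_left _ _
      obtain ⟨i, hi, hi2⟩ := (Nat.dvd_prime_pow Nat.prime_five).1 h3
      have : i ≠ 2 := by
        rintro rfl
        apply hm25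
        have := Nat.gcd_dvd_right 25 (m-1)
        rw [hi2] at this; simpa using this
      rw [hi2]
      have : i ≤ 1 := by omega
      exact (pow_dvd_pow 5 this).trans (by norm_num)
    obtain ⟨c, hc⟩ := hd
    have : k^5 - 1 = (k^(Nat.gcd 25 (m-1)))^c - 1^c := by rw [← pow_mul, ← hc]; simp
    rw [this]
    exact h1.trans (sub_dvd_pow_sub_pow _ _ c)
  have h3 : g ∣ u - 1 := by
    have := dvd_add hc h2
    simpa using this
  -- raise to a power to get z
  obtain ⟨r, s, hrs⟩ : IsCoprime a 5 := ((Nat.prime_iff_prime_int.1 Nat.prime_five).coprime_iff_not_dvd.2 ha).symm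
  have h4 : z = u^((r % 5).toNat) := by
    have hr : ((r % 5).toNat : ℤ) = r % 5 := by omega
    have h5 : ((r % 5).toNat : ℤ) = r + (-(r / 5)) * 5 := by omega
    rw [hu, ← Units.val_pow_eq_pow_val, ← zpow_natCast, ← zpow_mul, h5]
    have h6 : a * (r + (-(r / 5)) * 5) = 1 + 5 * (-s - a * (r/5)) := by linear_combination hrs
    rw [h6, zpow_add, zpow_mul]
    have : h.zU^(5:ℤ) = 1 := by have := h.zU5; exact_mod_cast this
    rw [this]; simp
  apply h.not_dvd_lam hp hp5 hg hgp
  have h7 := h3.trans (sub_dvd_pow_sub_pow u 1 ((r % 5).toNat))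
  rw [one_pow, ← h4] at h7
  rw [← neg_sub]; exact (dvd_neg).2 h7

lemma fifth_of_pow (h : CK z d) {p : ℕ} (hp : p.Prime) (hp4 : p % 5 = 4) {g x : 𝓞 K} (hx : g ∣ x^p - x) :
    ∃ k, g ∣ x - k^5 := by
  refine ⟨x^((3*p-2)/5), ?_⟩
  have h2 := hp.two_le
  have e : (3*p-2)/5*5 = p + p + (p-2) := by omega
  rw [← pow_mul, e, pow_add, pow_add]
  obtain ⟨c, hc⟩ := hx
  have e2 : x^p = x * x * x^(p-2) := by
    rw [mul_assoc, ← pow_succ', ← pow_succ']; congr 1; omega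
  refine ⟨-c - c * x^(p-2) * (x^p + x), ?_⟩
  linear_combination (-1 - x^(p-2) * (x^p + x)) * hc + e2

lemma d_fixed (h : CK z d) {x : 𝓞 K} (hx : d x = x) : ∃ n : ℤ, x = n := by
  obtain ⟨a, b, c, e, rfl⟩ := h.rep x
  rw [h.d_rep] at hx
  have := h.rep_zero (a := -c) (b := e - c - b) (c := b - c - c) (e := -c - e) (by
    push_cast; linear_combination hx - c * h.zsum)
  obtain ⟨h1, h2, h3, h4⟩ := this
  have hc : c = 0 := by omega
  have hb : b = 0 := by omega
  have he : e = 0 := by omega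
  exact ⟨a, by simp [hc, hb, he]⟩

lemma d_prime {g : 𝓞 K} (hg : Prime g) : Prime (d g) := (MulEquiv.prime_iff d.toMulEquiv).2 hg

lemma d_dvd {a b : 𝓞 K} : d a ∣ d b ↔ a ∣ b := map_dvd_iff d

lemma d_dvd_nat {g : 𝓞 K} {p : ℕ} (hgp : g ∣ (p : 𝓞 K)) : d g ∣ (p : 𝓞 K) := by
  have := map_dvd d hgp
  simpa using this

/-- p ≡ 1 mod 5 : d g is not divisible by g -/
lemma ndvd_one (h : CK z d) {p : ℕ} (hp : p.Prime) (h5 : p % 5 = 1) {g : 𝓞 K} (hg : Prime g) (hgp : g ∣ (p : 𝓞 K)) :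
    ¬ g ∣ d (d g) := by
  intro hc
  have hp5 : p ≠ 5 := by rintro rfl; simp at h5
  obtain ⟨n, hn⟩ := h.res_int hp hg hgp (hgp.trans (h.frob_one hp h5 z))
  have h1 : g ∣ d (d (z - n)) := hc.trans (map_dvd d (map_dvd d hn))
  have h2 := dvd_sub h1 hn
  have h3 : d (d (z - n)) - (z - n) = - (z * (1 - z) * (1 + z + z^2)) := by
    simp only [map_sub, map_intCast, h.hd, map_pow]; ring
  rw [h3, dvd_neg] at h2
  have hu2 : IsUnit (1 + z + z^2) := IsUnit.of_mul_eq_one (1 + z^3) (by linear_combination z*h.zsum)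
  rcases hg.dvd_or_dvd h2 with h4 | h4
  · rcases hg.dvd_or_dvd h4 with h5 | h5
    · exact hg.not_unit (isUnit_of_dvd_unit h5 h.zunit)
    · exact h.not_dvd_lam hp hp5 hg hgp h5
  · exact hg.not_unit (isUnit_of_dvd_unit h4 hu2)

lemma assoc_of_dvd {a b : 𝓞 K} (ha : Prime a) (hb : Prime b) (hab : a ∣ b) : b ∣ a :=
  (ha.dvd_prime_iff_associated hb).1 hab |>.symm.dvd

/-- p ≡ 4 mod 5 -/
lemma dvd_four (h : CK z d) {p : ℕ} (hp : p.Prime) (h5 : p % 5 = 4) {g : 𝓞 K} (hg : Prime g) (hgp : g ∣ (p : 𝓞 K)) :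
    g ∣ d (d g) := by
  have h1 := hgp.trans (h.frob_four hp h5 g)
  have h2 : g ∣ g^p := dvd_pow_self _ hp.ne_zero
  have := dvd_sub h2 h1
  simpa using this

lemma eps_d2 (h : CK z d) : d (d (eps z)) = eps z := by
  unfold eps
  simp only [map_neg, map_add, map_pow, h.hd]
  linear_combination (- z^3 - z^2 * (z^5 + 1)) * h.z5

lemma ndvd_four (h : CK z d) {p : ℕ} (hp : p.Prime) (h5 : p % 5 = 4) {g : 𝓞 K} (hg : Prime g) (hgp : g ∣ (p : 𝓞 K)) :
    ¬ g ∣ d g := by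
  intro hc
  have hp5 : p ≠ 5 := by rintro rfl; simp at h5
  have h0 := hgp.trans (h.frob_four hp h5 (eps z))
  rw [h.eps_d2] at h0
  obtain ⟨n, hn⟩ := h.res_int hp hg hgp h0
  have h1 : g ∣ d (eps z - n) := hc.trans (map_dvd d hn)
  have h2 := dvd_sub h1 hn
  have h3 : (d (eps z - n) - (eps z - n))^2 = 5 := by
    unfold eps
    simp only [map_neg, map_add, map_sub, map_intCast, h.hd, map_pow]
    linear_combination ((-5:𝓞 K)*z^0 + (5:𝓞 K)*z^1 + (1:𝓞 K)*z^4 + (-4:𝓞 K)*z^5 + (2:𝓞 K)*z^6 + (-1:𝓞 K)*z^7 + (1:𝓞 K)*z^8) * h.zsum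
  have h4 : g ∣ 5 := by rw [← h3]; exact h2.trans (dvd_pow_self _ (by norm_num))
  have h5 := h.prime_int hp hg hgp (n := 5) (by simpa using h4)
  have : p ∣ 5 := by exact_mod_cast h5
  exact hp5 ((Nat.prime_dvd_prime_iff_eq hp Nat.prime_five).1 this)

/-- product of the conjugates is an integer -/
lemma norm_int (h : CK z d) (x : 𝓞 K) : ∃ n : ℤ, x * d x * d (d x) * d (d (d x)) = n := by
  apply h.d_fixed
  simp only [map_mul, h.d4]; ring

end CK
end St14

namespace St14

section F5
variable {K : Type} [Field K] [NumberField K]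

/-- `x` is a fifth power modulo `g` -/
def F5 (g x : 𝓞 K) : Prop := ∃ k, g ∣ x - k^5

lemma inv_mod {g y : 𝓞 K} (hg : Prime g) (hy : ¬ g ∣ y) : ∃ y', g ∣ y * y' - 1 := by
  have hp : (Ideal.span {g}).IsPrime := (Ideal.span_singleton_prime hg.ne_zero).2 hg
  have hm : (Ideal.span {g}).IsMaximal := hp.isMaximal (by simpa using hg.ne_zero)
  obtain ⟨y', i, hi, h⟩ := hm.exists_inv (x := y) (by rwa [Ideal.mem_span_singleton])
  refine ⟨y', ?_⟩
  rw [Ideal.mem_span_singleton] at hi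
  obtain ⟨c, hc⟩ := hi
  exact ⟨-c, by linear_combination h - hc⟩

namespace F5
variable {g x y : 𝓞 K}

lemma mul (hx : F5 g x) (hy : F5 g y) : F5 g (x * y) := by
  obtain ⟨k, hk⟩ := hx
  obtain ⟨l, hl⟩ := hy
  refine ⟨k * l, ?_⟩
  have : x * y - (k*l)^5 = x * (y - l^5) + l^5 * (x - k^5) := by ring
  rw [this]; exact dvd_add (hl.mul_left _) (hk.mul_left _)

lemma p5 (g x : 𝓞 K) : F5 g (x^5) := ⟨x, by simp⟩

lemma one (g : 𝓞 K) : F5 g 1 := ⟨1, by simp⟩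

lemma pow (hx : F5 g x) (n : ℕ) : F5 g (x^n) := by
  induction n with
  | zero => simpa using one g
  | succ n ih => rw [pow_succ]; exact ih.mul hx

lemma congr (hx : F5 g x) (h : g ∣ y - x) : F5 g y := by
  obtain ⟨k, hk⟩ := hx
  exact ⟨k, by have := dvd_add h hk; simpa using this⟩

lemma cancel (hg : Prime g) (hxy : F5 g (x * y)) (hy : F5 g y) (h0 : ¬ g ∣ y) : F5 g x := by
  obtain ⟨y', hy'⟩ := inv_mod hg h0
  obtain ⟨l, hl⟩ := hy
  have hl0 : ¬ g ∣ l := by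
    intro hc
    exact h0 (by have := dvd_add hl (dvd_pow hc (n := 5) (by norm_num)); simpa using this)
  obtain ⟨l', hl'⟩ := inv_mod hg hl0
  have h1 : g ∣ (l*l')^5 - 1 := hl'.trans (by simpa using sub_dvd_pow_sub_pow (l*l') 1 5)
  -- x ≡ x y l'^5
  refine (hxy.mul (p5 g l')).congr ?_
  have : x - x * y * l'^5 = - x * ((l*l')^5 - 1) - x * l'^5 * (y - l^5) := by ring
  rw [this]; exact dvd_sub (h1.mul_left _) (hl.mul_left _)

lemma of_pow (hg : Prime g) {a : ℕ} (ha : ¬ 5 ∣ a) (hx : F5 g (x^a)) : F5 g x := by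
  by_cases h0 : g ∣ x
  · exact ⟨0, by simpa using h0⟩
  have h1 : a^4 % 5 = 1 := by
    rw [Nat.pow_mod]
    have : a % 5 < 5 := Nat.mod_lt _ (by norm_num)
    have h2 : a % 5 ≠ 0 := fun h => ha (Nat.dvd_of_mod_eq_zero h)
    interval_cases (a % 5) <;> simp_all
  have h2 : a * a^3 = 1 + 5 * (a^4/5) := by
    have := Nat.div_add_mod (a^4) 5
    rw [h1] at this; rw [← this.trans (by ring : a^4 = a * a^3)]; ring
  have h3 := hx.pow (a^3)
  rw [← pow_mul, h2, pow_add, pow_one, mul_comm 5, pow_mul] at h3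
  exact cancel hg h3 (p5 _ _) (fun h => h0 (hg.dvd_of_dvd_pow (hg.dvd_of_dvd_pow h)))

lemma map (d : 𝓞 K ≃+* 𝓞 K) (hx : F5 g x) : F5 (d g) (d x) := by
  obtain ⟨k, hk⟩ := hx
  exact ⟨d k, by simpa using map_dvd d hk⟩

lemma of_dvd {g' : 𝓞 K} (hx : F5 g x) (h : g' ∣ g) : F5 g' x := by
  obtain ⟨k, hk⟩ := hx
  exact ⟨k, h.trans hk⟩
end F5
end F5

lemma exists_kummer {K : Type} [Field K] [NumberField K] {ζ : K} (hζ : IsPrimitiveRoot ζ 5)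
    (hK : Module.finrank ℚ K = 4) {a : K} (ha : ∀ b : K, b^5 ≠ a) :
    ∃ (T : Type) (_ : Field T) (_ : NumberField T) (_ : Algebra K T) (σ : T ≃ₐ[K] T) (y : T),
      KD ζ σ y ∧ y^5 = algebraMap K T a := by
  have ha0 : a ≠ 0 := fun h => ha 0 (by simp [h])
  have H : Irreducible (X^5 - C a : K[X]) :=
    X_pow_sub_C_irreducible_of_prime (by norm_num : Nat.Prime 5) ha
  haveI : Fact (Irreducible (X^5 - C a : K[X])) := ⟨H⟩
  let T := AdjoinRoot (X^5 - C a : K[X])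
  have hm : (X^5 - C a : K[X]).Monic := monic_X_pow_sub_C _ (by norm_num)
  have hd : (X^5 - C a : K[X]).natDegree = 5 := natDegree_X_pow_sub_C
  let pb := AdjoinRoot.powerBasis hm.ne_zero
  have hfin : Module.finrank K T = 5 := by
    rw [pb.finrank]; simp [pb, AdjoinRoot.powerBasis_dim, hd]
  haveI : FiniteDimensional K T := pb.finite
  haveI : CharZero T := charZero_of_injective_algebraMap (algebraMap K T).injective
  haveI : IsScalarTower ℚ K T := inferInstance
  haveI : NumberField T :=
    { to_charZero := inferInstance, to_finiteDimensional := FiniteDimensional.trans ℚ K T }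
  let η : rootsOfUnity 5 K := hζ.toRootsOfUnity
  refine ⟨T, inferInstance, inferInstance, inferInstance, autAdjoinRootXPowSubC 5 a η, AdjoinRoot.root _, ⟨hζ, hK, hfin, ?_, ?_⟩, ?_⟩
  · exact root_X_pow_sub_C_ne_zero' (by norm_num) ha0
  · rw [autAdjoinRootXPowSubC_root, Algebra.smul_def]; rfl
  · have := AdjoinRoot.eval₂_root (X^5 - C a : K[X])
    simp [sub_eq_zero] at this
    exact this

end St14

namespace St14

section cl
variable {T : Type} [Field T] [NumberField T]

/-- class of a nonzero ideal -/
noncomputable def cl (I : Ideal (𝓞 T)) : ClassGroup (𝓞 T) :=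
  open Classical in if h : I ≠ 0 then ClassGroup.mk0 ⟨I, mem_nonZeroDivisors_of_ne_zero h⟩ else 1

lemma cl_def {I : Ideal (𝓞 T)} (h : I ≠ 0) : cl I = ClassGroup.mk0 ⟨I, mem_nonZeroDivisors_of_ne_zero h⟩ := by
  rw [cl, dif_pos h]

lemma cl_surj (c : ClassGroup (𝓞 T)) : ∃ I : Ideal (𝓞 T), I ≠ 0 ∧ cl I = c := by
  obtain ⟨⟨I, hI⟩, rfl⟩ := ClassGroup.mk0_surjective c
  have : I ≠ 0 := nonZeroDivisors.ne_zero hI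
  exact ⟨I, this, cl_def this⟩

lemma cl_mul {I J : Ideal (𝓞 T)} (hI : I ≠ 0) (hJ : J ≠ 0) : cl (I * J) = cl I * cl J := by
  rw [cl_def hI, cl_def hJ, cl_def (mul_ne_zero hI hJ), ← map_mul]; rfl

lemma cl_one : cl (1 : Ideal (𝓞 T)) = 1 := by
  rw [cl_def one_ne_zero]; exact map_one _

lemma cl_pow {I : Ideal (𝓞 T)} (hI : I ≠ 0) (n : ℕ) : cl (I^n) = cl I ^ n := by
  induction n with
  | zero => rw [pow_zero, pow_zero, cl_one]
  | succ n ih => rw [pow_succ, pow_succ, cl_mul (pow_ne_zero _ hI) hI, ih]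

lemma cl_eq_one {I : Ideal (𝓞 T)} (hI : I ≠ 0) : cl I = 1 ↔ ∃ x : 𝓞 T, x ≠ 0 ∧ I = Ideal.span {x} := by
  rw [cl_def hI, ClassGroup.mk0_eq_one_iff]
  constructor
  · rintro ⟨x, hx⟩
    refine ⟨x, ?_, hx⟩
    rintro rfl
    exact hI (hx.trans (by simp))
  · rintro ⟨x, -, hx⟩
    exact ⟨x, hx⟩

lemma cl_span {x : 𝓞 T} (hx : x ≠ 0) : cl (Ideal.span {x}) = 1 :=
  (cl_eq_one (by simpa using hx)).2 ⟨x, hx, rfl⟩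

lemma cl_eq {I J : Ideal (𝓞 T)} (hI : I ≠ 0) (hJ : J ≠ 0) : cl I = cl J ↔ ∃ a b : 𝓞 T, a ≠ 0 ∧ b ≠ 0 ∧
    Ideal.span {a} * I = Ideal.span {b} * J := by
  rw [cl_def hI, cl_def hJ, ClassGroup.mk0_eq_mk0_iff]
  constructor
  · rintro ⟨x, y, h1, h2, h3⟩; exact ⟨x, y, h1, h2, h3⟩
  · rintro ⟨x, y, h1, h2, h3⟩; exact ⟨x, y, h1, h2, h3⟩

lemma iS_ne (τ : T ≃+* T) {I : Ideal (𝓞 T)} (hI : I ≠ 0) : iS τ I ≠ 0 := iS_ne_bot τ hI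

lemma oi_ne (τ : T ≃+* T) {x : 𝓞 T} (hx : x ≠ 0) : oi τ x ≠ 0 := by simpa using hx

lemma span_ne {x : 𝓞 T} (hx : x ≠ 0) : Ideal.span {x} ≠ 0 := by simpa using hx

lemma cl_iS (τ : T ≃+* T) {I J : Ideal (𝓞 T)} (hI : I ≠ 0) (hJ : J ≠ 0) (h : cl I = cl J) : cl (iS τ I) = cl (iS τ J) := by
  obtain ⟨a, b, ha, hb, hab⟩ := (cl_eq hI hJ).1 h
  refine (cl_eq (iS_ne τ hI) (iS_ne τ hJ)).2 ⟨oi τ a, oi τ b, oi_ne τ ha, oi_ne τ hb, ?_⟩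
  rw [← iS_span, ← iS_span, ← map_mul, ← map_mul, hab]

/-- action of an automorphism on the class group -/
noncomputable def cS (τ : T ≃+* T) : ClassGroup (𝓞 T) →* ClassGroup (𝓞 T) where
  toFun c := cl (iS τ (cl_surj c).choose)
  map_one' := by
    have h := (cl_surj (1 : ClassGroup (𝓞 T))).choose_spec
    rw [cl_iS τ h.1 one_ne_zero (by rw [h.2, cl_one]), map_one, cl_one]
  map_mul' c e := by
    have h1 := (cl_surj c).choose_spec
    have h2 := (cl_surj e).choose_spec
    have h := (cl_surj (c * e)).choose_spec
    rw [cl_iS τ h.1 (mul_ne_zero h1.1 h2.1) (by rw [h.2, cl_mul h1.1 h2.1, h1.2, h2.2]), map_mul,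
      cl_mul (iS_ne τ h1.1) (iS_ne τ h2.1)]

lemma cS_cl (τ : T ≃+* T) {I : Ideal (𝓞 T)} (hI : I ≠ 0) : cS τ (cl I) = cl (iS τ I) := by
  have h := (cl_surj (cl I)).choose_spec
  exact cl_iS τ h.1 hI h.2

lemma cS_comp (τ ρ : T ≃+* T) (c : ClassGroup (𝓞 T)) : cS τ (cS ρ c) = cS (τ * ρ) c := by
  obtain ⟨I, hI, rfl⟩ := cl_surj c
  rw [cS_cl ρ hI, cS_cl τ (iS_ne ρ hI), cS_cl _ hI, iS_comp]

lemma cS_one (c : ClassGroup (𝓞 T)) : cS (1 : T ≃+* T) c = c := by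
  obtain ⟨I, hI, rfl⟩ := cl_surj c
  rw [cS_cl _ hI, iS_one]

end cl

section gen
variable {K T : Type} [Field K] [NumberField K] [Field T] [NumberField T] [Algebra K T]
variable {ζ : K} {σ : T ≃ₐ[K] T} {y : T}

lemma cl_iJ [IsPrincipalIdealRing (𝓞 K)] {I : Ideal (𝓞 K)} (hI : I ≠ 0) : cl (iJ K T I) = 1 := by
  obtain ⟨k, hk⟩ := IsPrincipalIdealRing.principal I
  have hk0 : k ≠ 0 := by rintro rfl; exact hI (hk.trans (by simp))
  have hk : I = Ideal.span {k} := hk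
  rw [hk, iJ_span]
  apply cl_span
  intro h
  apply hk0
  exact FaithfulSMul.algebraMap_injective (𝓞 K) (𝓞 T) (by rw [h, map_zero])

lemma nI_ne {I : Ideal (𝓞 T)} (hI : I ≠ 0) : Ideal.relNorm (𝓞 K) I ≠ 0 := by
  rw [Ideal.zero_eq_bot, Ne, Ideal.relNorm_eq_bot_iff]; exact hI

lemma KD.cS_norm [IsPrincipalIdealRing (𝓞 K)] (h : KD ζ σ y) (c : ClassGroup (𝓞 T)) :
   c * cS σ.toRingEquiv c * cS σ.toRingEquiv (cS σ.toRingEquiv c) *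
   cS σ.toRingEquiv (cS σ.toRingEquiv (cS σ.toRingEquiv c)) *
   cS σ.toRingEquiv (cS σ.toRingEquiv (cS σ.toRingEquiv (cS σ.toRingEquiv c))) = 1 := by
  obtain ⟨I, hI, rfl⟩ := cl_surj c
  have e := h.iJ_nI I
  have h1 := iS_ne σ.toRingEquiv hI
  have h2 := iS_ne σ.toRingEquiv h1
  have h3 := iS_ne σ.toRingEquiv h2
  have h4 := iS_ne σ.toRingEquiv h3
  rw [cS_cl _ hI, cS_cl _ h1, cS_cl _ h2, cS_cl _ h3, ← cl_mul hI h1, ← cl_mul (mul_ne_zero hI h1) h2,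
    ← cl_mul (mul_ne_zero (mul_ne_zero hI h1) h2) h3,
    ← cl_mul (mul_ne_zero (mul_ne_zero (mul_ne_zero hI h1) h2) h3) h4, ← e, cl_iJ (nI_ne hI)]

/-- abstract nilpotency: if σ has norm trivial on c with c^5=1 and no nontrivial fixed points then c = 1 -/
lemma nilp {G : Type} [CommGroup G] (s : G →* G) (hn : ∀ c, c * s c * s (s c) * s (s (s c)) * s (s (s (s c))) = 1)
    (hf : ∀ c : G, c^5 = 1 → s c = c → c = 1) (c : G) (hc : c^5 = 1) : c = 1 := by
  let n : G → G := fun c => s c / c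
  have hn5 : ∀ c : G, c^5 = 1 → (n c)^5 = 1 := by
    intro c hc; simp only [n, div_pow, ← map_pow, hc, map_one, div_one]
  have hz : ∀ c : G, c^5 = 1 → n c = 1 → c = 1 := by
    intro c hc h1; exact hf c hc (div_eq_one.1 h1)
  have h1 := hn5 c hc
  have h2 := hn5 _ h1
  have h3 := hn5 _ h2
  apply hz c hc; apply hz _ h1; apply hz _ h2; apply hz _ h3
  have e1 := hn c
  -- (s-1)^4 = N - 5 (...)
  have hs5 : (s c)^5 = 1 := by rw [← map_pow, hc, map_one]
  have hss5 : (s (s c))^5 = 1 := by rw [← map_pow, hs5, map_one]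
  have hsss5 : (s (s (s c)))^5 = 1 := by rw [← map_pow, hss5, map_one]
  simp only [n, _root_.map_div]
  have key : ∀ a b c d e : G, b^5 = 1 → c^5 = 1 → d^5=1 → a * b * c * d * e = 1 →
      e / d / (d / c) / (d / c / (c / b)) / (d / c / (c / b) / (c / b / (b / a))) = 1 := by
    intro a b c d e hb hc hd h
    have : e / d / (d / c) / (d / c / (c / b)) / (d / c / (c / b) / (c / b / (b / a))) =
      (a * b * c * d * e) * (c^5) / (b^5 * d^5) := by
      have : ∀ a b c d e : Additive G, e - d - (d - c) - (d - c - (c - b)) - (d - c - (c - b) - (c - b - (b - a))) =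
        (a + b + c + d + e) + (5 • c) - (5 • b + 5 • d) := by intros; abel
      exact this a b c d e
    rw [this, hb, hc, hd, h]; simp
  exact key _ _ _ _ _ hs5 hss5 hsss5 e1
end gen
end St14

namespace St14
section
variable {K T : Type} [Field K] [NumberField K] [Field T] [NumberField T] [Algebra K T]

lemma exists_over (q : Ideal (𝓞 K)) (hq : Prime q) : ∃ P : Ideal (𝓞 T), P.IsPrime ∧ P ≠ ⊥ ∧
    P.comap (algebraMap (𝓞 K) (𝓞 T)) = q := by
  have := Ideal.isPrime_of_prime hq
  have hm : q.IsMaximal := this.isMaximal hq.ne_zero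
  obtain ⟨P, hP, hP2⟩ := Ideal.exists_maximal_ideal_liesOver_of_isIntegral (S := 𝓞 T) q
  have h2 : P.comap (algebraMap (𝓞 K) (𝓞 T)) = q := hP2.over.symm
  refine ⟨P, hP.isPrime, ?_, h2⟩
  rintro rfl
  apply hq.ne_zero
  rw [← h2]
  exact Ideal.comap_bot_of_injective _ (FaithfulSMul.algebraMap_injective (𝓞 K) (𝓞 T))

lemma ram_unique {P Q : Ideal (𝓞 T)} (hP : Ram K P) (hQ : Ram K Q)
    (h : P.comap (algebraMap (𝓞 K) (𝓞 T)) = Q.comap (algebraMap (𝓞 K) (𝓞 T))) : P = Q :=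
  ideal_pow_inj (n := 5) (by norm_num) (by rw [hP.2.2, hQ.2.2, h])

lemma primeK_span {g : 𝓞 K} (hg : Prime g) : Prime (Ideal.span {g}) :=
  (Ideal.prime_span_singleton_iff).2 hg

lemma dvd_iJ {P : Ideal (𝓞 T)} {J : Ideal (𝓞 K)} : P ∣ iJ K T J ↔ P.comap (algebraMap (𝓞 K) (𝓞 T)) ∣ J := by
  rw [Ideal.dvd_iff_le, Ideal.dvd_iff_le, iJ_def, Ideal.map_le_iff_le_comap]

lemma vv_span {g w : 𝓞 K} : vv (Ideal.span {g}) (Ideal.span {w}) = multiplicity g w := by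
  unfold vv
  apply multiplicity_eq_of_emultiplicity_eq
  rw [emultiplicity_eq_emultiplicity_iff]
  intro n
  rw [Ideal.span_singleton_pow, Ideal.dvd_span_singleton, Ideal.mem_span_singleton]

variable {ζ : K} {σ : T ≃ₐ[K] T} {y : T}
namespace KD

lemma ram_of_val (h : KD ζ σ y) {x : 𝓞 T} {w : 𝓞 K} (hx : x^5 = algebraMap (𝓞 K) (𝓞 T) w) (hw : w ≠ 0)
    {P : Ideal (𝓞 T)} (hP : P.IsPrime) (hP0 : P ≠ ⊥)
    (hv : ¬ 5 ∣ vv (P.comap (algebraMap (𝓞 K) (𝓞 T))) (Ideal.span {w})) : Ram K P := by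
  set p := P.comap (algebraMap (𝓞 K) (𝓞 T)) with hp
  have hPP : Prime P := Ideal.prime_of_isPrime hP0 hP
  have hp0 : p ≠ 0 := by
    intro hc
    have : P ∣ iJ K T p := dvd_iJ.2 (by rw [← hp])
    have hx0 : x ≠ 0 := by
      rintro rfl
      apply hw
      apply FaithfulSMul.algebraMap_injective (𝓞 K) (𝓞 T)
      rw [← hx]; simp
    -- comap of nonzero ideal is nonzero
    exact Ideal.IsIntegral.comap_ne_bot (R := 𝓞 K) hP0 hc
  have hpp : Prime p := Ideal.prime_of_isPrime hp0 (Ideal.comap_isPrime _ _)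
  have main : vv P (iJ K T p) = 1 → False := by
    intro h1
    obtain ⟨J, hJ, hJ2⟩ := vv_dec hpp (I := Ideal.span {w}) (span_ne hw)
    have hJ0 : J ≠ 0 := by rintro rfl; exact hJ2 (dvd_zero _)
    have e : (Ideal.span {x})^5 = (iJ K T p)^(vv p (Ideal.span {w})) * iJ K T J := by
      rw [Ideal.span_singleton_pow, hx, ← iJ_span, ← map_pow, ← map_mul, ← hJ]
    have hx0 : Ideal.span {x} ≠ 0 := by
      intro h0
      rw [h0, zero_pow (by norm_num)] at e
      exact mul_ne_zero (pow_ne_zero _ (iJ_ne_zero hp0)) (iJ_ne_zero hJ0) e.symm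
    have e2 := congrArg (vv P) e
    rw [vv_pow hPP hx0, vv_mul hPP (pow_ne_zero _ (iJ_ne_zero hp0)) (iJ_ne_zero hJ0),
      vv_pow hPP (iJ_ne_zero hp0), h1, vv_zero (I := iJ K T J) (fun hd => hJ2 (dvd_iJ.1 hd))] at e2
    exact hv ⟨vv P (Ideal.span {x}), by linarith⟩
  rcases h.prime_cases hP hP0 with h1 | h1 | h1
  · exact ⟨hP, hP0, h1.2.1⟩
  · exfalso; apply main; rw [← hp] at h1; rw [← h1, vv_self hPP]
  · exfalso; apply main
    obtain ⟨h1, h2, h3⟩ := h1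
    obtain ⟨a1, a2, a3⟩ := h.distinct h1
    have q1 := iS_Prime σ.toRingEquiv hPP
    have q2 := iS_Prime σ.toRingEquiv q1
    have q3 := iS_Prime σ.toRingEquiv q2
    have q4 := iS_Prime σ.toRingEquiv q3
    rw [← hp] at h2
    rw [h2, vv_mul hPP (by simp only [ne_eq, mul_eq_zero, hPP.ne_zero, q1.ne_zero, q2.ne_zero, q3.ne_zero, or_self, not_false_eq_true]) q4.ne_zero,
      vv_mul hPP (by simp only [ne_eq, mul_eq_zero, hPP.ne_zero, q1.ne_zero, q2.ne_zero, q3.ne_zero, or_self, not_false_eq_true]) q3.ne_zero,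
      vv_mul hPP (by simp only [ne_eq, mul_eq_zero, hPP.ne_zero, q1.ne_zero, q2.ne_zero, q3.ne_zero, or_self, not_false_eq_true]) q2.ne_zero,
      vv_mul hPP hPP.ne_zero q1.ne_zero, vv_self hPP, vv_ne hPP q1 h1.symm, vv_ne hPP q2 a1.symm, vv_ne hPP q3 a2.symm, vv_ne hPP q4 a3.symm]

/-- prime not inert when w is a fifth power -/
lemma not_inert {z : 𝓞 K} (h : KD (z : K) σ y) {x : 𝓞 T} (hxy : (x : T) = y) {w k : 𝓞 K} (hx : x^5 = algebraMap (𝓞 K) (𝓞 T) w)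
    {P : Ideal (𝓞 T)} (hP : P.IsPrime) (hP0 : P ≠ ⊥)
    (hw : w ∉ P.comap (algebraMap (𝓞 K) (𝓞 T))) (hl : 1 - z ∉ P.comap (algebraMap (𝓞 K) (𝓞 T)))
    (hk : w - k^5 ∈ P.comap (algebraMap (𝓞 K) (𝓞 T))) :
    Ideal.relNorm (𝓞 K) P = P.comap (algebraMap (𝓞 K) (𝓞 T)) := by
  have hs : oi σ.toRingEquiv x = algebraMap (𝓞 K) (𝓞 T) z * x := by
    apply RingOfIntegers.ext
    rw [oi_coe, hxy]
    simp only [map_mul, hxy]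
    exact h.hy
  rcases h.prime_cases hP hP0 with h1 | h1 | h1
  · exact h1.2.2
  · exfalso
    set Z := algebraMap (𝓞 K) (𝓞 T) z with hZ
    set k' := algebraMap (𝓞 K) (𝓞 T) k with hk'
    have hSP : iS σ.toRingEquiv P = P := by rw [h1, iS_iJ]
    have hz1 : z^5 = 1 := by
      apply RingOfIntegers.ext; simpa using h.hζ.pow_eq_one
    have hz2 : z ≠ 1 := by
      intro hc; exact h.hζ.ne_one (by norm_num) (by rw [hc]; simp)
    have hzs : 1 + z + z^2 + z^3 + z^4 = 0 := by
      have : (z - 1) * (1 + z + z^2 + z^3 + z^4) = 0 := by linear_combination hz1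
      exact (mul_eq_zero.1 this).resolve_left (sub_ne_zero.2 hz2)
    have hZs : 1 + Z + Z^2 + Z^3 + Z^4 = 0 := by
      have := congrArg (algebraMap (𝓞 K) (𝓞 T)) hzs
      simpa only [map_add, map_pow, map_one, map_zero] using this
    have hpr : x^5 - k'^5 = (x - k') * (x - Z * k') * (x - Z^2 * k') * (x - Z^3 * k') * (x - Z^4 * k') := by
      linear_combination (-x*k'^4*Z^6 + x^2*k'^3*(Z^3+Z^5) - x^3*k'^2*(Z+Z^3) + x^4*k' + k'^5*(Z-1)*(Z^5+1)) * hZs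
    have hx0 : x ∉ P := by
      intro hc
      apply hw
      rw [Ideal.mem_comap, ← hx]
      exact Ideal.pow_mem_of_mem _ hc _ (by norm_num)
    have hmem : x^5 - k'^5 ∈ P := by
      rw [hx, hk', ← map_pow, ← map_sub]; exact hk
    have fin : ∀ i : ℕ, x - Z^i * k' ∈ P → False := by
      intro i hi
      have h2 := iS_mem (τ := σ.toRingEquiv) hi
      rw [hSP, map_sub, hs, map_mul, map_pow] at h2
      have ha : ∀ k : 𝓞 K, oi σ.toRingEquiv (algebraMap (𝓞 K) (𝓞 T) k) = algebraMap (𝓞 K) (𝓞 T) k :=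
        fun k => RingOfIntegers.ext (σ.commutes _)
      rw [ha z, ha k] at h2
      have h3 := P.sub_mem hi h2
      have e : x - Z^i * k' - (Z * x - Z^i * k') = (1 - Z) * x := by ring
      rw [← hZ, ← hk', e] at h3
      rcases hP.mem_or_mem h3 with h4 | h4
      · apply hl; rw [Ideal.mem_comap, map_sub, map_one]; exact h4
      · exact hx0 h4
    rw [hpr] at hmem
    rcases hP.mem_or_mem hmem with hm | hm
    · rcases hP.mem_or_mem hm with hm | hm
      · rcases hP.mem_or_mem hm with hm | hm
        · rcases hP.mem_or_mem hm with hm | hm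
          · exact fin 0 (by simpa using hm)
          · exact fin 1 (by simpa using hm)
        · exact fin 2 hm
      · exact fin 3 hm
    · exact fin 4 hm
  · exact h1.2.2

lemma ram_mul_mem {z : 𝓞 K} (h : KD (z : K) σ y) {x : 𝓞 T} (hxy : (x : T) = y) {P : Ideal (𝓞 T)} (hP : Ram K P) :
    algebraMap (𝓞 K) (𝓞 T) (1 - z) * x ∈ P := by
  have := h.ram_sub hP x
  have hs : oi σ.toRingEquiv x = algebraMap (𝓞 K) (𝓞 T) z * x := by
    apply RingOfIntegers.ext
    rw [oi_coe, hxy]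
    simp only [map_mul, hxy]
    exact h.hy
  rw [hs] at this
  have := P.neg_mem this
  rw [map_sub, map_one]
  convert this using 1; ring

/-- if w ≡ 1 mod λ^5 then ramified primes contain x -/
lemma ram_mem {z : 𝓞 K} (h : KD (z : K) σ y) {x : 𝓞 T} (hxy : (x : T) = y) {w : 𝓞 K} (hx : x^5 = algebraMap (𝓞 K) (𝓞 T) w)
    (hl4 : (1 - z)^4 ∣ 5) (hw : (1-z)^5 ∣ w - 1) {P : Ideal (𝓞 T)} (hP : Ram K P) : x ∈ P := by
  obtain ⟨c, hc⟩ := hl4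
  obtain ⟨f, hf⟩ := hw
  have hz2 : z ≠ 1 := by
    intro hc; exact h.hζ.ne_one (by norm_num) (by rw [hc]; simp)
  set A := algebraMap (𝓞 K) (𝓞 T) with hA
  have hinj : Function.Injective A := FaithfulSMul.algebraMap_injective (𝓞 K) (𝓞 T)
  have hl0' : A (1 - z) ≠ 0 := by
    rw [Ne, map_eq_zero_iff A hinj]; exact sub_ne_zero.2 hz2.symm
  set l : 𝓞 T := A (1 - z) with hl
  have hl0 : (l : T) ≠ 0 := by simpa using hl0'
  let t : T := ((x : T) - 1) / l
  have ht : (x : T) = 1 + l * t := by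
    simp only [t]; field_simp; ring
  have h5 : (5 : T) = (l : T)^4 * ((A c : 𝓞 T) : T) := by
    have := congrArg (fun k => ((A k : 𝓞 T) : T)) hc
    simp only [map_mul, map_pow, map_ofNat] at this
    exact this
  have hwT : (x : T)^5 - 1 = (l : T)^5 * ((A f : 𝓞 T) : T) := by
    have := congrArg (fun k => ((A k : 𝓞 T) : T)) hf
    have h2 := congrArg (fun k : 𝓞 T => (k : T)) hx
    simp only [map_sub, map_mul, map_pow, map_one] at this h2
    rw [h2, this]; simp [hl]
  have hti : t^5 + ((l^3 * A c : 𝓞 T) : T) * t^4 + ((2 * l^2 * A c : 𝓞 T) : T) * t^3 + ((2 * l * A c : 𝓞 T) : T) * t^2 + ((A c : 𝓞 T) : T) * t - ((A f : 𝓞 T) : T) = 0 := by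
    have h6 : (l : T)^5 * (t^5 + ((l^3 * A c : 𝓞 T) : T) * t^4 + ((2 * l^2 * A c : 𝓞 T) : T) * t^3 + ((2 * l * A c : 𝓞 T) : T) * t^2 + ((A c : 𝓞 T) : T) * t - ((A f : 𝓞 T) : T)) = 0 := by
      simp only [map_mul, map_pow, map_ofNat]
      rw [ht] at hwT
      linear_combination hwT - (l*t + 2*(l*t)^2 + 2*(l*t)^3+ (l*t)^4) * h5
    exact (mul_eq_zero.1 h6).resolve_left (pow_ne_zero _ hl0)
  have hintg : IsIntegral (𝓞 T) t := by
    refine ⟨X^5 + (C (l^3 * A c) * X^4 + C (2 * l^2 * A c) * X^3 + C (2 * l * A c) * X^2 + C (A c) * X - C (A f)), ?_, ?_⟩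
    · apply monic_X_pow_add
      compute_degree!
    · simp only [eval₂_add, eval₂_sub, eval₂_mul, eval₂_pow, eval₂_X, eval₂_C]
      linear_combination hti
  obtain ⟨t', ht'⟩ := IsIntegrallyClosed.isIntegral_iff.1 hintg
  have hxt : x = 1 + l * t' := by
    apply RingOfIntegers.ext; simp only [map_add, map_mul, map_one]; rw [ht, ← ht']
  have hs : oi σ.toRingEquiv x = A z * x := by
    apply RingOfIntegers.ext
    rw [oi_coe, hxy]
    simp only [map_mul, hxy]
    exact h.hy
  have h1 := h.ram_sub hP t'
  have ha : ∀ k : 𝓞 K, oi σ.toRingEquiv (A k) = A k := fun k => RingOfIntegers.ext (σ.commutes _)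
  have e : oi σ.toRingEquiv t' - t' = - x := by
    apply mul_left_cancel₀ hl0'
    have h3 := congrArg (oi σ.toRingEquiv) hxt
    rw [hs, map_add, map_mul, map_one, hl, ha, ← hl] at h3
    have : l = 1 - A z := by rw [hl, map_sub, map_one]
    rw [mul_sub]
    linear_combination (-1:𝓞 T) * h3 + hxt + x * this
  rw [e] at h1
  simpa using P.neg_mem h1
end KD
end
end St14

namespace St14
section
variable {K T : Type} [Field K] [NumberField K] [Field T] [NumberField T] [Algebra K T]

/-- units of K that are norms of elements of T -/
noncomputable def nT (K T : Type) [Field K] [NumberField K] [Field T] [NumberField T] [Algebra K T] : Subgroup (𝓞 K)ˣ where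
  carrier := {u | ∃ x : T, Algebra.norm K x = ((u : 𝓞 K) : K)}
  one_mem' := ⟨1, by simp⟩
  mul_mem' := by
    rintro a b ⟨x, hx⟩ ⟨y, hy⟩
    exact ⟨x * y, by simp [hx, hy]⟩
  inv_mem' := by
    rintro a ⟨x, hx⟩
    have hx0 : x ≠ 0 := by
      rintro rfl
      rw [Algebra.norm_zero] at hx
      exact a.ne_zero (RingOfIntegers.ext hx.symm)
    refine ⟨1 / x, ?_⟩
    rw [KD.norm_div _ _ hx0, hx, map_one, one_div]
    have : (((a⁻¹ : (𝓞 K)ˣ) : 𝓞 K) : K) * ((a : 𝓞 K) : K) = 1 := by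
      rw [← map_mul, Units.inv_mul, map_one]
    exact (eq_inv_of_mul_eq_one_left this).symm

lemma mem_nT {u : (𝓞 K)ˣ} : u ∈ nT K T ↔ ∃ x : T, Algebra.norm K x = ((u : 𝓞 K) : K) := Iff.rfl

lemma nU_le_nT : (nU K T).range ≤ nT K T := by
  rintro _ ⟨e, rfl⟩
  exact ⟨_, (nU_coe e).symm⟩

lemma KD.P5_le {ζ : K} {σ : T ≃ₐ[K] T} {y : T} (h : KD ζ σ y) : P5 (𝓞 K)ˣ ≤ (nU K T).range := by
  rintro _ ⟨e, rfl⟩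
  refine ⟨jU K T e, ?_⟩
  apply uext
  rw [nU_coe, jU_coe, Algebra.norm_algebraMap, h.h5]
  simp

lemma KD.rel_nT {σ : T ≃ₐ[K] T} {I : Ideal (𝓞 T)} (hI : I ≠ ⊥) {a b : 𝓞 T} (ha : a ≠ 0)
    (hab : Ideal.span {a} * iS σ.toRingEquiv I = Ideal.span {b} * I) :
    ∃ u ∈ nT K T, RingOfIntegers.norm K b = u * RingOfIntegers.norm K a := by
  obtain ⟨u, hu⟩ := KD.rel_unit (K := K) hI hab
  refine ⟨u, ⟨(b : T) / a, ?_⟩, hu⟩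
  have ha' : (a : T) ≠ 0 := by simpa using ha
  rw [norm_div _ _ ha', div_eq_iff (by rwa [Ne, Algebra.norm_eq_zero_iff])]
  have := congrArg (fun k : 𝓞 K => (k : K)) hu
  simpa using this

variable {z : 𝓞 K} {d : 𝓞 K ≃+* 𝓞 K} {σ : T ≃ₐ[K] T} {y : T}

theorem not_five_dvd_class (h : CK z d) (hT : KD (z : K) σ y) (𝔓 : Fin 2 → Ideal (𝓞 T))
    (hall : ∀ P, Ram K P → ∃ i, P = 𝔓 i) (hram : ∀ i, Ram K (𝔓 i)) (hz : h.zU ∉ nT K T) :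
    ¬ 5 ∣ Nat.card (ClassGroup (𝓞 T)) := by
  have := h.pid
  obtain ⟨u1, u2⟩ := hT.index_upper 𝔓 hall hram
  have hb := hT.herbrand
  set r1 := (dU σ.toRingEquiv).range.relIndex (nU K T).ker
  change r1 * (P5 (𝓞 K)ˣ).relIndex (nU K T).range = 125 at hb
  have e1 := Subgroup.relIndex_mul_index hT.P5_le
  rw [h.unit_index] at e1
  set r2 := (P5 (𝓞 K)ˣ).relIndex (nU K T).range
  have e2 := Subgroup.relIndex_mul_index (nU_le_nT (K := K) (T := T))
  have e3 : (nT K T).index ≠ 1 := by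
    rw [Ne, Subgroup.index_eq_one]
    intro hc; apply hz; rw [hc]; trivial
  norm_num at u1 u2
  have hd1 : (nU K T).range.index ∣ 5^2 := ⟨r2, by rw [mul_comm]; exact e1.symm⟩
  obtain ⟨i, hi, hi2⟩ := (Nat.dvd_prime_pow (by norm_num)).1 hd1
  have hd2 : (nT K T).index ∣ 5^2 := (Dvd.intro_left _ e2).trans hd1
  obtain ⟨j, hj, hj2⟩ := (Nat.dvd_prime_pow (by norm_num)).1 hd2
  have hj0 : j ≠ 0 := by rintro rfl; exact e3 (by simpa using hj2)
  have hcase : (nU K T).range.index = 5 ∧ r1 = 25 := by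
    interval_cases i
    · exfalso; rw [pow_zero] at hi2; rw [hi2, mul_eq_one] at e2; exact e3 e2.2
    · norm_num at hi2; rw [hi2] at e1
      have : r2 = 5 := by omega
      rw [this] at hb; exact ⟨hi2, by omega⟩
    · norm_num at hi2; rw [hi2] at e1
      have : r2 = 1 := by omega
      rw [this] at hb; omega
  have hpr := u2 hcase.2
  have hle : nT K T ≤ (nU K T).range := by
    rw [← Subgroup.relIndex_eq_one]
    rw [hcase.1] at e2
    interval_cases j
    · exact absurd rfl hj0
    · rw [hj2] at e2; omega
    · rw [hj2] at e2; omega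
  have hfix : ∀ c : ClassGroup (𝓞 T), cS σ.toRingEquiv c = c → c = 1 := by
    intro c hc
    obtain ⟨I, hI, rfl⟩ := cl_surj c
    rw [cS_cl _ hI, cl_eq (iS_ne _ hI) hI] at hc
    obtain ⟨a, b, ha, hb, hab⟩ := hc
    obtain ⟨u, hu, hun⟩ := KD.rel_nT (K := K) hI ha hab
    obtain ⟨w, rfl⟩ := hle hu
    obtain ⟨t, ht, ht2⟩ := hT.rel_amb hI ha hb hab w hun
    obtain ⟨k, hk, f, hf⟩ := hT.ambig_fin 𝔓 hall hram (mul_ne_zero (span_ne ht) hI) ht2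
    have : cl (Ideal.span {t} * I) = 1 := by
      rw [cl_eq_one (mul_ne_zero (span_ne ht) hI)]
      obtain ⟨x0, hx0⟩ := hpr.1
      obtain ⟨x1, hx1⟩ := hpr.2
      have e : Ideal.span {t} * I = Ideal.span {algebraMap (𝓞 K) (𝓞 T) k * (x0^(f 0).val * x1^(f 1).val)} := by
        rw [hf, Fin.prod_univ_two, hx0, hx1, Ideal.span_singleton_pow, Ideal.span_singleton_pow, Ideal.span_singleton_mul_span_singleton, Ideal.span_singleton_mul_span_singleton]
      refine ⟨_, ?_, e⟩
      intro h0
      rw [h0] at e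
      exact mul_ne_zero (span_ne ht) hI (e.trans (by simp))
    rwa [cl_mul (span_ne ht) hI, cl_span ht, one_mul] at this
  intro hdvd
  haveI : Fact (Nat.Prime 5) := ⟨by norm_num⟩
  obtain ⟨c, hc⟩ := exists_prime_orderOf_dvd_card' 5 hdvd
  have : c = 1 := nilp (cS σ.toRingEquiv) hT.cS_norm (fun c _ => hfix c) c (by rw [← hc, pow_orderOf_eq_one])
  rw [this, orderOf_one] at hc
  norm_num at hc

/-- subgroup of units that are fifth powers mod g -/
def HF {g : 𝓞 K} (hg : Prime g) : Subgroup (𝓞 K)ˣ where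
  carrier := {u | F5 g (u : 𝓞 K)}
  one_mem' := by simpa using F5.one g
  mul_mem' := by
    intro a b ha hb
    have := F5.mul ha hb
    simpa using this
  inv_mem' := by
    intro a ha
    refine F5.cancel hg (y := (a : 𝓞 K)) (by simpa using F5.one g) ha ?_
    intro hc; exact hg.not_unit (isUnit_of_dvd_unit hc a.isUnit)

lemma mem_HF {g : 𝓞 K} {hg : Prime g} {u : (𝓞 K)ˣ} : u ∈ HF hg ↔ F5 g (u : 𝓞 K) := Iff.rfl

namespace CK
variable {p : ℕ} {g : 𝓞 K}

lemma frob_sq (h : CK z d) (hp : p.Prime) (hp4 : p % 5 = 4) (hgp : g ∣ (p : 𝓞 K)) (k : 𝓞 K) : g ∣ k^(p^2) - k := by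
  have h1 := h.frob_four hp hp4 k
  have h2 := h.frob_four hp hp4 (d (d k))
  rw [h.d4] at h2
  have h3 := h1.trans (sub_dvd_pow_sub_pow (k^p) (d (d k)) p)
  rw [← pow_mul, ← pow_two] at h3
  have := dvd_add h3 h2
  rw [sub_add_sub_cancel] at this
  exact hgp.trans this

lemma zeta_HF (h : CK z d) (hp : p.Prime) (hp4 : p % 5 = 4) (hp25 : p % 25 ≠ 24) (hg : Prime g) (hgp : g ∣ (p : 𝓞 K)) {a : ℤ}
    (ha : h.zU^a ∈ HF hg) : 5 ∣ a := by
  by_contra hc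
  obtain ⟨k, hk⟩ := ha
  refine h.zeta_not_fifth hp (by rintro rfl; simp at hp4) hg hgp (m := p^2) (Nat.one_le_pow _ _ hp.pos) ?_ (h.frob_sq hp hp4 hgp) k hc rfl hk
  intro h25
  have h1 : 1 ≤ p^2 := Nat.one_le_pow _ _ hp.pos
  have h2 : p^2 % 25 = 1 := by omega
  rw [Nat.pow_mod] at h2
  have h3 : p % 25 < 25 := Nat.mod_lt _ (by norm_num)
  have h4 : p % 25 % 5 = 4 := by omega
  interval_cases (p % 25) <;> omega

lemma eps_HF (h : CK z d) (hp : p.Prime) (hp4 : p % 5 = 4) (hg : Prime g) (hgp : g ∣ (p : 𝓞 K)) : h.eU ∈ HF hg := by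
  have h1 := hgp.trans (h.frob_four hp hp4 (eps z))
  rw [h.eps_d2] at h1
  rw [mem_HF, h.eU_coe]
  exact h.fifth_of_pow hp hp4 h1
end CK

lemma KD.local_F5 (h : CK z d) (hT : KD (z : K) σ y) {P : Ideal (𝓞 T)} (hP : Ram K P) {g : 𝓞 K}
    (hPg : P.comap (algebraMap (𝓞 K) (𝓞 T)) = Ideal.span {g}) {u : 𝓞 K} (hu : ¬ g ∣ u)
    {x : T} (hx : Algebra.norm K x = u) : F5 g u := by
  have := h.pid
  obtain ⟨k, hk⟩ := hT.local_norm hP (u := u) (by rwa [hPg, Ideal.mem_span_singleton]) hx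
  rw [hPg, Ideal.mem_span_singleton] at hk
  exact ⟨k, hk⟩

end
end St14

namespace St14
section
variable {K : Type} [Field K] [NumberField K]

def zz (d : 𝓞 K ≃+* 𝓞 K) (g : 𝓞 K) : 𝓞 K := g * (d g)^4 * d (d g) * (d (d (d g)))^4
def vp (d : 𝓞 K ≃+* 𝓞 K) (π : 𝓞 K) : 𝓞 K := π * (d π)^2 * (d (d π))^4 * (d (d (d π)))^3

lemma span_dvd {a b : 𝓞 K} (h1 : a ∣ b) (h2 : b ∣ a) : Ideal.span {a} = Ideal.span {b} :=
  le_antisymm (Ideal.span_singleton_le_span_singleton.2 h2) (Ideal.span_singleton_le_span_singleton.2 h1)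

section
variable {T : Type} [Field T] [NumberField T] [Algebra K T]
variable {z : 𝓞 K} {d : 𝓞 K ≃+* 𝓞 K} {σ : T ≃ₐ[K] T} {y : T}

/-- a prime q at which w is a fifth power: q is a norm of an ideal -/
lemma KD.exists_norm_prime (hT : KD (z : K) σ y) {x : 𝓞 T} (hxy : (x : T) = y) {w : 𝓞 K}
    (hx : x^5 = algebraMap (𝓞 K) (𝓞 T) w) {q : 𝓞 K} (hq : Prime q) (hqw : ¬ q ∣ w) (hql : ¬ q ∣ 1 - z) (hf : F5 q w) :
    ∃ P : Ideal (𝓞 T), P.IsPrime ∧ P ≠ ⊥ ∧ P.comap (algebraMap (𝓞 K) (𝓞 T)) = Ideal.span {q} ∧ Ideal.relNorm (𝓞 K) P = Ideal.span {q} := by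
  obtain ⟨P, hP, hP0, hPq⟩ := exists_over (T := T) (Ideal.span {q}) (primeK_span hq)
  obtain ⟨k, hk⟩ := hf
  refine ⟨P, hP, hP0, hPq, ?_⟩
  rw [← hPq]
  apply hT.not_inert hxy hx hP hP0 (k := k)
  all_goals rwa [hPq, Ideal.mem_span_singleton]

lemma norm_of_span {I : Ideal (𝓞 T)} {x : 𝓞 T} (hI : I = Ideal.span {x}) {q : 𝓞 K} (hn : Ideal.relNorm (𝓞 K) I = Ideal.span {q}) :
    ∃ u : (𝓞 K)ˣ, Algebra.norm K (x : T) = ((q * u : 𝓞 K) : K) := by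
  rw [hI, nI_span, Ideal.span_singleton_eq_span_singleton] at hn
  obtain ⟨u, hu⟩ := hn.symm
  exact ⟨u, by rw [hu]; rfl⟩

lemma KD.exists_norm_elt (hT : KD (z : K) σ y) {x : 𝓞 T} (hxy : (x : T) = y) {w : 𝓞 K}
    (hx : x^5 = algebraMap (𝓞 K) (𝓞 T) w) {q : 𝓞 K} (hq : Prime q) (hqw : ¬ q ∣ w) (hql : ¬ q ∣ 1 - z) (hf : F5 q w) :
    ∃ X : T, ∃ u : (𝓞 K)ˣ, Algebra.norm K X = ((q^(Nat.card (ClassGroup (𝓞 T))) * u : 𝓞 K) : K) := by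
  obtain ⟨P, hP, hP0, hPq, hn⟩ := hT.exists_norm_prime hxy hx hq hqw hql hf
  have h1 : cl (P^(Nat.card (ClassGroup (𝓞 T)))) = 1 := by
    rw [cl_pow hP0, pow_card_eq_one']
  obtain ⟨X, hX, hX2⟩ := (cl_eq_one (pow_ne_zero _ hP0)).1 h1
  obtain ⟨u, hu⟩ := norm_of_span (K := K) hX2 (q := q^(Nat.card (ClassGroup (𝓞 T)))) (by rw [map_pow, hn, Ideal.span_singleton_pow])
  exact ⟨X, u, hu⟩
end

variable {z : 𝓞 K} {d : 𝓞 K ≃+* 𝓞 K}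

lemma nth_root_int {w : 𝓞 K} {b : K} (hb : b^5 = w) : ∃ b' : 𝓞 K, b'^5 = w := by
  have : IsIntegral (𝓞 K) b := by
    apply IsIntegral.of_pow (n := 5) (by norm_num)
    rw [hb]; exact isIntegral_algebraMap
  obtain ⟨b', hb'⟩ := IsIntegrallyClosed.isIntegral_iff.1 this
  refine ⟨b', RingOfIntegers.ext ?_⟩
  change algebraMap (𝓞 K) K (b'^5) = _
  rw [map_pow, hb', hb]

/-- final combination step -/
lemma combine (h : CK z d) {p : ℕ} (hp : p.Prime) (hp4 : p % 5 = 4) (hp25 : p % 25 ≠ 24) {g : 𝓞 K} (hg : Prime g) (hgp : g ∣ (p : 𝓞 K))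
    {π : 𝓞 K} (hπg : ∀ q, (q = π ∨ q = d π ∨ q = d (d π) ∨ q = d (d (d π))) → ¬ g ∣ q ∧ ¬ d g ∣ q) {H : ℕ} (hH : ¬ 5 ∣ H)
    (u : (𝓞 K)ˣ) (h1 : F5 g ((vp d π)^H * u)) (h2 : F5 (d g) ((vp d π)^H * u)) : F5 g (vp d π) := by
  obtain ⟨a, b, e, rfl⟩ := h.unit_form u
  have hdg : Prime (d g) := CK.d_prime hg
  have key : ∀ (g' : 𝓞 K) (hg' : Prime g'), g' ∣ (p : 𝓞 K) → F5 g' ((vp d π)^H * ((h.zU^a * h.eU^b * e^5 : (𝓞 K)ˣ) : 𝓞 K)) →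
      F5 g' ((vp d π)^H * ((h.zU^a : (𝓞 K)ˣ) : 𝓞 K)) := by
    intro g' hg' hgp' hf
    have hm : h.eU^b * e^5 ∈ HF hg' := by
      refine mul_mem (zpow_mem (h.eps_HF hp hp4 hg' hgp') b) ?_
      rw [mem_HF]; push_cast; exact F5.p5 _ _
    refine F5.cancel hg' ?_ (mem_HF.1 hm) ?_
    · convert hf using 1; push_cast; ring
    · intro hc; exact hg'.not_unit (isUnit_of_dvd_unit hc (Units.isUnit _))
  have k1 := key g hg hgp h1
  have k2 := key (d g) hdg (CK.d_dvd_nat hgp) h2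
  have k3 := ((k2.map d).map d).map d
  rw [h.d4] at k3
  have hv : d (d (d (vp d π))) * (d (d π) * d (d (d π)))^5 = (vp d π)^2 := by
    unfold vp; simp only [map_mul, map_pow, h.d4]; ring
  have hzd : ∀ a : ℤ, d ((h.zU^a : (𝓞 K)ˣ) : 𝓞 K) = ((h.zU^(2*a) : (𝓞 K)ˣ) : 𝓞 K) := by
    intro a
    have : Units.map (d : 𝓞 K →* 𝓞 K) (h.zU^a) = h.zU^(2*a) := by
      rw [map_zpow, h.d_zU, zpow_mul]; rfl
    rw [← this]; rfl
  simp only [map_mul, map_pow, hzd] at k3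
  have k4 := (k3.mul (F5.p5 g ((d (d π) * d (d (d π)))^H)))
  have k5 := k1.pow 2
  have hgv : ¬ g ∣ vp d π := by
    unfold vp
    intro hc
    rcases hg.dvd_or_dvd hc with hc | hc
    · rcases hg.dvd_or_dvd hc with hc | hc
      · rcases hg.dvd_or_dvd hc with hc | hc
        · exact (hπg _ (by tauto)).1 hc
        · exact (hπg (d π) (by tauto)).1 (hg.dvd_of_dvd_pow hc)
      · exact (hπg (d (d π)) (by tauto)).1 (hg.dvd_of_dvd_pow hc)
    · exact (hπg (d (d (d π))) (by tauto)).1 (hg.dvd_of_dvd_pow hc)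
  have hnu : ∀ v : (𝓞 K)ˣ, ¬ g ∣ (v : 𝓞 K) := fun v hc => hg.not_unit (isUnit_of_dvd_unit hc v.isUnit)
  have k6 : h.zU^(6*a) ∈ HF hg := by
    rw [mem_HF]
    refine F5.cancel hg ?_ k5 ?_
    · convert k4 using 1
      have e6 : h.zU^(2*(2*(2*a))) = h.zU^(6*a) * (h.zU^a)^2 := by
        rw [← zpow_natCast, ← zpow_mul, ← zpow_add]; congr 1; push_cast; ring
      rw [e6]
      have : (d (d (d (vp d π))))^H * ((d (d π) * d (d (d π)))^H)^5 = ((vp d π)^H)^2 := by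
        rw [← pow_mul, mul_comm H 5, pow_mul, ← mul_pow, hv, ← pow_mul, ← pow_mul, mul_comm]
      push_cast
      linear_combination (-((h.zU^(6*a) : (𝓞 K)ˣ) : 𝓞 K) * ((h.zU^a : (𝓞 K)ˣ) : 𝓞 K)^2) * this
    · intro hc
      rcases hg.dvd_or_dvd (hg.dvd_of_dvd_pow hc) with hc | hc
      · exact hgv (hg.dvd_of_dvd_pow hc)
      · exact hnu _ hc
  have k7 := h.zeta_HF hp hp4 hp25 hg hgp k6
  have k8 : (5:ℤ) ∣ a := by omega
  obtain ⟨m, rfl⟩ := k8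
  have : h.zU^(5*m) = 1 := by rw [zpow_mul]; norm_cast; rw [h.zU5, one_zpow]
  rw [this, Units.val_one, mul_one] at k1
  exact F5.of_pow hg hH k1

theorem T_layer (h : CK z d) {p : ℕ} (hp : p.Prime) (hp4 : p % 5 = 4) (hp25 : p % 25 ≠ 24) {g : 𝓞 K} (hg : Prime g) (hgp : g ∣ (p : 𝓞 K))
    {N : ℕ} (hN : N.Prime) (hN1 : N % 5 = 1) {π : 𝓞 K} (hπ : Prime π) (hπN : π ∣ (N : 𝓞 K))
    (hz0 : ∀ q, (q = π ∨ q = d π ∨ q = d (d π) ∨ q = d (d (d π))) → F5 q (zz d g) ∧ F5 q (eps z)) : F5 g (vp d π) := by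
  have hpid := h.pid
  have hp5 : p ≠ 5 := by rintro rfl; simp at hp4
  have hN5 : N ≠ 5 := by rintro rfl; simp at hN1
  have hdg : Prime (d g) := CK.d_prime hg
  have hddg : Prime (d (d g)) := CK.d_prime hdg
  have hdddg : Prime (d (d (d g))) := CK.d_prime hddg
  have hdgp := CK.d_dvd_nat (d := d) hgp
  have hddgp := CK.d_dvd_nat (d := d) hdgp
  have hdddgp := CK.d_dvd_nat (d := d) hddgp
  -- the primes over N
  have hqq : ∀ q, (q = π ∨ q = d π ∨ q = d (d π) ∨ q = d (d (d π))) → Prime q ∧ q ∣ (N : 𝓞 K) := by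
    have a1 := CK.d_prime (d := d) hπ
    have a2 := CK.d_prime (d := d) a1
    have a3 := CK.d_prime (d := d) a2
    have b1 := CK.d_dvd_nat (d := d) hπN
    have b2 := CK.d_dvd_nat (d := d) b1
    have b3 := CK.d_dvd_nat (d := d) b2
    rintro q (rfl | rfl | rfl | rfl)
    exacts [⟨hπ, hπN⟩, ⟨a1, b1⟩, ⟨a2, b2⟩, ⟨a3, b3⟩]
  have hpN : ∀ g' q, Prime g' → g' ∣ (p : 𝓞 K) → Prime q → q ∣ (N : 𝓞 K) → ¬ g' ∣ q := by
    intro g' q hg' hgp' hq hqN hc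
    have := h.prime_int hp hg' hgp' (n := N) (by exact_mod_cast hc.trans hqN)
    have h2 : p ∣ N := by exact_mod_cast this
    have := (Nat.prime_dvd_prime_iff_eq hp hN).1 h2
    omega
  -- w
  obtain ⟨n, hn⟩ := h.norm_int g
  have hn5 : ¬ 5 ∣ n := by
    intro hc
    have h1 := (dvd_pow_self (1 - z) (by norm_num : 4 ≠ 0)).trans (h.int_lam hc)
    rw [← hn] at h1
    have hno : ∀ g' : 𝓞 K, Prime g' → g' ∣ (p : 𝓞 K) → ¬ (1 - z) ∣ g' := fun g' hg' hgp' hc =>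
      h.not_dvd_lam hp hp5 hg' hgp' (CK.assoc_of_dvd h.lam_prime hg' hc)
    rcases h.lam_prime.dvd_or_dvd h1 with h1 | h1
    · rcases h.lam_prime.dvd_or_dvd h1 with h1 | h1
      · rcases h.lam_prime.dvd_or_dvd h1 with h1 | h1
        · exact hno _ hg hgp h1
        · exact hno _ hdg hdgp h1
      · exact hno _ hddg hddgp h1
    · exact hno _ hdddg hdddgp h1
  obtain ⟨j, hj⟩ := h.one_mod (z0 := zz d g) (n := n) hn5 (by
    rw [← hn]; unfold zz; simp only [map_mul, map_pow, h.d4]; ring)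
  set w := (zz d g)^4 * (eps z)^(4*j) with hw
  have hep : IsUnit ((eps z)^(4*j)) := h.eps_unit.pow _
  have hw0 : w ≠ 0 := by
    refine mul_ne_zero (pow_ne_zero _ ?_) hep.ne_zero
    unfold zz
    exact mul_ne_zero (mul_ne_zero (mul_ne_zero hg.ne_zero (pow_ne_zero _ hdg.ne_zero)) hddg.ne_zero) (pow_ne_zero _ hdddg.ne_zero)
  have hspw : Ideal.span {w} = (Ideal.span {g})^8 * (Ideal.span {d g})^32 := by
    have e1 : Ideal.span {d (d g)} = Ideal.span {g} := by
      have := h.dvd_four hp hp4 hg hgp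
      exact span_dvd (CK.assoc_of_dvd hg hddg this) this
    have e2 : Ideal.span {d (d (d g))} = Ideal.span {d g} := by
      have := h.dvd_four hp hp4 hdg hdgp
      exact span_dvd (CK.assoc_of_dvd hdg hdddg this) this
    have e3 : Ideal.span {(eps z)^(4*j)} = 1 := by
      rw [Ideal.one_eq_top, Ideal.span_singleton_eq_top]; exact hep
    rw [hw]; unfold zz
    simp only [← Ideal.span_singleton_mul_span_singleton, ← Ideal.span_singleton_pow]
    rw [e1, e2]
    simp only [Ideal.span_singleton_pow] at *
    rw [e3]
    simp only [← Ideal.span_singleton_pow]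
    ring
  have hG := primeK_span hg
  have hDG := primeK_span hdg
  have hGD : Ideal.span {g} ≠ Ideal.span {d g} := by
    intro hc
    rw [Ideal.span_singleton_eq_span_singleton] at hc
    exact h.ndvd_four hp hp4 hg hgp hc.dvd
  have hv1 : vv (Ideal.span {g}) (Ideal.span {w}) = 8 := by
    rw [hspw, vv_mul hG (pow_ne_zero _ hG.ne_zero) (pow_ne_zero _ hDG.ne_zero), vv_pow hG hG.ne_zero, vv_pow hG hDG.ne_zero,
      vv_self hG, vv_ne hG hDG hGD]
  have hv2 : vv (Ideal.span {d g}) (Ideal.span {w}) = 32 := by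
    rw [hspw, vv_mul hDG (pow_ne_zero _ hG.ne_zero) (pow_ne_zero _ hDG.ne_zero), vv_pow hDG hG.ne_zero, vv_pow hDG hDG.ne_zero,
      vv_self hDG, vv_ne hDG hG hGD.symm]
  have hw5 : ∀ b : K, b^5 ≠ w := by
    intro b hb
    obtain ⟨b', hb'⟩ := nth_root_int hb
    have hb0 : b' ≠ 0 := by rintro rfl; exact hw0 (by rw [← hb']; simp)
    rw [← hb', ← Ideal.span_singleton_pow, vv_pow hG (span_ne hb0)] at hv1
    omega
  obtain ⟨T, _, _, _, σ, y, hT, hy⟩ := exists_kummer h.hz h.hK hw5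
  have hyi : IsIntegral (𝓞 T) y := by
    apply IsIntegral.of_pow (n := 5) (by norm_num)
    rw [hy]
    exact isIntegral_algebraMap (R := 𝓞 T) (A := T) (x := algebraMap (𝓞 K) (𝓞 T) w)
  obtain ⟨x, hxy⟩ := IsIntegrallyClosed.isIntegral_iff.1 hyi
  have hx : x^5 = algebraMap (𝓞 K) (𝓞 T) w := by
    apply RingOfIntegers.ext
    change algebraMap (𝓞 T) T (x^5) = _
    rw [map_pow, hxy, hy]; rfl
  obtain ⟨P0, hP0, hP00, hP0g⟩ := exists_over (T := T) (Ideal.span {g}) hG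
  obtain ⟨P1, hP1, hP10, hP1g⟩ := exists_over (T := T) (Ideal.span {d g}) hDG
  have hR0 : Ram K P0 := hT.ram_of_val hx hw0 hP0 hP00 (by rw [hP0g, hv1]; norm_num)
  have hR1 : Ram K P1 := hT.ram_of_val hx hw0 hP1 hP10 (by rw [hP1g, hv2]; norm_num)
  have hall : ∀ P : Ideal (𝓞 T), Ram K P → ∃ i, P = ![P0, P1] i := by
    intro P hP
    have h1 := hT.ram_mem hxy hx h.lam4_dvd hj hP
    have h2 : P ∣ iJ K T (Ideal.span {w}) := by
      rw [iJ_span, ← hx, Ideal.dvd_span_singleton]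
      exact Ideal.pow_mem_of_mem _ h1 _ (by norm_num)
    rw [dvd_iJ, hspw] at h2
    rcases hP.primeK.dvd_or_dvd h2 with h2 | h2
    · refine ⟨0, ram_unique hP hR0 ?_⟩
      change _ = P0.comap _
      rw [hP0g]; exact prime_dvd_prime_eq hP.primeK hG (hP.primeK.dvd_of_dvd_pow h2)
    · refine ⟨1, ram_unique hP hR1 ?_⟩
      change _ = P1.comap _
      rw [hP1g]; exact prime_dvd_prime_eq hP.primeK hDG (hP.primeK.dvd_of_dvd_pow h2)
  have hznT : h.zU ∉ nT K T := by
    rintro ⟨X, hX⟩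
    have hf := hT.local_F5 h hR0 hP0g (u := (h.zU : 𝓞 K)) (fun hc => hg.not_unit (isUnit_of_dvd_unit hc (Units.isUnit _))) hX
    have : (5 : ℤ) ∣ 1 := h.zeta_HF hp hp4 hp25 hg hgp (a := 1) (by rw [mem_HF, zpow_one]; exact hf)
    norm_num at this
  have hcard := not_five_dvd_class h hT ![P0, P1] hall (by intro i; fin_cases i; exacts [hR0, hR1]) hznT
  set H := Nat.card (ClassGroup (𝓞 T)) with hH
  have hnorm : ∀ q, (q = π ∨ q = d π ∨ q = d (d π) ∨ q = d (d (d π))) → ∃ X : T, ∃ u : (𝓞 K)ˣ, Algebra.norm K X = ((q^H * u : 𝓞 K) : K) := by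
    intro q hq
    obtain ⟨hqp, hqN⟩ := hqq q hq
    have hqw : ¬ q ∣ w := by
      intro hc
      have h1 : Ideal.span {q} ∣ Ideal.span {w} := by
        rw [Ideal.dvd_span_singleton, Ideal.mem_span_singleton]; exact hc
      have hQ := primeK_span hqp
      rw [hspw] at h1
      rcases hQ.dvd_or_dvd h1 with h1 | h1
      · have := prime_dvd_prime_eq hQ hG (hQ.dvd_of_dvd_pow h1)
        rw [Ideal.span_singleton_eq_span_singleton] at this
        exact hpN g q hg hgp hqp hqN this.symm.dvd
      · have := prime_dvd_prime_eq hQ hDG (hQ.dvd_of_dvd_pow h1)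
        rw [Ideal.span_singleton_eq_span_singleton] at this
        exact hpN (d g) q hdg hdgp hqp hqN this.symm.dvd
    have hwF : F5 q w := ((hz0 q hq).1.pow 4).mul ((hz0 q hq).2.pow _)
    exact hT.exists_norm_elt hxy hx hqp hqw (h.not_dvd_lam hN hN5 hqp hqN) hwF
  obtain ⟨X0, u0, h0⟩ := hnorm π (by tauto)
  obtain ⟨X1, u1, h1⟩ := hnorm (d π) (by tauto)
  obtain ⟨X2, u2, h2⟩ := hnorm (d (d π)) (by tauto)
  obtain ⟨X3, u3, h3⟩ := hnorm (d (d (d π))) (by tauto)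
  have hX : Algebra.norm K (X0 * X1^2 * X2^4 * X3^3) = (((vp d π)^H * ((u0 * u1^2 * u2^4 * u3^3 : (𝓞 K)ˣ) : 𝓞 K) : 𝓞 K) : K) := by
    simp only [map_mul, map_pow, h0, h1, h2, h3]
    unfold vp
    push_cast
    ring
  have hgq : ∀ q, (q = π ∨ q = d π ∨ q = d (d π) ∨ q = d (d (d π))) → ¬ g ∣ q ∧ ¬ d g ∣ q := fun q hq =>
    ⟨hpN g q hg hgp (hqq q hq).1 (hqq q hq).2, hpN (d g) q hdg hdgp (hqq q hq).1 (hqq q hq).2⟩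
  have hgv : ∀ g' : 𝓞 K, Prime g' → g' ∣ (p : 𝓞 K) → ∀ u : (𝓞 K)ˣ, ¬ g' ∣ (vp d π)^H * u := by
    intro g' hg' hgp' u hc
    rcases hg'.dvd_or_dvd hc with hc | hc
    · have hc := hg'.dvd_of_dvd_pow hc
      have hno : ∀ q, (q = π ∨ q = d π ∨ q = d (d π) ∨ q = d (d (d π))) → ¬ g' ∣ q := fun q hq => hpN g' q hg' hgp' (hqq q hq).1 (hqq q hq).2
      unfold vp at hc
      rcases hg'.dvd_or_dvd hc with hc | hc
      · rcases hg'.dvd_or_dvd hc with hc | hc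
        · rcases hg'.dvd_or_dvd hc with hc | hc
          · exact hno _ (by tauto) hc
          · exact hno (d π) (by tauto) (hg'.dvd_of_dvd_pow hc)
        · exact hno (d (d π)) (by tauto) (hg'.dvd_of_dvd_pow hc)
      · exact hno (d (d (d π))) (by tauto) (hg'.dvd_of_dvd_pow hc)
    · exact hg'.not_unit (isUnit_of_dvd_unit hc (Units.isUnit _))
  exact combine h hp hp4 hp25 hg hgp hgq hcard _
    (hT.local_F5 h hR0 hP0g (hgv g hg hgp _) hX) (hT.local_F5 h hR1 hP1g (hgv (d g) hdg hdgp _) hX)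

end
end St14

namespace St14

section LA
instance fact5 : Fact (Nat.Prime 5) := ⟨Nat.prime_five⟩
variable {V : Type} [AddCommGroup V] [Module (ZMod 5) V]
open Module

/-- truncated logarithm of `1 + n` -/
def lg (n : End (ZMod 5) V) : End (ZMod 5) V := n + 2 * n^2 + 2 * n^3

lemma five_end (x : End (ZMod 5) V) : (5 : End (ZMod 5) V) * x = 0 := by
  ext v
  have h : (5 : End (ZMod 5) V) = algebraMap (ZMod 5) _ 5 := by rw [map_ofNat]
  have h5 : (5 : ZMod 5) = 0 := by decide
  rw [h, h5]; simp

lemma lg_comm {n δ : End (ZMod 5) V} (hn : n^4 = 0) (hd : δ * n = (2 * n + n^2) * δ) :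
    δ * lg n = 2 * (lg n * δ) := by
  have h2 : δ * n^2 = (2 * n + n^2)^2 * δ := by
    calc δ * n^2 = (δ * n) * n := by rw [pow_two, mul_assoc]
      _ = _ := by rw [hd, mul_assoc, hd, ← mul_assoc, pow_two (2 * n + n^2)]
  have h3 : δ * n^3 = (2 * n + n^2)^3 * δ := by
    rw [pow_succ, ← mul_assoc, h2, mul_assoc, hd, ← mul_assoc, ← pow_succ]
  have hc2 : ∀ x : End (ZMod 5) V, x * 2 = 2 * x := fun x => by rw [mul_two, two_mul]
  have e1 : δ * lg n = ((2 * n + n^2) + 2 * (2 * n + n^2)^2 + 2 * (2 * n + n^2)^3) * δ := by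
    unfold lg
    have e : ∀ x, δ * (2 * x) = 2 * (δ * x) := fun x => by rw [← mul_assoc, hc2, mul_assoc]
    rw [mul_add, mul_add, e, e, h2, h3, hd]
    simp only [add_mul, mul_assoc]
  rw [e1, ← mul_assoc]
  congr 1
  have hP : (2 * n + n^2) + 2 * (2 * n + n^2)^2 + 2 * (2 * n + n^2)^3 = 2 * lg n + 5 * (n^2 + 4 * n^3) + n^4 * (26 + 12 * n + 2 * n^2) := by
    have : ((2 * X + X^2) + 2 * (2 * X + X^2)^2 + 2 * (2 * X + X^2)^3 : (ZMod 5)[X]) = 2 * (X + 2 * X^2 + 2 * X^3) + 5 * (X^2 + 4 * X^3) + X^4 * (26 + 12 * X + 2 * X^2) := by ring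
    have := congrArg (aeval n) this
    simp only [map_add, map_mul, map_pow, map_ofNat, aeval_X] at this
    exact this
  rw [hP, hn, five_end]; simp

lemma lg_ker {n : End (ZMod 5) V} (hn : n^4 = 0) {v : V} (hv : lg n v = 0) : n v = 0 := by
  have h0 : ∀ x, n (n (n (n x))) = 0 := fun x => by
    have := congrArg (fun f => f x) hn
    simpa [pow_succ] using this
  have e : lg n v = n v + (2 : ZMod 5) • n (n v) + (2 : ZMod 5) • n (n (n v)) := by
    have : lg n = n + (2 : ZMod 5) • n^2 + (2 : ZMod 5) • n^3 := by
      unfold lg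
      rw [two_mul, two_mul, two_smul, two_smul]
    rw [this]
    simp [pow_succ]
  rw [e] at hv
  have h3 : n (n (n v)) = 0 := by
    have := congrArg (fun x => n (n x)) hv
    simpa [h0] using this
  have h2 : n (n v) = 0 := by
    have := congrArg n hv
    simpa [h3, h0] using this
  simpa [h3, h2] using hv

theorem la_main [FiniteDimensional (ZMod 5) V] {n δ : End (ZMod 5) V} (hn : n^4 = 0) (hd : δ * n = (2 * n + n^2) * δ)
    (h0 : 3 ≤ finrank (ZMod 5) (End.eigenspace δ 1)) (h5 : finrank (ZMod 5) V ≤ 5)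
    (hW : finrank (ZMod 5) ↥(End.eigenspace δ 1 ⊓ LinearMap.ker n) ≤ 1) :
    2 ≤ finrank (ZMod 5) ↥(End.eigenspace δ 2 ⊓ LinearMap.ker n) ∧ End.eigenspace δ 4 = ⊥ := by
  have hmap : ∀ (m : ZMod 5) (v : V), v ∈ End.eigenspace δ m → lg n v ∈ End.eigenspace δ (2 * m) := by
    intro m v hv
    rw [End.mem_eigenspace_iff] at hv ⊢
    have := congrArg (fun f => f v) (lg_comm hn hd)
    simp only [End.mul_apply, hv, map_smul] at this
    rw [this, show (2 : End (ZMod 5) V) = algebraMap (ZMod 5) _ 2 by rw [map_ofNat], Module.algebraMap_end_apply, smul_smul, mul_comm]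
  have hle : End.eigenspace δ 1 ⊓ LinearMap.ker (lg n) ≤ End.eigenspace δ 1 ⊓ LinearMap.ker n :=
    inf_le_inf_left _ (fun v hv => lg_ker hn hv)
  have hk : finrank (ZMod 5) ↥(LinearMap.ker ((lg n).domRestrict (End.eigenspace δ 1))) ≤ 1 := by
    refine le_trans (le_of_eq ?_) ((Submodule.finrank_mono hle).trans hW)
    rw [← Submodule.finrank_map_subtype_eq]
    have : Submodule.map (End.eigenspace δ 1).subtype (LinearMap.ker ((lg n).domRestrict (End.eigenspace δ 1))) = End.eigenspace δ 1 ⊓ LinearMap.ker (lg n) := by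
      ext v
      simp only [Submodule.mem_map, LinearMap.mem_ker, Submodule.mem_inf, LinearMap.domRestrict_apply]
      constructor
      · rintro ⟨w, hw, rfl⟩; exact ⟨w.2, hw⟩
      · rintro ⟨h1, h2⟩; exact ⟨⟨v, h1⟩, h2, rfl⟩
    rw [this]
  have hr := LinearMap.finrank_range_add_finrank_ker ((lg n).domRestrict (End.eigenspace δ 1))
  have hrl : finrank (ZMod 5) ↥(LinearMap.range ((lg n).domRestrict (End.eigenspace δ 1))) ≤ finrank (ZMod 5) (End.eigenspace δ 2) := by
    apply Submodule.finrank_mono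
    rintro _ ⟨v, rfl⟩
    have := hmap 1 v v.2
    simpa using this
  have hd12 : Disjoint (End.eigenspace δ 1) (End.eigenspace δ 2) :=
    End.disjoint_genEigenspace δ (by decide) 1 1
  have hd3 : Disjoint (End.eigenspace δ 1 ⊔ End.eigenspace δ 2) (End.eigenspace δ 4) := by
    have hi := End.eigenspaces_iSupIndep δ
    have := (hi 4).symm
    refine this.mono_left (sup_le ?_ ?_)
    · exact le_iSup₂_of_le 1 (by decide) le_rfl
    · exact le_iSup₂_of_le 2 (by decide) le_rfl
  have s1 := Submodule.finrank_sup_add_finrank_inf_eq (End.eigenspace δ 1) (End.eigenspace δ 2)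
  have s2 := Submodule.finrank_sup_add_finrank_inf_eq (End.eigenspace δ 1 ⊔ End.eigenspace δ 2) (End.eigenspace δ 4)
  rw [hd12.eq_bot, finrank_bot] at s1
  rw [hd3.eq_bot, finrank_bot] at s2
  have s3 := Submodule.finrank_le (End.eigenspace δ 1 ⊔ End.eigenspace δ 2 ⊔ End.eigenspace δ 4)
  have hb : End.eigenspace δ 4 = ⊥ := by
    rw [← Submodule.finrank_eq_zero (R := ZMod 5)]; omega
  refine ⟨?_, hb⟩
  have : End.eigenspace δ 2 ⊓ LinearMap.ker n = End.eigenspace δ 2 := by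
    rw [inf_eq_left]
    intro v hv
    have := hmap 2 v hv
    rw [show (2 * 2 : ZMod 5) = 4 by decide, hb, Submodule.mem_bot] at this
    exact lg_ker hn this
  rw [this]; omega
end LA

section tors
open Module
variable (G : Type) [CommGroup G]

abbrev V5 := Additive (powMonoidHom 5 : G →* G).ker

instance : Module (ZMod 5) (V5 G) := AddCommGroup.zmodModule (n := 5) (by
  intro x
  apply Additive.toMul.injective
  apply Subtype.ext
  exact x.toMul.2)

variable {G}
def mk5 (c : G) (hc : c^5 = 1) : V5 G := Additive.ofMul ⟨c, hc⟩
def g5 (v : V5 G) : G := (Additive.toMul v : (powMonoidHom 5 : G →* G).ker)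
@[simp] lemma g5_mk (c : G) (hc : c^5 = 1) : g5 (mk5 c hc) = c := rfl
lemma g5_inj {v w : V5 G} (h : g5 v = g5 w) : v = w := Additive.toMul.injective (Subtype.ext h)
lemma g5_pow (v : V5 G) : g5 v ^5 = 1 := (Additive.toMul v : (powMonoidHom 5 : G →* G).ker).2
@[simp] lemma g5_add (v w : V5 G) : g5 (v + w) = g5 v * g5 w := rfl
@[simp] lemma g5_zero : g5 (0 : V5 G) = 1 := rfl
@[simp] lemma g5_neg (v : V5 G) : g5 (-v) = (g5 v)⁻¹ := rfl
@[simp] lemma g5_sub (v w : V5 G) : g5 (v - w) = g5 v / g5 w := rfl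
lemma g5_nsmul (n : ℕ) (v : V5 G) : g5 ((n : ZMod 5) • v) = g5 v ^ n := by
  rw [Nat.cast_smul_eq_nsmul]; rfl

noncomputable def f5 (f : G →* G) : End (ZMod 5) (V5 G) :=
  AddMonoidHom.toZModLinearMap 5 (M := V5 G) (M₁ := V5 G)
    { toFun := fun v => mk5 (f (g5 v)) (by rw [← map_pow, g5_pow, map_one])
      map_zero' := g5_inj (by simp)
      map_add' := fun v w => g5_inj (by simp) }
@[simp] lemma g5_f5 (f : G →* G) (v : V5 G) : g5 (f5 f v) = f (g5 v) := rfl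

lemma pRank_eq [Finite G] : pRank 5 G = finrank (ZMod 5) (V5 G) := by
  have : Nat.card {g : G // g^5 = 1} = 5 ^ finrank (ZMod 5) (V5 G) := by
    have h1 : Nat.card (V5 G) = 5 ^ finrank (ZMod 5) (V5 G) := by
      rw [Module.natCard_eq_pow_finrank (K := ZMod 5)]; simp
    rw [← h1]
    rfl
  unfold pRank
  rw [this, Nat.factorization_pow]
  simp [Nat.Prime.factorization_self Nat.prime_five]

lemma finrank_le_one_of_zpowers [Finite G] (W : Submodule (ZMod 5) (V5 G)) (v : G) (h : ∀ w ∈ W, g5 w ∈ Subgroup.zpowers v) :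
    finrank (ZMod 5) W ≤ 1 := by
  let H : Subgroup G :=
    { carrier := {g | ∃ w ∈ W, g5 w = g}
      one_mem' := ⟨0, W.zero_mem, rfl⟩
      mul_mem' := by rintro _ _ ⟨a, ha, rfl⟩ ⟨b, hb, rfl⟩; exact ⟨a + b, W.add_mem ha hb, rfl⟩
      inv_mem' := by rintro _ ⟨a, ha, rfl⟩; exact ⟨-a, W.neg_mem ha, rfl⟩ }
  have hH : H ≤ Subgroup.zpowers v := by rintro _ ⟨w, hw, rfl⟩; exact h w hw
  haveI : IsCyclic H := by
    have : Function.Injective (Subgroup.inclusion hH) := Subgroup.inclusion_injective hH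
    exact isCyclic_of_injective _ this
  obtain ⟨⟨_, w0, hw0, rfl⟩, hg⟩ := IsCyclic.exists_generator (α := H)
  refine finrank_le_one (⟨w0, hw0⟩ : W) ?_
  rintro ⟨w, hw⟩
  obtain ⟨k, hk⟩ := hg ⟨g5 w, w, hw, rfl⟩
  refine ⟨(k : ZMod 5), Subtype.ext ?_⟩
  have hk := congrArg Subtype.val hk
  simp at hk
  apply g5_inj
  rw [← hk]
  change g5 ((k : ZMod 5) • w0) = _
  rw [Int.cast_smul_eq_zsmul]; rfl
end tors
end St14

namespace St14

variable {K L : Type} [Field K] [NumberField K] [Field L] [NumberField L] [Algebra K L]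

structure LD (z : 𝓞 K) (d : 𝓞 K ≃+* 𝓞 K) (σ : L ≃ₐ[K] L) (a : 𝓞 L) (δ : L ≃+* L) (N : ℕ) : Prop where
  ck : CK z d
  kd : KD (z : K) σ (a : L)
  ha : a^5 = N
  hN : N.Prime
  hN1 : N % 5 = 1
  da : oi δ a = a
  dk : ∀ k : 𝓞 K, oi δ (algebraMap (𝓞 K) (𝓞 L) k) = algebraMap (𝓞 K) (𝓞 L) (d k)

lemma fixK (f : L ≃+* L) (h : ∀ k : 𝓞 K, f (algebraMap K L k) = algebraMap K L k) (k : K) :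
    f (algebraMap K L k) = algebraMap K L k := by
  obtain ⟨x, y, hy, rfl⟩ := IsFractionRing.div_surjective (A := 𝓞 K) k
  rw [_root_.map_div₀, _root_.map_div₀]
  congr 1
  · exact h x
  · exact h y

namespace LD
variable {z : 𝓞 K} {d : 𝓞 K ≃+* 𝓞 K} {σ : L ≃ₐ[K] L} {a : 𝓞 L} {δ : L ≃+* L} {N : ℕ}

lemma dkL (h : LD z d σ a δ N) (k : 𝓞 K) : δ (algebraMap K L k) = algebraMap K L (d k) := by
  have := congrArg (algebraMap (𝓞 L) L) (h.dk k)
  exact this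

lemma daL (h : LD z d σ a δ N) : δ a = a := by
  have := congrArg (algebraMap (𝓞 L) L) (h.da)
  exact this

lemma a_ne (h : LD z d σ a δ N) : a ≠ 0 := by
  rintro rfl
  exact h.kd.hy0 (by simp)

lemma eq_pow (h : LD z d σ a δ N) (f : L ≃+* L) (hf : ∀ k : 𝓞 K, f (algebraMap K L k) = algebraMap K L k)
    (n : ℕ) (hn : n < 5) (ha : f a = (algebraMap K L z)^n * a) (x : L) : f x = (σ^n) x := by
  let g : L ≃ₐ[K] L := AlgEquiv.ofRingEquiv (f := f) (fixK f hf)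
  obtain ⟨m, hm, hg⟩ := h.kd.exists_pow g
  have h1 : g a = f a := rfl
  rw [hg, h.kd.pow_y, ha] at h1
  have h2 := mul_right_cancel₀ h.kd.hy0 h1
  have h2 : algebraMap K L ((z : K)^m) = algebraMap K L ((z : K)^n) := by rw [map_pow (algebraMap K L), map_pow (algebraMap K L)]; exact h2
  have h3 := (algebraMap K L).injective h2
  have := h.ck.hz.pow_inj hm hn h3
  subst this
  rw [← hg]; rfl

lemma comm (h : LD z d σ a δ N) (x : L) : δ (σ x) = σ (σ (δ x)) := by
  have h1 := h.eq_pow (δ * σ.toRingEquiv * δ⁻¹) ?_ 2 (by norm_num) ?_ (δ x)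
  · have e : δ⁻¹ (δ x) = x := δ.symm_apply_apply x
    rw [RingAut.mul_apply, RingAut.mul_apply, e] at h1
    exact h1
  · intro k
    have e : δ⁻¹ (algebraMap K L k) = algebraMap K L ((d.symm k : 𝓞 K)) := by
      apply δ.injective
      rw [h.dkL, d.apply_symm_apply]
      exact δ.apply_symm_apply _
    rw [RingAut.mul_apply, RingAut.mul_apply, e]
    change δ (σ _) = _
    rw [σ.commutes, h.dkL, d.apply_symm_apply]
  · have e : δ⁻¹ (a : L) = a := by
      apply δ.injective
      rw [h.daL]
      exact δ.apply_symm_apply _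
    rw [RingAut.mul_apply, RingAut.mul_apply, e]
    change δ (σ _) = _
    rw [h.kd.hy, map_mul, h.daL, h.dkL, h.ck.hd]
    congr 1
    exact map_pow _ _ _

lemma comm' (h : LD z d σ a δ N) : δ * σ.toRingEquiv = σ.toRingEquiv * σ.toRingEquiv * δ := by
  ext x; exact h.comm x

lemma d4 (h : LD z d σ a δ N) (x : L) : δ (δ (δ (δ x))) = x := by
  have h1 := h.eq_pow (δ * δ * δ * δ) ?_ 0 (by norm_num) ?_ x
  · exact h1
  · intro k
    change δ (δ (δ (δ _))) = _
    rw [h.dkL, h.dkL, h.dkL, h.dkL, h.ck.d4]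
  · change δ (δ (δ (δ _))) = _
    rw [h.daL, h.daL, h.daL, h.daL]; simp

lemma iS4 (h : LD z d σ a δ N) (I : Ideal (𝓞 L)) : iS δ (iS δ (iS δ (iS δ I))) = I := by
  rw [iS_comp, iS_comp, iS_comp]
  have : δ * (δ * (δ * δ)) = 1 := by ext x; exact h.d4 x
  rw [← mul_assoc, ← mul_assoc] at this
  simp only [mul_assoc] at this ⊢
  rw [this, iS_one]

lemma cS4 (h : LD z d σ a δ N) (c : ClassGroup (𝓞 L)) : cS δ (cS δ (cS δ (cS δ c))) = c := by
  obtain ⟨I, hI, rfl⟩ := cl_surj c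
  rw [cS_cl _ hI, cS_cl _ (iS_ne _ hI), cS_cl _ (iS_ne _ (iS_ne _ hI)), cS_cl _ (iS_ne _ (iS_ne _ (iS_ne _ hI))), h.iS4]

lemma iS_comm (h : LD z d σ a δ N) (I : Ideal (𝓞 L)) :
    iS δ (iS σ.toRingEquiv I) = iS σ.toRingEquiv (iS σ.toRingEquiv (iS δ I)) := by
  rw [iS_comp, iS_comp, iS_comp, h.comm', mul_assoc]

lemma cS_comm (h : LD z d σ a δ N) (c : ClassGroup (𝓞 L)) :
    cS δ (cS σ.toRingEquiv c) = cS σ.toRingEquiv (cS σ.toRingEquiv (cS δ c)) := by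
  rw [cS_comp, cS_comp, cS_comp, h.comm', mul_assoc]

lemma iS_iJ (h : LD z d σ a δ N) (q : 𝓞 K) : iS δ (iJ K L (Ideal.span {q})) = iJ K L (Ideal.span {d q}) := by
  rw [iJ_span, iS_span, h.dk, iJ_span]

lemma nI_d (h : LD z d σ a δ N) {I : Ideal (𝓞 L)} {q : 𝓞 K} (hI : Ideal.relNorm (𝓞 K) I = Ideal.span {q}) :
    Ideal.relNorm (𝓞 K) (iS δ I) = Ideal.span {d q} := by
  apply h.kd.iJ_inj
  rw [← h.iS_iJ, ← hI, h.kd.iJ_nI, h.kd.iJ_nI]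
  simp only [map_mul, h.iS_comm, h.kd.iS5]
  ring

lemma norm_d (h : LD z d σ a δ N) (x : 𝓞 L) : RingOfIntegers.norm K (oi δ x) = d (RingOfIntegers.norm K x) := by
  apply RingOfIntegers.ext
  apply (algebraMap K L).injective
  rw [← h.dkL, RingOfIntegers.coe_norm, RingOfIntegers.coe_norm, h.kd.norm_eq, h.kd.norm_eq]
  simp only [map_mul, h.comm, h.kd.s5, oi_coe]
  ring

lemma normL_d (h : LD z d σ a δ N) {x : L} {k : 𝓞 K} (hx : Algebra.norm K x = k) : Algebra.norm K (δ x) = d k := by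
  apply (algebraMap K L).injective
  rw [← h.dkL, ← hx, h.kd.norm_eq, h.kd.norm_eq]
  simp only [map_mul, h.comm, h.kd.s5]
  ring

lemma comap_d (h : LD z d σ a δ N) {P : Ideal (𝓞 L)} {q : 𝓞 K} (hP : P.comap (algebraMap (𝓞 K) (𝓞 L)) = Ideal.span {q}) :
   (iS δ P).comap (algebraMap (𝓞 K) (𝓞 L)) = Ideal.span {d q} := by
  ext x
  obtain ⟨x, rfl⟩ := d.surjective x
  rw [Ideal.mem_comap, ← h.dk, Ideal.mem_span_singleton, map_dvd_iff, ← Ideal.mem_span_singleton, ← hP, Ideal.mem_comap]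
  constructor
  · intro hx
    obtain ⟨y, hy, hyx⟩ := mem_iS.1 hx
    rw [← (oi δ).injective hyx]; exact hy
  · exact fun hx => iS_mem hx

lemma ram_d (h : LD z d σ a δ N) {P : Ideal (𝓞 L)} (hP : Ram K P) : Ram K (iS δ P) := by
  haveI := h.ck.pid
  refine ⟨iS_prime _ hP.1, iS_ne_bot _ hP.2.1, ?_⟩
  obtain ⟨q, hq⟩ := IsPrincipalIdealRing.principal (P.comap (algebraMap (𝓞 K) (𝓞 L)))
  have hq : P.comap (algebraMap (𝓞 K) (𝓞 L)) = Ideal.span {q} := hq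
  rw [h.comap_d hq, ← h.iS_iJ, ← hq, ← hP.2.2, map_pow]

end LD
end St14

namespace St14
variable {K L : Type} [Field K] [NumberField K] [Field L] [NumberField L] [Algebra K L]
variable {z : 𝓞 K} {d : 𝓞 K ≃+* 𝓞 K} {σ : L ≃ₐ[K] L} {a : 𝓞 L} {δ : L ≃+* L} {N : ℕ}

namespace CK
lemma ndvd1 (h : CK z d) {p : ℕ} (hp : p.Prime) (h5 : p % 5 = 1) {g : 𝓞 K} (hg : Prime g) (hgp : g ∣ (p : 𝓞 K)) :
    ¬ g ∣ d g := fun hc => h.ndvd_one hp h5 hg hgp (hc.trans (d_dvd.2 hc))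

lemma ndvd3 (h : CK z d) {p : ℕ} (hp : p.Prime) (h5 : p % 5 = 1) {g : 𝓞 K} (hg : Prime g) (hgp : g ∣ (p : 𝓞 K)) :
    ¬ g ∣ d (d (d g)) := fun hc => by
  have := d_dvd (d := d).2 hc
  rw [h.d4] at this
  exact h.ndvd1 hp h5 hg hgp (assoc_of_dvd (d_prime hg) hg this)

lemma split (h : CK z d) {p : ℕ} (hp : p.Prime) (h5 : p % 5 = 1) {g : 𝓞 K} (hg : Prime g) (hgp : g ∣ (p : 𝓞 K)) :
    Ideal.span {(p : 𝓞 K)} = Ideal.span {g} * Ideal.span {d g} * Ideal.span {d (d g)} * Ideal.span {d (d (d g))} := by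
  have key : ∀ {q r : 𝓞 K}, Prime q → Prime r → ¬ q ∣ r → ∀ {x}, r ∣ x → ∀ {y}, x = r * y → q ∣ x → q ∣ y := by
    intro q r hq hr hqr x _ y hxy hqx
    rw [hxy] at hqx
    exact (hq.dvd_or_dvd hqx).resolve_left hqr
  have g1 : d g ∣ (p : 𝓞 K) := d_dvd_nat hgp
  have g2 : d (d g) ∣ (p : 𝓞 K) := d_dvd_nat g1
  have g3 : d (d (d g)) ∣ (p : 𝓞 K) := d_dvd_nat g2
  have p1 : Prime (d g) := d_prime hg
  have p2 : Prime (d (d g)) := d_prime p1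
  have p3 : Prime (d (d (d g))) := d_prime p2
  obtain ⟨n, hn⟩ := h.norm_int g
  have hdvd : g * d g * d (d g) * d (d (d g)) ∣ (p : 𝓞 K) := by
    obtain ⟨x, hx⟩ := hgp
    have a1 : d g ∣ x := (p1.dvd_or_dvd (hx ▸ g1)).resolve_left (fun hc => h.ndvd1 hp h5 hg ⟨x, hx⟩ (assoc_of_dvd p1 hg hc))
    have a2 : d (d g) ∣ x := (p2.dvd_or_dvd (hx ▸ g2)).resolve_left (fun hc => h.ndvd_one hp h5 hg ⟨x, hx⟩ (assoc_of_dvd p2 hg hc))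
    have a3 : d (d (d g)) ∣ x := (p3.dvd_or_dvd (hx ▸ g3)).resolve_left (fun hc => h.ndvd3 hp h5 hg ⟨x, hx⟩ (assoc_of_dvd p3 hg hc))
    obtain ⟨y, rfl⟩ := a1
    have b2 : d (d g) ∣ y := (p2.dvd_or_dvd a2).resolve_left (fun hc => h.ndvd1 hp h5 hg ⟨_, hx⟩ (d_dvd.1 (assoc_of_dvd p2 p1 hc)))
    have b3 : d (d (d g)) ∣ y := (p3.dvd_or_dvd a3).resolve_left (fun hc => h.ndvd_one hp h5 hg ⟨_, hx⟩ (d_dvd.1 (assoc_of_dvd p3 p1 hc)))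
    obtain ⟨w, rfl⟩ := b2
    have c3 : d (d (d g)) ∣ w := (p3.dvd_or_dvd b3).resolve_left (fun hc => h.ndvd1 hp h5 hg ⟨_, hx⟩ (d_dvd.1 (d_dvd.1 (assoc_of_dvd p3 p2 hc))))
    obtain ⟨t, rfl⟩ := c3
    exact ⟨t, by rw [hx]; ring⟩
  rw [Ideal.span_singleton_mul_span_singleton, Ideal.span_singleton_mul_span_singleton, Ideal.span_singleton_mul_span_singleton]
  apply span_dvd _ hdvd
  rw [hn]
  have : (p : ℤ) ∣ n := h.prime_int hp hg hgp ⟨d g * d (d g) * d (d (d g)), by rw [← hn]; ring⟩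
  obtain ⟨t, rfl⟩ := this
  exact ⟨t, by push_cast; ring⟩
end CK

namespace LD

lemma haK (h : LD z d σ a δ N) : a^5 = algebraMap (𝓞 K) (𝓞 L) (N : 𝓞 K) := by rw [h.ha]; simp

lemma N0 (h : LD z d σ a δ N) : (N : 𝓞 K) ≠ 0 := by exact_mod_cast h.hN.ne_zero

lemma exists_ram (h : LD z d σ a δ N) {π : 𝓞 K} (hπ : Prime π) (hπN : π ∣ (N : 𝓞 K)) :
    ∃ P : Ideal (𝓞 L), Ram K P ∧ P.comap (algebraMap (𝓞 K) (𝓞 L)) = Ideal.span {π} := by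
  have hs := h.ck.split h.hN h.hN1 hπ hπN
  have q0 := primeK_span hπ
  have q1 := primeK_span (CK.d_prime (d := d) hπ)
  have q2 := primeK_span (CK.d_prime (d := d) (CK.d_prime (d := d) hπ))
  have q3 := primeK_span (CK.d_prime (d := d) (CK.d_prime (d := d) (CK.d_prime (d := d) hπ)))
  obtain ⟨P, hP, hP0, hc⟩ := exists_over (T := L) _ q0
  refine ⟨P, h.kd.ram_of_val h.haK h.N0 hP hP0 ?_, hc⟩
  have ne : ∀ {x : 𝓞 K}, ¬ π ∣ x → Ideal.span {π} ≠ Ideal.span {x} := by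
    intro x hx he
    rw [Ideal.span_singleton_eq_span_singleton] at he
    exact hx he.dvd
  rw [hc, hs, vv_mul q0 (mul_ne_zero (mul_ne_zero q0.ne_zero q1.ne_zero) q2.ne_zero) q3.ne_zero,
    vv_mul q0 (mul_ne_zero q0.ne_zero q1.ne_zero) q2.ne_zero, vv_mul q0 q0.ne_zero q1.ne_zero, vv_self q0,
    vv_ne q0 q1 (ne (h.ck.ndvd1 h.hN h.hN1 hπ hπN)), vv_ne q0 q2 (ne (h.ck.ndvd_one h.hN h.hN1 hπ hπN)),
    vv_ne q0 q3 (ne (h.ck.ndvd3 h.hN h.hN1 hπ hπN))]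
  norm_num

lemma ram_prod (h : LD z d σ a δ N) {π : 𝓞 K} (hπ : Prime π) (hπN : π ∣ (N : 𝓞 K)) {P : Ideal (𝓞 L)} (hP : Ram K P)
    (hc : P.comap (algebraMap (𝓞 K) (𝓞 L)) = Ideal.span {π}) :
    P * iS δ P * iS δ (iS δ P) * iS δ (iS δ (iS δ P)) = Ideal.span {a} := by
  apply ideal_pow_inj (n := 5) (by norm_num)
  rw [Ideal.span_singleton_pow, h.haK, ← iJ_span, h.ck.split h.hN h.hN1 hπ hπN]
  have h1 := h.ram_d hP
  have h2 := h.ram_d h1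
  have h3 := h.ram_d h2
  have c1 := h.comap_d hc
  have c2 := h.comap_d c1
  have c3 := h.comap_d c2
  rw [mul_pow, mul_pow, mul_pow, hP.2.2, h1.2.2, h2.2.2, h3.2.2, hc, c1, c2, c3]
  simp only [map_mul]

lemma ram_pow (h : LD z d σ a δ N) {P : Ideal (𝓞 L)} (hP : Ram K P) : cl P ^ 5 = 1 := by
  haveI := h.ck.pid
  obtain ⟨k, hk, hk2⟩ := KD.ram_pow_principal hP
  rw [← cl_pow hP.2.1, hk2, cl_span]
  intro hc
  apply hk
  exact (FaithfulSMul.algebraMap_injective (𝓞 K) (𝓞 L)) (by simpa using hc)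

lemma cl_prod (h : LD z d σ a δ N) {π : 𝓞 K} (hπ : Prime π) (hπN : π ∣ (N : 𝓞 K)) {P : Ideal (𝓞 L)} (hP : Ram K P)
    (hc : P.comap (algebraMap (𝓞 K) (𝓞 L)) = Ideal.span {π}) :
    cl P * cS δ (cl P) * cS δ (cS δ (cl P)) * cS δ (cS δ (cS δ (cl P))) = 1 := by
  have n0 : P ≠ 0 := hP.2.1
  have n1 := iS_ne δ n0
  have n2 := iS_ne δ n1
  have n3 := iS_ne δ n2
  rw [cS_cl _ n0, cS_cl _ n1, cS_cl _ n2, ← cl_mul n0 n1, ← cl_mul (mul_ne_zero n0 n1) n2,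
    ← cl_mul (mul_ne_zero (mul_ne_zero n0 n1) n2) n3, h.ram_prod hπ hπN hP hc, cl_span h.a_ne]

lemma pow_eq_one_of {G : Type} [CommGroup G] {c : G} (h4 : c * c * c * c = 1) (h5 : c^5 = 1) : c = 1 := by
  have : c^5 = (c * c * c * c) * c := by simp only [pow_succ, pow_zero, one_mul]
  rw [h5, h4, one_mul] at this
  exact this.symm

theorem not_fix (h : LD z d σ a δ N) : ∃ c : ClassGroup (𝓞 L), c^5 = 1 ∧ cS δ c ≠ c := by
  obtain ⟨π, hπ, hπN⟩ := h.ck.exists_prime h.hN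
  obtain ⟨P, hP, hc⟩ := h.exists_ram hπ hπN
  by_contra! hcon
  have e := hcon (cl P) (h.ram_pow hP)
  have e2 := h.cl_prod hπ hπN hP hc
  rw [e, e, e] at e2
  have e1 := pow_eq_one_of e2 (h.ram_pow hP)
  have n0 : P ≠ 0 := hP.2.1
  have n1 := iS_ne δ n0
  have n2 := iS_ne δ n1
  have n3 := iS_ne δ n2
  have f1 : cl (iS δ P) = 1 := by rw [← cS_cl _ n0, e1, map_one]
  have f2 : cl (iS δ (iS δ P)) = 1 := by rw [← cS_cl _ n1, f1, map_one]
  have f3 : cl (iS δ (iS δ (iS δ P))) = 1 := by rw [← cS_cl _ n2, f2, map_one]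
  have h1 := h.ram_d hP
  have h2 := h.ram_d h1
  have h3 := h.ram_d h2
  have c1 := h.comap_d hc
  have c2 := h.comap_d c1
  have c3 := h.comap_d c2
  have ne : ∀ {Q R : Ideal (𝓞 L)} {x y : 𝓞 K}, ¬ x ∣ y → Q.comap (algebraMap (𝓞 K) (𝓞 L)) = Ideal.span {x} →
      R.comap (algebraMap (𝓞 K) (𝓞 L)) = Ideal.span {y} → Q ≠ R := by
    rintro Q R x y hxy hx hy rfl
    rw [hx, Ideal.span_singleton_eq_span_singleton] at hy
    exact hxy hy.dvd
  have p1 : Prime (d π) := CK.d_prime hπ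
  have p2 : Prime (d (d π)) := CK.d_prime p1
  have g1 : d π ∣ (N : 𝓞 K) := CK.d_dvd_nat hπN
  have g2 : d (d π) ∣ (N : 𝓞 K) := CK.d_dvd_nat g1
  have n01 := ne (h.ck.ndvd1 h.hN h.hN1 hπ hπN) hc c1
  have n02 := ne (h.ck.ndvd_one h.hN h.hN1 hπ hπN) hc c2
  have n03 := ne (h.ck.ndvd3 h.hN h.hN1 hπ hπN) hc c3
  have n12 := ne (h.ck.ndvd1 h.hN h.hN1 p1 g1) c1 c2
  have n13 := ne (h.ck.ndvd_one h.hN h.hN1 p1 g1) c1 c3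
  have n23 := ne (h.ck.ndvd1 h.hN h.hN1 p2 g2) c2 c3
  have := h.kd.index_lower ![P, iS δ P, iS δ (iS δ P), iS δ (iS δ (iS δ P))] ?_ ?_ ?_
  · norm_num at this
  · intro i j hij
    fin_cases i <;> fin_cases j <;> first | rfl | (exfalso; first | exact n01 hij | exact n02 hij | exact n03 hij | exact n12 hij | exact n13 hij | exact n23 hij | exact n01 hij.symm | exact n02 hij.symm | exact n03 hij.symm | exact n12 hij.symm | exact n13 hij.symm | exact n23 hij.symm)
  · intro i; fin_cases i
    exacts [hP, h1, h2, h3]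
  · intro i; fin_cases i
    · obtain ⟨x, _, hx⟩ := (cl_eq_one n0).1 e1; exact ⟨x, hx⟩
    · obtain ⟨x, _, hx⟩ := (cl_eq_one n1).1 f1; exact ⟨x, hx⟩
    · obtain ⟨x, _, hx⟩ := (cl_eq_one n2).1 f2; exact ⟨x, hx⟩
    · obtain ⟨x, _, hx⟩ := (cl_eq_one n3).1 f3; exact ⟨x, hx⟩
end LD
end St14

namespace St14
variable {K L : Type} [Field K] [NumberField K] [Field L] [NumberField L] [Algebra K L]
variable {z : 𝓞 K} {d : 𝓞 K ≃+* 𝓞 K} {σ : L ≃ₐ[K] L} {a : 𝓞 L} {δ : L ≃+* L} {N : ℕ}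

def Rel (σ : L ≃ₐ[K] L) (c : ClassGroup (𝓞 L)) (u : (𝓞 K)ˣ) : Prop :=
  ∃ I : Ideal (𝓞 L), I ≠ 0 ∧ cl I = c ∧ ∃ x y : 𝓞 L, x ≠ 0 ∧ y ≠ 0 ∧
    Ideal.span {x} * iS σ.toRingEquiv I = Ideal.span {y} * I ∧ RingOfIntegers.norm K y = u * RingOfIntegers.norm K x

namespace Rel
variable {c c' : ClassGroup (𝓞 L)} {u u' : (𝓞 K)ˣ}

lemma exists_of (hc : cS σ.toRingEquiv c = c) : ∃ u ∈ nT K L, Rel σ c u := by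
  obtain ⟨I, hI, rfl⟩ := cl_surj c
  rw [cS_cl _ hI, cl_eq (iS_ne _ hI) hI] at hc
  obtain ⟨x, y, hx, hy, hxy⟩ := hc
  obtain ⟨u, hu, hn⟩ := KD.rel_nT (K := K) hI hx hxy
  exact ⟨u, hu, I, hI, rfl, x, y, hx, hy, hxy, hn⟩

lemma mul (h : Rel σ c u) (h' : Rel σ c' u') : Rel σ (c * c') (u * u') := by
  obtain ⟨I, hI, rfl, x, y, hx, hy, hxy, hn⟩ := h
  obtain ⟨I', hI', rfl, x', y', hx', hy', hxy', hn'⟩ := h'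
  refine ⟨I * I', mul_ne_zero hI hI', cl_mul hI hI', x * x', y * y', mul_ne_zero hx hx', mul_ne_zero hy hy', ?_, ?_⟩
  · rw [← Ideal.span_singleton_mul_span_singleton, ← Ideal.span_singleton_mul_span_singleton, map_mul,
      mul_mul_mul_comm, hxy, hxy', mul_mul_mul_comm]
  · rw [map_mul, map_mul, hn, hn']; push_cast; ring

lemma one : Rel σ (1 : ClassGroup (𝓞 L)) (1 : (𝓞 K)ˣ) :=
  ⟨1, one_ne_zero, cl_one, 1, 1, one_ne_zero, one_ne_zero, by rw [map_one], by simp⟩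

lemma pow (h : Rel σ c u) (n : ℕ) : Rel σ (c^n) (u^n) := by
  induction n with
  | zero => simpa using one
  | succ n ih => rw [pow_succ, pow_succ]; exact ih.mul h

lemma of_one (h : Rel σ 1 u) : u ∈ (nU K L).range := by
  obtain ⟨I, hI, hc, x, y, hx, hy, hxy, hn⟩ := h
  obtain ⟨t, ht, rfl⟩ := (cl_eq_one hI).1 hc
  rw [iS_span, Ideal.span_singleton_mul_span_singleton, Ideal.span_singleton_mul_span_singleton,
    Ideal.span_singleton_eq_span_singleton] at hxy
  obtain ⟨w, hw⟩ := hxy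
  refine ⟨w, ?_⟩
  apply Units.ext
  apply RingOfIntegers.ext
  have hw' := congrArg (fun r : 𝓞 L => Algebra.norm K (r : L)) hw
  have hn' := congrArg (fun r : 𝓞 K => (r : K)) hn
  simp only [map_mul, RingOfIntegers.coe_norm] at hw' hn'
  have e : Algebra.norm K ((oi σ.toRingEquiv t : 𝓞 L) : L) = Algebra.norm K (t : L) := Algebra.norm_eq_of_algEquiv σ (t : L)
  have hw'' : Algebra.norm K (x : L) * Algebra.norm K ((oi σ.toRingEquiv t : 𝓞 L) : L) * Algebra.norm K ((w : 𝓞 L) : L) =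
    Algebra.norm K (y : L) * Algebra.norm K (t : L) := hw'
  have hn'' : Algebra.norm K (y : L) = (u : 𝓞 K) * Algebra.norm K (x : L) := hn'
  rw [e, hn''] at hw''
  have hx0 : Algebra.norm K (x : L) ≠ 0 := by rw [Algebra.norm_ne_zero_iff]; simpa using hx
  have ht0 : Algebra.norm K (t : L) ≠ 0 := by rw [Algebra.norm_ne_zero_iff]; simpa using ht
  rw [nU_coe]
  apply mul_left_cancel₀ (mul_ne_zero hx0 ht0)
  rw [hw'']; ring

lemma strong [IsPrincipalIdealRing (𝓞 K)] {ζ : K} {y : L} (hk : KD ζ σ y) (h : Rel σ c u) (hu : u ∈ (nU K L).range) :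
    ∃ m : Multiset (Ideal (𝓞 L)), (∀ P ∈ m, Ram K P) ∧ cl m.prod = c := by
  obtain ⟨I, hI, rfl, x, y, hx, hy, hxy, hn⟩ := h
  obtain ⟨w, rfl⟩ := hu
  obtain ⟨t, ht, hti⟩ := hk.rel_amb hI hx hy hxy w hn
  obtain ⟨k, hk0, m, hm, hm2⟩ := hk.ambig _ _ (mul_ne_zero (span_ne ht) hI) hti rfl
  refine ⟨m, hm, ?_⟩
  have hk1 : algebraMap (𝓞 K) (𝓞 L) k ≠ 0 := fun hc => hk0 ((FaithfulSMul.algebraMap_injective (𝓞 K) (𝓞 L)) (by simpa using hc))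
  have hm0 : m.prod ≠ 0 := by
    rw [Ne, Multiset.prod_eq_zero_iff]
    exact fun h0 => (hm 0 h0).2.1 rfl
  have := congrArg cl hm2
  rwa [cl_mul (span_ne ht) hI, cl_mul (span_ne hk1) hm0, cl_span ht, cl_span hk1, one_mul, one_mul, eq_comm] at this

lemma uniq {ζ : K} {y : L} (hk : KD ζ σ y) (h : Rel σ c u) (h' : Rel σ c u') (h5 : c^5 = 1) : u * u'^4 ∈ (nU K L).range := by
  have := h.mul (h'.pow 4)
  rw [← pow_succ', h5] at this
  exact this.of_one

lemma dd (hL : LD z d σ a δ N) (h : Rel σ c u) : Rel σ (cS δ c) (Units.map (d : 𝓞 K →* 𝓞 K) u ^ 3) := by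
  obtain ⟨I, hI, rfl, x, y, hx, hy, hxy, hn⟩ := h
  have hJ := iS_ne δ hI
  have h1 := congrArg (iS δ) hxy
  rw [map_mul, map_mul, iS_span, iS_span, hL.iS_comm] at h1
  set J := iS δ I with hJd
  set A := oi δ x
  set B := oi δ y
  set s := σ.toRingEquiv
  have h2 := congrArg (fun I => iS s (iS s I)) h1
  have h3 := congrArg (fun I => iS s (iS s I)) h2
  simp only [map_mul, iS_span] at h2 h3
  rw [hL.kd.iS5] at h3
  have hA := oi_ne δ hx
  have hB := oi_ne δ hy
  have e : ∀ t : 𝓞 L, RingOfIntegers.norm K (oi s t) = RingOfIntegers.norm K t := by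
    intro t
    apply RingOfIntegers.ext
    exact Algebra.norm_eq_of_algEquiv σ (t : L)
  refine ⟨J, hJ, (cS_cl _ hI).symm, A * oi s (oi s A) * oi s (oi s (oi s (oi s A))), B * oi s (oi s B) * oi s (oi s (oi s (oi s B))),
    mul_ne_zero (mul_ne_zero hA (oi_ne _ (oi_ne _ hA))) (oi_ne _ (oi_ne _ (oi_ne _ (oi_ne _ hA)))),
    mul_ne_zero (mul_ne_zero hB (oi_ne _ (oi_ne _ hB))) (oi_ne _ (oi_ne _ (oi_ne _ (oi_ne _ hB)))), ?_, ?_⟩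
  · simp only [← Ideal.span_singleton_mul_span_singleton]
    have h0 : iS s (iS s J) * iS s (iS s (iS s (iS s J))) ≠ 0 :=
      mul_ne_zero (iS_ne _ (iS_ne _ hJ)) (iS_ne _ (iS_ne _ (iS_ne _ (iS_ne _ hJ))))
    apply mul_right_cancel₀ h0
    calc _ = (Ideal.span {A} * iS s (iS s J)) * (Ideal.span {oi s (oi s A)} * iS s (iS s (iS s (iS s J)))) * (Ideal.span {oi s (oi s (oi s (oi s A)))} * iS s J) := by ring
      _ = _ := by rw [h1, h2, h3]; ring
  · simp only [map_mul, e]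
    change RingOfIntegers.norm K (oi δ y) * RingOfIntegers.norm K (oi δ y) * RingOfIntegers.norm K (oi δ y) = _ * (RingOfIntegers.norm K (oi δ x) * RingOfIntegers.norm K (oi δ x) * RingOfIntegers.norm K (oi δ x))
    rw [hL.norm_d, hL.norm_d, hn, map_mul]
    push_cast
    simp only [Units.coe_map]
    change d (u : 𝓞 K) * _ * _ * _ = d (u : 𝓞 K) ^ 3 * _
    ring

end Rel
end St14

namespace St14
variable {K L : Type} [Field K] [NumberField K] [Field L] [NumberField L] [Algebra K L]
variable {z : 𝓞 K} {d : 𝓞 K ≃+* 𝓞 K} {σ : L ≃ₐ[K] L} {a : 𝓞 L} {δ : L ≃+* L} {N : ℕ}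

lemma ram_hom {G : Type} [CommGroup G] (φ : ClassGroup (𝓞 L) →* G) (H : Subgroup G) (hH : ∀ P, Ram K P → φ (cl P) ∈ H)
    (m : Multiset (Ideal (𝓞 L))) : (∀ P ∈ m, Ram K P) → φ (cl m.prod) ∈ H := by
  induction m using Multiset.induction with
  | empty => intro _; rw [Multiset.prod_zero, cl_one, map_one]; exact H.one_mem
  | cons P m ih =>
    intro hm
    have hP := hm P (Multiset.mem_cons_self _ _)
    have hm' : ∀ Q ∈ m, Ram K Q := fun Q hQ => hm Q (Multiset.mem_cons_of_mem hQ)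
    have hm0 : m.prod ≠ 0 := by
      rw [Ne, Multiset.prod_eq_zero_iff]
      exact fun h0 => (hm' 0 h0).2.1 rfl
    rw [Multiset.prod_cons, cl_mul hP.2.1 hm0, map_mul]
    exact H.mul_mem (hH P hP) (ih hm')

lemma aid0 {G : Type} [AddCommGroup G] (A B C E e : G) :
    B = ((3 : ℕ) • ((2 : ℕ) • A + (C + Neg.neg B) + (5 : ℕ) • E) + (4 : ℕ) • (A + B + (5 : ℕ) • e)) + ((5 : ℕ) • (Neg.neg ((2 : ℕ) • A)) + (3 : ℕ) • (Neg.neg C) + (5 : ℕ) • (Neg.neg ((3 : ℕ) • E)) + (5 : ℕ) • (Neg.neg ((4 : ℕ) • e))) := by abel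
lemma mid0 {G : Type} [CommGroup G] (A B C E e : G) :
    B = ((A^2 * (C * B⁻¹) * E^5)^3 * (A * B * e^5)^4) * (((A^2)⁻¹)^5 * (C⁻¹)^3 * ((E^3)⁻¹)^5 * ((e^4)⁻¹)^5) :=
  aid0 (G := Additive G) A B C E e
lemma aid1 {G : Type} [AddCommGroup G] (A B C E e : G) :
    (14 : ℕ) • A = ((3 : ℕ) • ((2 : ℕ) • A + (C + Neg.neg B) + (5 : ℕ) • E) + (4 : ℕ) • ((2 : ℕ) • (A + B + (5 : ℕ) • e))) + ((3 : ℕ) • (Neg.neg C) + (5 : ℕ) • (Neg.neg B) + (5 : ℕ) • (Neg.neg ((3 : ℕ) • E)) + (5 : ℕ) • (Neg.neg ((8 : ℕ) • e))) := by abel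
lemma mid1 {G : Type} [CommGroup G] (A B C E e : G) :
    A^14 = ((A^2 * (C * B⁻¹) * E^5)^3 * ((A * B * e^5)^2)^4) * ((C⁻¹)^3 * (B⁻¹)^5 * ((E^3)⁻¹)^5 * ((e^8)⁻¹)^5) :=
  aid1 (G := Additive G) A B C E e

namespace LD

/-- primes over `N` -/
def OverN (K : Type) [Field K] [NumberField K] [Algebra K L] (N : ℕ) (P : Ideal (𝓞 L)) : Prop :=
  ∃ q : 𝓞 K, Prime q ∧ q ∣ (N : 𝓞 K) ∧ P.comap (algebraMap (𝓞 K) (𝓞 L)) = Ideal.span {q}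

lemma overN_of_mem (h : LD z d σ a δ N) {P : Ideal (𝓞 L)} (hP : Ram K P) (ha : a ∈ P) : OverN K N P := by
  haveI := h.ck.pid
  obtain ⟨q, hq⟩ := IsPrincipalIdealRing.principal (P.comap (algebraMap (𝓞 K) (𝓞 L)))
  have hq : P.comap (algebraMap (𝓞 K) (𝓞 L)) = Ideal.span {q} := hq
  have hp := hP.primeK
  rw [hq] at hp
  refine ⟨q, Ideal.prime_span_singleton_iff.1 hp, ?_, hq⟩
  rw [← Ideal.mem_span_singleton, ← hq, Ideal.mem_comap, ← h.haK]
  exact Ideal.pow_mem_of_mem _ ha _ (by norm_num)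

lemma ram_class (h : LD z d σ a δ N) {P : Ideal (𝓞 L)} (hP : Ram K P) :
    P.comap (algebraMap (𝓞 K) (𝓞 L)) = Ideal.span {1 - z} ∨ OverN K N P := by
  have h1 := h.kd.ram_mul_mem (x := a) rfl hP
  rcases hP.1.mem_or_mem h1 with h1 | h1
  · left
    have : P.comap (algebraMap (𝓞 K) (𝓞 L)) ∣ Ideal.span {1 - z} := by
      rw [Ideal.dvd_span_singleton]; exact h1
    exact prime_dvd_prime_eq hP.primeK (primeK_span h.ck.lam_prime) this
  · exact Or.inr (h.overN_of_mem hP h1)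

lemma ram_class25 (h : LD z d σ a δ N) (h25 : 25 ∣ N - 1) {P : Ideal (𝓞 L)} (hP : Ram K P) : OverN K N P := by
  apply h.overN_of_mem hP
  refine h.kd.ram_mem rfl h.haK h.ck.lam4_dvd ?_ hP
  obtain ⟨t, ht⟩ := h25
  have h1 := h.hN.one_lt
  have : (N : 𝓞 K) - 1 = 5 * 5 * t := by
    have : (N : 𝓞 K) = ((25 * t + 1 : ℕ) : 𝓞 K) := by congr 1; omega
    rw [this]; push_cast; ring
  rw [this]
  refine Dvd.dvd.mul_right ?_ _
  have h4 := h.ck.lam4_dvd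
  exact dvd_trans ⟨(1-z)^3, by ring⟩ (mul_dvd_mul h4 h4)

lemma lam_fix (h : LD z d σ a δ N) {P : Ideal (𝓞 L)} (hP : Ram K P) (hc : P.comap (algebraMap (𝓞 K) (𝓞 L)) = Ideal.span {1 - z}) :
    cS δ (cl P) = cl P := by
  rw [cS_cl _ hP.2.1]
  congr 1
  apply ram_unique (h.ram_d hP) hP
  rw [h.comap_d hc, hc]
  apply span_dvd
  · have := CK.d_dvd (d := d).2 (show (1 - z) ∣ d (1 - z) from ⟨_, h.ck.d_lam⟩)
    have h2 := CK.d_dvd (d := d).2 this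
    have h3 := CK.d_dvd (d := d).2 h2
    rw [h.ck.d4] at h3
    exact (this.trans h2).trans h3
  · exact ⟨_, h.ck.d_lam⟩

lemma zeta_nT (h : LD z d σ a δ N) (h25 : ¬ 25 ∣ N - 1) {m : ℤ} (hm : h.ck.zU^m ∈ nT K L) : 5 ∣ m := by
  by_contra hc
  obtain ⟨π, hπ, hπN⟩ := h.ck.exists_prime h.hN
  obtain ⟨P, hP, hcP⟩ := h.exists_ram hπ hπN
  obtain ⟨x, hx⟩ := hm
  obtain ⟨k, hk⟩ := h.kd.local_F5 h.ck hP hcP (fun hc => hπ.not_unit (isUnit_of_dvd_unit hc (Units.isUnit _))) hx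
  refine h.ck.zeta_not_fifth h.hN ?_ hπ hπN h.hN.one_lt.le h25 (fun k => hπN.trans (h.ck.frob_one h.hN h.hN1 k)) k hc rfl hk
  rintro rfl
  have := h.hN1
  norm_num at this

noncomputable def tr0 (δ : L ≃+* L) : ClassGroup (𝓞 L) →* ClassGroup (𝓞 L) :=
  MonoidHom.id _ * cS δ * (cS δ).comp (cS δ) * (cS δ).comp ((cS δ).comp (cS δ))
lemma tr0_apply (c : ClassGroup (𝓞 L)) : tr0 δ c = c * cS δ c * cS δ (cS δ c) * cS δ (cS δ (cS δ c)) := rfl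

noncomputable def tr1 (δ : L ≃+* L) : ClassGroup (𝓞 L) →* ClassGroup (𝓞 L) :=
  MonoidHom.id _ * (cS δ)^3 * ((cS δ).comp (cS δ))^4 * ((cS δ).comp ((cS δ).comp (cS δ)))^2
lemma tr1_apply (c : ClassGroup (𝓞 L)) : tr1 δ c = c * (cS δ c)^3 * (cS δ (cS δ c))^4 * (cS δ (cS δ (cS δ c)))^2 := rfl

lemma pow_mod {G : Type} [CommGroup G] {c : G} (h : c^5 = 1) (n : ℕ) : c^n = c^(n % 5) := by
  conv_lhs => rw [← Nat.div_add_mod n 5, pow_add, pow_mul, h, one_pow, one_mul]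

lemma mem_of_pow4 {G : Type} [CommGroup G] {c : G} (h : c^5 = 1) {H : Subgroup G} (h4 : c^4 ∈ H) : c ∈ H := by
  have : c = (c^4)^4 := by rw [← pow_mul, pow_mod h]; simp
  rw [this]; exact H.pow_mem h4 4

variable {c : ClassGroup (𝓞 L)} {u : (𝓞 K)ˣ}

lemma P5R (h : LD z d σ a δ N) (e : (𝓞 K)ˣ) : e^5 ∈ (nU K L).range := h.kd.P5_le (P5_pow e)

lemma W0_unit (h : LD z d σ a δ N) (h5 : c^5 = 1) (hd : cS δ c = c) (hr : Rel σ c u) :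
    ∃ m : ℤ, u * (h.ck.zU^m)⁻¹ ∈ (nU K L).range := by
  have h1 := hr.dd h
  rw [hd] at h1
  have h2 := h1.uniq h.kd hr h5
  obtain ⟨m, b, e, rfl⟩ := h.ck.unit_form u
  obtain ⟨o, ho⟩ := mem_P5.1 (CK.neg_one_P5 (K := K))
  simp only [map_mul, map_pow, map_zpow, h.ck.d_zU, h.ck.d_eU] at h2
  set R := (nU K L).range
  set E := Units.map (d : 𝓞 K →* 𝓞 K) e
  have hneg : (-1 : (𝓞 K)ˣ) ∈ R := h.kd.P5_le CK.neg_one_P5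
  have e1 : (-h.ck.eU⁻¹ : (𝓞 K)ˣ) = (-1) * h.ck.eU⁻¹ := by simp
  rw [e1] at h2
  have key : h.ck.eU^b ∈ R := by
    have : h.ck.eU^b = (((h.ck.zU ^ 2) ^ m * (-1 * h.ck.eU⁻¹) ^ b * E ^ 5) ^ 3 * (h.ck.zU ^ m * h.ck.eU ^ b * e ^ 5) ^ 4) *
      ((((h.ck.zU^m)^2)⁻¹)^5 * (((-1)^b)⁻¹)^3 * ((E^3)⁻¹)^5 * ((e^4)⁻¹)^5) := by
      have z2 : (h.ck.zU^2)^m = (h.ck.zU^m)^2 := by rw [← zpow_natCast, ← zpow_natCast, zpow_comm]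
      rw [z2, mul_zpow, inv_zpow]
      generalize h.ck.zU^m = A
      generalize h.ck.eU^b = B
      generalize ((-1 : (𝓞 K)ˣ))^b = C
      exact mid0 A B C E e
    rw [this]
    refine R.mul_mem h2 (R.mul_mem (R.mul_mem (R.mul_mem ?_ ?_) ?_) ?_)
    · exact h.P5R _
    · exact R.pow_mem (R.inv_mem (R.zpow_mem hneg _)) _
    · exact h.P5R _
    · exact h.P5R _
  refine ⟨m, ?_⟩
  have : h.ck.zU ^ m * h.ck.eU ^ b * e ^ 5 * (h.ck.zU ^ m)⁻¹ = h.ck.eU^b * e^5 := by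
    rw [mul_comm, ← mul_assoc, ← mul_assoc, inv_mul_cancel, one_mul]
  rw [this]
  exact R.mul_mem key (h.P5R e)

lemma W1_unit (h : LD z d σ a δ N) (h5 : c^5 = 1) (hd : cS δ c = c^2) (hr : Rel σ c u) :
    ∃ b : ℤ, u * (h.ck.eU^b)⁻¹ ∈ (nU K L).range := by
  have h1 := hr.dd h
  rw [hd] at h1
  have h2 := h1.uniq h.kd (hr.pow 2) (by rw [← pow_mul, mul_comm, pow_mul, h5, one_pow])
  obtain ⟨m, b, e, rfl⟩ := h.ck.unit_form u
  simp only [map_mul, map_pow, map_zpow, h.ck.d_zU, h.ck.d_eU] at h2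
  set R := (nU K L).range
  set E := Units.map (d : 𝓞 K →* 𝓞 K) e
  have hneg : (-1 : (𝓞 K)ˣ) ∈ R := h.kd.P5_le CK.neg_one_P5
  have e1 : (-h.ck.eU⁻¹ : (𝓞 K)ˣ) = (-1) * h.ck.eU⁻¹ := by simp
  rw [e1] at h2
  have key : h.ck.zU^m ∈ R := by
    apply mem_of_pow R h.P5R (a := 14) (by norm_num)
    have : (h.ck.zU^m)^14 = (((h.ck.zU ^ 2) ^ m * (-1 * h.ck.eU⁻¹) ^ b * E ^ 5) ^ 3 * ((h.ck.zU ^ m * h.ck.eU ^ b * e ^ 5)^2) ^ 4) *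
      ((((-1)^b)⁻¹)^3 * ((h.ck.eU^b)⁻¹)^5 * ((E^3)⁻¹)^5 * ((e^8)⁻¹)^5) := by
      have z2 : (h.ck.zU^2)^m = (h.ck.zU^m)^2 := by rw [← zpow_natCast, ← zpow_natCast, zpow_comm]
      rw [z2, mul_zpow, inv_zpow]
      generalize h.ck.zU^m = A
      generalize h.ck.eU^b = B
      generalize ((-1 : (𝓞 K)ˣ))^b = C
      exact mid1 A B C E e
    rw [this]
    refine R.mul_mem h2 (R.mul_mem (R.mul_mem (R.mul_mem ?_ ?_) ?_) ?_)
    · exact R.pow_mem (R.inv_mem (R.zpow_mem hneg _)) _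
    · exact h.P5R _
    · exact h.P5R _
    · exact h.P5R _
  refine ⟨b, ?_⟩
  have : h.ck.zU ^ m * h.ck.eU ^ b * e ^ 5 * (h.ck.eU ^ b)⁻¹ = h.ck.zU^m * e^5 := by
    rw [mul_assoc, mul_assoc, mul_comm (h.ck.eU ^ b), mul_assoc, inv_mul_cancel, mul_one]
  rw [this]
  exact R.mul_mem key (h.P5R e)
end LD
end St14

namespace St14
variable {K L : Type} [Field K] [NumberField K] [Field L] [NumberField L] [Algebra K L]
variable {z : 𝓞 K} {d : 𝓞 K ≃+* 𝓞 K} {σ : L ≃ₐ[K] L} {a : 𝓞 L} {δ : L ≃+* L} {N : ℕ}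
namespace LD

lemma tr0_overN (h : LD z d σ a δ N) {P : Ideal (𝓞 L)} (hP : Ram K P) (hc : OverN K N P) : tr0 δ (cl P) = 1 := by
  obtain ⟨q, hq, hqN, hc⟩ := hc
  exact h.cl_prod hq hqN hP hc

lemma tr0_fix {c : ClassGroup (𝓞 L)} (hd : cS δ c = c) : tr0 δ c = c^4 := by
  rw [tr0_apply, hd, hd, hd]; simp only [pow_succ, pow_zero, one_mul]

lemma zU_of_dvd (h : LD z d σ a δ N) {m : ℤ} (hm : 5 ∣ m) : h.ck.zU^m = 1 := by
  obtain ⟨t, rfl⟩ := hm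
  rw [zpow_mul]
  have := h.ck.zU5
  rw [show (5:ℤ) = ((5:ℕ):ℤ) by norm_num, zpow_natCast, this, one_zpow]

lemma R_le_nT (h : LD z d σ a δ N) {u : (𝓞 K)ˣ} (hu : u ∈ (nU K L).range) : u ∈ nT K L := nU_le_nT hu

lemma nT_of (h : LD z d σ a δ N) {u w : (𝓞 K)ˣ} (hu : u ∈ nT K L) (hw : u * w⁻¹ ∈ (nU K L).range) : w ∈ nT K L := by
  have := (nT K L).mul_mem ((nT K L).inv_mem (h.R_le_nT hw)) hu
  simpa using this

theorem W0 (h : LD z d σ a δ N) : ∃ v : ClassGroup (𝓞 L), ∀ c : ClassGroup (𝓞 L), c^5 = 1 → cS σ.toRingEquiv c = c → cS δ c = c →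
    c ∈ Subgroup.zpowers v := by
  haveI := h.ck.pid
  by_cases h25 : 25 ∣ N - 1
  · have key : ∀ c : ClassGroup (𝓞 L), ∀ u : (𝓞 K)ˣ, c^5 = 1 → cS δ c = c → Rel σ c u → u ∈ (nU K L).range → c = 1 := by
      intro c u h5 hd hr hu
      obtain ⟨m, hm, rfl⟩ := hr.strong h.kd hu
      have := ram_hom (K := K) (tr0 δ) ⊥ (fun P hP => (h.tr0_overN hP (h.ram_class25 h25 hP))) m hm
      rw [tr0_fix hd] at this
      exact mem_of_pow4 (H := ⊥) h5 this
    by_cases hex : ∃ c : ClassGroup (𝓞 L), c^5 = 1 ∧ cS σ.toRingEquiv c = c ∧ cS δ c = c ∧ c ≠ 1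
    swap
    · refine ⟨1, fun c h5 hs hd => ?_⟩
      by_cases hc : c = 1
      · rw [hc]; exact Subgroup.one_mem _
      · exact absurd ⟨c, h5, hs, hd, hc⟩ hex
    obtain ⟨c0, h50, hs0, hd0, hc0⟩ := hex
    refine ⟨c0, fun c h5 hs hd => ?_⟩
    obtain ⟨u0, hu0, hr0⟩ := Rel.exists_of hs0
    obtain ⟨u, hu, hr⟩ := Rel.exists_of hs
    obtain ⟨m0, hm0⟩ := h.W0_unit h50 hd0 hr0
    obtain ⟨m, hm⟩ := h.W0_unit h5 hd hr
    have n0 : ¬ 5 ∣ m0 := by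
      intro hc
      rw [h.zU_of_dvd hc, inv_one, mul_one] at hm0
      exact hc0 (key _ _ h50 hd0 hr0 hm0)
    obtain ⟨k, hk⟩ : ∃ k : ℕ, 5 ∣ m + k * m0 := by
      have hmm : m0 % 5 = 1 ∨ m0 % 5 = 2 ∨ m0 % 5 = 3 ∨ m0 % 5 = 4 := by omega
      have hm5 : m % 5 = 0 ∨ m % 5 = 1 ∨ m % 5 = 2 ∨ m % 5 = 3 ∨ m % 5 = 4 := by omega
      rcases hmm with q | q | q | q <;> rcases hm5 with w | w | w | w | w <;>
        first
        | exact ⟨0, by push_cast; omega⟩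
        | exact ⟨1, by push_cast; omega⟩
        | exact ⟨2, by push_cast; omega⟩
        | exact ⟨3, by push_cast; omega⟩
        | exact ⟨4, by push_cast; omega⟩
    have hr' := hr.mul (hr0.pow k)
    have e := key _ _ (by rw [mul_pow, h5, ← pow_mul, mul_comm k, pow_mul, h50, one_pow, one_mul]) (by rw [map_mul, map_pow, hd, hd0]) hr' (by
      have e1 : u * u0^k = (u * (h.ck.zU^m)⁻¹) * (u0 * (h.ck.zU^m0)⁻¹)^k * (h.ck.zU^(m + k * m0)) := by
        rw [zpow_add, mul_comm (k : ℤ), zpow_mul, zpow_natCast, mul_pow, inv_pow]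
        generalize h.ck.zU^m = A
        generalize h.ck.zU^m0 = B
        rw [show u * A⁻¹ * (u0^k * (B^k)⁻¹) * (A * B^k) = u * u0^k * (A⁻¹ * A) * ((B^k)⁻¹ * B^k) by
          simp only [mul_assoc, mul_comm, mul_left_comm], inv_mul_cancel, inv_mul_cancel, mul_one, mul_one]
      rw [e1, h.zU_of_dvd hk, mul_one]
      exact Subgroup.mul_mem _ hm (Subgroup.pow_mem _ hm0 _))
    rw [eq_inv_of_mul_eq_one_left e]
    exact Subgroup.inv_mem _ (Subgroup.pow_mem _ (Subgroup.mem_zpowers _) _)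
  · obtain ⟨v, hv⟩ : ∃ v : ClassGroup (𝓞 L), ∀ P, Ram K P → P.comap (algebraMap (𝓞 K) (𝓞 L)) = Ideal.span {1 - z} → cl P = v := by
      by_cases hex : ∃ P, Ram K P ∧ P.comap (algebraMap (𝓞 K) (𝓞 L)) = Ideal.span {1 - z}
      · obtain ⟨P, hP, hc⟩ := hex
        exact ⟨cl P, fun Q hQ hcQ => by rw [ram_unique hQ hP (hcQ.trans hc.symm)]⟩
      · exact ⟨1, fun P hP hc => absurd ⟨P, hP, hc⟩ hex⟩
    refine ⟨v, fun c h5 hs hd => ?_⟩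
    obtain ⟨u, hu, hr⟩ := Rel.exists_of hs
    obtain ⟨m, hm⟩ := h.W0_unit h5 hd hr
    rw [h.zU_of_dvd (h.zeta_nT h25 (h.nT_of hu hm)), inv_one, mul_one] at hm
    obtain ⟨m, hm, rfl⟩ := hr.strong h.kd hm
    have := ram_hom (K := K) (tr0 δ) (Subgroup.zpowers v) (fun P hP => ?_) m hm
    · rw [tr0_fix hd] at this
      exact mem_of_pow4 h5 this
    · rcases h.ram_class hP with hc | hc
      · rw [tr0_fix (h.lam_fix hP hc), hv P hP hc]
        exact Subgroup.pow_mem _ (Subgroup.mem_zpowers _) _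
      · rw [h.tr0_overN hP hc]; exact Subgroup.one_mem _

lemma tr1_d (h : LD z d σ a δ N) {c : ClassGroup (𝓞 L)} (h5 : c^5 = 1) : tr1 δ (cS δ c) = tr1 δ c ^ 2 := by
  rw [tr1_apply, tr1_apply, h.cS4]
  have k1 : (cS δ c)^5 = 1 := by rw [← map_pow, h5, map_one]
  have k2 : (cS δ (cS δ c))^5 = 1 := by rw [← map_pow, k1, map_one]
  simp only [mul_pow, ← pow_mul]
  norm_num
  rw [pow_mod k1 6, pow_mod k2 8]
  norm_num
  simp only [mul_assoc, mul_comm, mul_left_comm]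

lemma overN_cases (h : LD z d σ a δ N) {π q : 𝓞 K} (hπ : Prime π) (hπN : π ∣ (N : 𝓞 K)) (hq : Prime q) (hqN : q ∣ (N : 𝓞 K)) :
    Ideal.span {q} = Ideal.span {π} ∨ Ideal.span {q} = Ideal.span {d π} ∨ Ideal.span {q} = Ideal.span {d (d π)} ∨
      Ideal.span {q} = Ideal.span {d (d (d π))} := by
  have hs := h.ck.split h.hN h.hN1 hπ hπN
  have hp := primeK_span hq
  have h1 : Ideal.span {q} ∣ Ideal.span {(N : 𝓞 K)} := by
    rw [Ideal.dvd_span_singleton, Ideal.mem_span_singleton]; exact hqN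
  rw [hs] at h1
  have p1 := CK.d_prime (d := d) hπ
  have p2 := CK.d_prime (d := d) p1
  have p3 := CK.d_prime (d := d) p2
  rcases hp.dvd_or_dvd h1 with h1 | h1
  · rcases hp.dvd_or_dvd h1 with h1 | h1
    · rcases hp.dvd_or_dvd h1 with h1 | h1
      · exact Or.inl (prime_dvd_prime_eq hp (primeK_span hπ) h1)
      · exact Or.inr (Or.inl (prime_dvd_prime_eq hp (primeK_span p1) h1))
    · exact Or.inr (Or.inr (Or.inl (prime_dvd_prime_eq hp (primeK_span p2) h1)))
  · exact Or.inr (Or.inr (Or.inr (prime_dvd_prime_eq hp (primeK_span p3) h1)))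

theorem W1 (h : LD z d σ a δ N) (he : h.ck.eU ∉ nT K L) : ∃ v : ClassGroup (𝓞 L), ∀ c : ClassGroup (𝓞 L), c^5 = 1 → cS σ.toRingEquiv c = c →
    cS δ c = c^2 → c ∈ Subgroup.zpowers v := by
  haveI := h.ck.pid
  obtain ⟨π, hπ, hπN⟩ := h.ck.exists_prime h.hN
  obtain ⟨P0, hP0, hc0⟩ := h.exists_ram hπ hπN
  refine ⟨tr1 δ (cl P0), fun c h5 hs hd => ?_⟩
  obtain ⟨u, hu, hr⟩ := Rel.exists_of hs
  obtain ⟨b, hb⟩ := h.W1_unit h5 hd hr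
  have h5b : 5 ∣ b := by
    by_contra hc
    exact he (mem_of_zpow (nT K L) (fun g => h.R_le_nT (h.P5R g)) hc (h.nT_of hu hb))
  have hu' : u ∈ (nU K L).range := by
    obtain ⟨t, rfl⟩ := h5b
    have := (nU K L).range.mul_mem hb (h.P5R (h.ck.eU^t))
    rw [mul_comm (5:ℤ), zpow_mul, show (5:ℤ) = ((5:ℕ):ℤ) by norm_num, zpow_natCast, mul_assoc, inv_mul_cancel, mul_one] at this
    exact this
  obtain ⟨m, hm, rfl⟩ := hr.strong h.kd hu'
  have := ram_hom (K := K) (tr1 δ) (Subgroup.zpowers (tr1 δ (cl P0))) (fun P hP => ?_) m hm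
  · rw [tr1_apply (cl m.prod), hd, map_pow, hd, map_pow, map_pow, hd] at this
    apply mem_of_pow4 h5
    have e : ∀ c : ClassGroup (𝓞 L), c * (c ^ 2) ^ 3 * ((c ^ 2) ^ 2) ^ 4 * (((c ^ 2) ^ 2) ^ 2) ^ 2 = c^39 := by
      intro c; simp only [← pow_mul, ← pow_add, ← pow_succ']
    rw [e, pow_mod h5] at this
    exact this
  · have k5 := h.ram_pow hP
    have k50 := h.ram_pow hP0
    rcases h.ram_class hP with hc | ⟨q, hq, hqN, hc⟩
    · have e := h.lam_fix hP hc
      have : tr1 δ (cl P) = 1 := by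
        rw [tr1_apply, e, e, e]
        have e : ∀ c : ClassGroup (𝓞 L), c * c ^ 3 * c ^ 4 * c ^ 2 = c^10 := by
          intro c; simp only [← pow_add, ← pow_succ']
        rw [e, pow_mod k5]; norm_num
      rw [this]; exact Subgroup.one_mem _
    · have r1 := h.ram_d hP0
      have r2 := h.ram_d r1
      have r3 := h.ram_d r2
      have c1 := h.comap_d hc0
      have c2 := h.comap_d c1
      have c3 := h.comap_d c2
      have q1 : (cS δ (cl P0))^5 = 1 := by rw [← map_pow, k50, map_one]
      have q2 : (cS δ (cS δ (cl P0)))^5 = 1 := by rw [← map_pow, q1, map_one]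
      have n0 : P0 ≠ 0 := hP0.2.1
      rcases h.overN_cases hπ hπN hq hqN with e | e | e | e
      · rw [ram_unique hP hP0 (by rw [hc, e, hc0])]; exact Subgroup.mem_zpowers _
      · rw [ram_unique hP r1 (by rw [hc, e, c1]), ← cS_cl _ n0, h.tr1_d k50]
        exact Subgroup.pow_mem _ (Subgroup.mem_zpowers _) _
      · rw [ram_unique hP r2 (by rw [hc, e, c2]), ← cS_cl _ r1.2.1, ← cS_cl _ n0, h.tr1_d q1, h.tr1_d k50]
        exact Subgroup.pow_mem _ (Subgroup.pow_mem _ (Subgroup.mem_zpowers _) _) _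
      · rw [ram_unique hP r3 (by rw [hc, e, c3]), ← cS_cl _ r2.2.1, ← cS_cl _ r1.2.1, ← cS_cl _ n0, h.tr1_d q2, h.tr1_d q1, h.tr1_d k50]
        exact Subgroup.pow_mem _ (Subgroup.pow_mem _ (Subgroup.pow_mem _ (Subgroup.mem_zpowers _) _) _) _
end LD
end St14

namespace St14
variable {K L : Type} [Field K] [NumberField K] [Field L] [NumberField L] [Algebra K L]
variable {z : 𝓞 K} {d : 𝓞 K ≃+* 𝓞 K} {σ : L ≃ₐ[K] L} {a : 𝓞 L} {δ : L ≃+* L} {N : ℕ}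

/-- integers of `K` which are norms from `L` -/
def NS (K L : Type) [Field K] [NumberField K] [Field L] [NumberField L] [Algebra K L] (k : 𝓞 K) : Prop :=
  ∃ x : L, Algebra.norm K x = (k : K)

namespace LD
lemma NS_mul {k l : 𝓞 K} (hk : NS K L k) (hl : NS K L l) : NS K L (k * l) := by
  obtain ⟨x, hx⟩ := hk
  obtain ⟨y, hy⟩ := hl
  exact ⟨x * y, by rw [map_mul, hx, hy]; push_cast; rfl⟩
lemma NS_pow {k : 𝓞 K} (hk : NS K L k) (n : ℕ) : NS K L (k^n) := by
  obtain ⟨x, hx⟩ := hk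
  exact ⟨x^n, by rw [map_pow, hx]; push_cast; rfl⟩
lemma NS_p5 (h : LD z d σ a δ N) (k : 𝓞 K) : NS K L (k^5) :=
  ⟨algebraMap K L k, by rw [Algebra.norm_algebraMap, h.kd.h5]; push_cast; rfl⟩
lemma NS_cancel (h : LD z d σ a δ N) {k l : 𝓞 K} (hk : NS K L (k * l)) (hl : NS K L l) (h0 : l ≠ 0) : NS K L k := by
  obtain ⟨x, hx⟩ := hk
  obtain ⟨y, hy⟩ := hl
  have hl : (l : K) ≠ 0 := by exact_mod_cast h0
  have hy0 : y ≠ 0 := by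
    rintro rfl
    rw [Algebra.norm_zero] at hy
    exact hl hy.symm
  refine ⟨x / y, ?_⟩
  have : Algebra.norm K (x / y) * Algebra.norm K y = Algebra.norm K x := by
    rw [← map_mul, div_mul_cancel₀ _ hy0]
  rw [hy, hx] at this
  push_cast at this
  exact mul_right_cancel₀ hl this
lemma NS_d (h : LD z d σ a δ N) {k : 𝓞 K} (hk : NS K L k) : NS K L (d k) := by
  obtain ⟨x, hx⟩ := hk
  exact ⟨δ x, h.normL_d hx⟩
lemma NS_of_pow (h : LD z d σ a δ N) {k : 𝓞 K} (h0 : k ≠ 0) {n : ℕ} (hn : ¬ 5 ∣ n) (hk : NS K L (k^n)) : NS K L k := by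
  obtain ⟨s, t, hst⟩ : ∃ s t : ℕ, n * s = 5 * t + 1 := by
    have : n % 5 = 1 ∨ n % 5 = 2 ∨ n % 5 = 3 ∨ n % 5 = 4 := by omega
    rcases this with q | q | q | q
    · exact ⟨1, n * 1 / 5, by omega⟩
    · exact ⟨3, n * 3 / 5, by omega⟩
    · exact ⟨2, n * 2 / 5, by omega⟩
    · exact ⟨4, n * 4 / 5, by omega⟩
  have h1 := NS_pow hk s
  rw [← pow_mul, hst, pow_succ', mul_comm 5, pow_mul] at h1
  exact h.NS_cancel h1 (h.NS_p5 _) (pow_ne_zero _ (pow_ne_zero _ h0))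

lemma neg_triv (hV : ∀ c : ClassGroup (𝓞 L), c^5 = 1 → cS δ c = c⁻¹ → c = 1) (k : ℕ) :
    ∀ c : ClassGroup (𝓞 L), c^(5^k) = 1 → cS δ c = c⁻¹ → c = 1 := by
  induction k with
  | zero => intro c hc _; simpa using hc
  | succ k ih =>
    intro c hc hd
    apply ih c _ hd
    apply hV
    · rw [← pow_mul, ← pow_succ, hc]
    · rw [map_pow, hd, inv_pow]

theorem zz_norm (h : LD z d σ a δ N) (he : h.ck.eU ∈ nT K L) (hV : ∀ c : ClassGroup (𝓞 L), c^5 = 1 → cS δ c = c⁻¹ → c = 1)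
    {g : 𝓞 K} (hg : Prime g) (hgN : ¬ g ∣ (N : 𝓞 K)) (hgl : ¬ g ∣ 1 - z) (hF : F5 g (N : 𝓞 K)) : NS K L (zz d g) := by
  have p1 := CK.d_prime (d := d) hg
  have p2 := CK.d_prime (d := d) p1
  have p3 := CK.d_prime (d := d) p2
  have hz0 : zz d g ≠ 0 := by
    unfold zz
    exact mul_ne_zero (mul_ne_zero (mul_ne_zero hg.ne_zero (pow_ne_zero _ p1.ne_zero)) p2.ne_zero) (pow_ne_zero _ p3.ne_zero)
  obtain ⟨Q, hQ, hQ0, hQc, hQn⟩ := h.kd.exists_norm_prime rfl h.haK hg hgN hgl hF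
  have hQ0 : Q ≠ 0 := hQ0
  have n1 := iS_ne δ hQ0
  have n2 := iS_ne δ n1
  have n3 := iS_ne δ n2
  have m1 := h.nI_d hQn
  have m2 := h.nI_d m1
  have m3 := h.nI_d m2
  obtain ⟨e, H, hH, hcard⟩ := Nat.exists_eq_pow_mul_and_not_dvd (Nat.card_pos (α := ClassGroup (𝓞 L))).ne' 5 (by norm_num)
  set c := (cl Q)^H with hc
  have hc5 : c^(5^e) = 1 := by rw [hc, ← pow_mul, mul_comm, ← hcard, pow_card_eq_one']
  have hB : c * (cS δ c)⁻¹ * cS δ (cS δ c) * (cS δ (cS δ (cS δ c)))⁻¹ = 1 := by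
    apply neg_triv hV e
    · simp only [mul_pow, inv_pow, ← map_pow, hc5, map_one, inv_one, mul_one]
    · simp only [map_mul, map_inv, h.cS4, mul_inv, inv_inv]
      simp only [mul_assoc, mul_comm, mul_left_comm]
  have hB2 : c * cS δ (cS δ c) = cS δ c * cS δ (cS δ (cS δ c)) := by
    rw [← div_eq_one, ← hB, div_eq_mul_inv, mul_inv]
    simp only [mul_assoc, mul_comm, mul_left_comm]
  have e1 : c * cS δ (cS δ c) = cl ((Q * iS δ (iS δ Q))^H) := by
    rw [cl_pow (mul_ne_zero hQ0 n2), cl_mul hQ0 n2, mul_pow, hc, map_pow, map_pow, cS_cl _ hQ0, cS_cl _ n1]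
  have e2 : cS δ c * cS δ (cS δ (cS δ c)) = cl ((iS δ Q * iS δ (iS δ (iS δ Q)))^H) := by
    rw [cl_pow (mul_ne_zero n1 n3), cl_mul n1 n3, mul_pow, hc, map_pow, map_pow, map_pow, cS_cl _ hQ0, cS_cl _ n1, cS_cl _ n2]
  rw [e1, e2, cl_eq (pow_ne_zero _ (mul_ne_zero hQ0 n2)) (pow_ne_zero _ (mul_ne_zero n1 n3))] at hB2
  obtain ⟨x, y, hx, hy, hxy⟩ := hB2
  have hn := congrArg (Ideal.relNorm (𝓞 K)) hxy
  simp only [map_mul, map_pow, hQn, m1, m2, m3, Ideal.relNorm_singleton, Ideal.span_singleton_mul_span_singleton,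
    Ideal.span_singleton_pow, Ideal.span_singleton_eq_span_singleton] at hn
  obtain ⟨u, hu⟩ := hn
  have cn : ∀ x : 𝓞 L, ((Algebra.intNorm (𝓞 K) (𝓞 L) x : 𝓞 K) : K) = Algebra.norm K (x : L) := fun x =>
    Algebra.algebraMap_intNorm (A := 𝓞 K) (K := K) (L := L) (B := 𝓞 L) x
  have nsx : ∀ x : 𝓞 L, NS K L (Algebra.intNorm (𝓞 K) (𝓞 L) x) := fun x => ⟨x, (cn x).symm⟩
  set nx := Algebra.intNorm (𝓞 K) (𝓞 L) x
  set ny := Algebra.intNorm (𝓞 K) (𝓞 L) y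
  have nx0 : nx ≠ 0 := by
    intro h0
    have := cn x
    rw [show Algebra.intNorm (𝓞 K) (𝓞 L) x = 0 from h0] at this
    have h1 := Algebra.norm_eq_zero_iff.1 (this.symm.trans (by simp))
    exact hx (by exact_mod_cast h1)
  have k1 : NS K L ((zz d g)^H * u) := by
    apply h.NS_cancel (l := nx) _ (nsx x) nx0
    have : (zz d g)^H * u * nx = ny * ((d g * d (d (d g)))^H)^5 := by
      calc (zz d g)^H * u * nx = (nx * (g * d (d g))^H * u) * ((d g * d (d (d g)))^H)^4 := by
            unfold zz; simp only [mul_pow]; ring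
        _ = _ := by rw [hu]; ring
    rw [this]
    exact NS_mul (nsx y) (h.NS_p5 _)
  obtain ⟨m, b, e', rfl⟩ := h.ck.unit_form u
  have ne : ∀ b : ℤ, NS K L ((h.ck.eU^b : (𝓞 K)ˣ) : 𝓞 K) := fun b => (nT K L).zpow_mem he b
  have k2 : NS K L ((zz d g)^H * ((h.ck.zU^m : (𝓞 K)ˣ) : 𝓞 K)) := by
    apply h.NS_cancel (l := ((h.ck.eU^b * e'^5 : (𝓞 K)ˣ) : 𝓞 K)) _ _ (Units.ne_zero _)
    · rw [mul_assoc, ← Units.val_mul, ← mul_assoc]; exact k1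
    · rw [Units.val_mul]
      refine NS_mul (ne b) ?_
      rw [Units.val_pow_eq_pow_val]
      exact h.NS_p5 _
  have k3 := h.NS_d (h.NS_d k2)
  have dz : d (d (zz d g)) = zz d g := by
    unfold zz; simp only [map_mul, map_pow, h.ck.d4]; ring
  have du : d (d ((h.ck.zU^m : (𝓞 K)ˣ) : 𝓞 K)) = ((h.ck.zU^(4*m) : (𝓞 K)ˣ) : 𝓞 K) := by
    have : Units.map (d : 𝓞 K →* 𝓞 K) (Units.map (d : 𝓞 K →* 𝓞 K) (h.ck.zU^m)) = h.ck.zU^(4*m) := by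
      rw [map_zpow, map_zpow, h.ck.d_zU, map_pow, h.ck.d_zU, ← pow_mul, zpow_mul]
      norm_num
    rw [← this]; rfl
  rw [map_mul, map_mul, map_pow, map_pow, dz, du] at k3
  have k4 := NS_mul k2 k3
  apply h.NS_of_pow hz0 (n := H + H) (by omega)
  have : zz d g ^ H * ((h.ck.zU^m : (𝓞 K)ˣ) : 𝓞 K) * (zz d g ^ H * ((h.ck.zU^(4*m) : (𝓞 K)ˣ) : 𝓞 K)) = zz d g ^ (H + H) := by
    have : ((h.ck.zU^m : (𝓞 K)ˣ) : 𝓞 K) * ((h.ck.zU^(4*m) : (𝓞 K)ˣ) : 𝓞 K) = 1 := by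
      rw [← Units.val_mul, ← zpow_add, h.zU_of_dvd ⟨m, by ring⟩, Units.val_one]
    rw [pow_add]
    linear_combination zz d g ^ H * zz d g ^ H * this
  rwa [this] at k4

theorem final_F5 (h : LD z d σ a δ N) (he : h.ck.eU ∈ nT K L) (hV : ∀ c : ClassGroup (𝓞 L), c^5 = 1 → cS δ c = c⁻¹ → c = 1)
    {p : ℕ} (hp : p.Prime) (hp4 : p % 5 = 4) (hp25 : p % 25 ≠ 24) {g : 𝓞 K} (hg : Prime g) (hgp : g ∣ (p : 𝓞 K))
    {π : 𝓞 K} (hπ : Prime π) (hπN : π ∣ (N : 𝓞 K)) : F5 g (vp d π) := by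
  have hN1 := h.hN1
  have hpN : p ≠ N := by rintro rfl; omega
  have hgN : ¬ g ∣ (N : 𝓞 K) := by
    intro hc
    have := h.ck.prime_int hp hg hgp (n := (N : ℤ)) (by exact_mod_cast hc)
    exact hpN ((Nat.prime_dvd_prime_iff_eq hp h.hN).1 (by exact_mod_cast this))
  have hF : F5 g (N : 𝓞 K) := by
    apply h.ck.fifth_of_pow hp hp4
    haveI := Fact.mk hp
    have h1 : (p : ℤ) ∣ (N : ℤ)^p - N := by
      rw [← ZMod.intCast_zmod_eq_zero_iff_dvd _ p]
      push_cast
      rw [ZMod.pow_card, sub_self]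
    obtain ⟨t, ht⟩ := h1
    have h2 : (N : 𝓞 K)^p - N = p * t := by exact_mod_cast congrArg (Int.cast : ℤ → 𝓞 K) ht
    rw [h2]
    exact Dvd.dvd.mul_right hgp _
  have hzz := h.zz_norm he hV hg hgN (h.ck.not_dvd_lam hp (by rintro rfl; omega) hg hgp) hF
  refine T_layer h.ck hp hp4 hp25 hg hgp h.hN h.hN1 hπ hπN ?_
  have key : ∀ q, Prime q → q ∣ (N : 𝓞 K) → F5 q (zz d g) ∧ F5 q (eps z) := by
    intro q hq hqN
    obtain ⟨P, hP, hc⟩ := h.exists_ram hq hqN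
    have nd : ∀ g', g' ∣ (p : 𝓞 K) → ¬ q ∣ g' := by
      intro g' hg' hc
      have := h.ck.prime_int h.hN hq hqN (n := (p : ℤ)) (by exact_mod_cast hc.trans hg')
      exact hpN ((Nat.prime_dvd_prime_iff_eq h.hN hp).1 (by exact_mod_cast this)).symm
    have g1 := CK.d_dvd_nat (d := d) hgp
    have g2 := CK.d_dvd_nat (d := d) g1
    have g3 := CK.d_dvd_nat (d := d) g2
    obtain ⟨x, hx⟩ := hzz
    obtain ⟨y, hy⟩ := he
    constructor
    · refine h.kd.local_F5 h.ck hP hc ?_ hx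
      intro hd
      unfold zz at hd
      rcases hq.dvd_or_dvd hd with hd | hd
      · rcases hq.dvd_or_dvd hd with hd | hd
        · rcases hq.dvd_or_dvd hd with hd | hd
          · exact nd _ hgp hd
          · exact nd _ g1 (hq.dvd_of_dvd_pow hd)
        · exact nd _ g2 hd
      · exact nd _ g3 (hq.dvd_of_dvd_pow hd)
    · exact h.kd.local_F5 h.ck hP hc (fun hd => hq.not_unit (isUnit_of_dvd_unit hd h.ck.eps_unit)) hy
  have n1 := CK.d_dvd_nat (d := d) hπN
  have n2 := CK.d_dvd_nat (d := d) n1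
  have n3 := CK.d_dvd_nat (d := d) n2
  have p1 := CK.d_prime (d := d) hπ
  have p2 := CK.d_prime (d := d) p1
  have p3 := CK.d_prime (d := d) p2
  rintro q (rfl | rfl | rfl | rfl)
  · exact key _ hπ hπN
  · exact key _ p1 n1
  · exact key _ p2 n2
  · exact key _ p3 n3
end LD
end St14

namespace St14
open Module
variable {K L : Type} [Field K] [NumberField K] [Field L] [NumberField L] [Algebra K L]
variable {z : 𝓞 K} {d : 𝓞 K ≃+* 𝓞 K} {σ : L ≃ₐ[K] L} {a : 𝓞 L} {δ : L ≃+* L} {N : ℕ}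
namespace LD

lemma g5_eig {G : Type} [CommGroup G] (f : G →* G) (k : ℕ) (v : V5 G) :
    v ∈ End.eigenspace (f5 f) (k : ZMod 5) ↔ f (g5 v) = g5 v ^ k := by
  rw [End.mem_eigenspace_iff]
  constructor
  · intro h; rw [← g5_f5, h, g5_nsmul]
  · intro h; apply g5_inj; rw [g5_f5, h, g5_nsmul]

lemma n4 {V : Type} [AddCommGroup V] [Module (ZMod 5) V] {s : End (ZMod 5) V} (hs : 1 + s + s^2 + s^3 + s^4 = 0) : (s - 1)^4 = 0 := by
  have : (s - 1)^4 = (1 + s + s^2 + s^3 + s^4) - 5 * (s + s^3 - s^2) := by noncomm_ring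
  rw [this, hs, five_end, sub_zero]

lemma s_sum (h : LD z d σ a δ N) : 1 + f5 (cS σ.toRingEquiv) + f5 (cS σ.toRingEquiv)^2 + f5 (cS σ.toRingEquiv)^3 + f5 (cS σ.toRingEquiv)^4
    = (0 : End (ZMod 5) (V5 (ClassGroup (𝓞 L)))) := by
  haveI := h.ck.pid
  refine LinearMap.ext fun v => g5_inj ?_
  have := h.kd.cS_norm (g5 v)
  simp only [LinearMap.add_apply, g5_add, pow_succ, pow_zero, one_mul, Module.End.mul_apply, g5_f5, Module.End.one_apply]
  rw [this]; rfl

lemma d_comm (h : LD z d σ a δ N) : f5 (cS δ) * f5 (cS σ.toRingEquiv) = f5 (cS σ.toRingEquiv)^2 * f5 (cS δ) := by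
  refine LinearMap.ext fun v => g5_inj ?_
  simp only [pow_succ, pow_zero, one_mul, Module.End.mul_apply, g5_f5]
  exact h.cS_comm _

theorem rank12 (h : LD z d σ a δ N) :
    finrank (ZMod 5) (End.eigenspace (f5 (cS δ)) (1 : ZMod 5)) < finrank (ZMod 5) (V5 (ClassGroup (𝓞 L))) := by
  apply Submodule.finrank_lt
  intro htop
  obtain ⟨c, h5, hc⟩ := h.not_fix
  have : mk5 c h5 ∈ End.eigenspace (f5 (cS δ)) (1 : ZMod 5) := by rw [htop]; trivial
  have := (g5_eig (cS δ) 1 (mk5 c h5)).1 (by exact_mod_cast this)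
  rw [g5_mk, pow_one] at this
  exact hc this

theorem rank3 (h : LD z d σ a δ N) (hana : ∀ π : 𝓞 K, Prime π → π ∣ (N : 𝓞 K) → ∃ p : ℕ, p.Prime ∧ p % 5 = 4 ∧ p % 25 ≠ 24 ∧
    ∃ g : 𝓞 K, Prime g ∧ g ∣ (p : 𝓞 K) ∧ ¬ F5 g (vp d π))
    (h3 : 3 ≤ finrank (ZMod 5) (End.eigenspace (f5 (cS δ)) (1 : ZMod 5))) : 6 ≤ finrank (ZMod 5) (V5 (ClassGroup (𝓞 L))) := by
  by_contra hcon
  set s := f5 (cS σ.toRingEquiv) with hs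
  set D := f5 (cS δ) with hD
  have hn : (s - 1)^4 = 0 := n4 h.s_sum
  have hd : D * (s - 1) = (2 * (s - 1) + (s - 1)^2) * D := by
    have : (2 * (s - 1) + (s - 1)^2) * D = s^2 * D - D := by noncomm_ring
    rw [this, ← h.d_comm, mul_sub, mul_one]
  have ker : ∀ w, w ∈ LinearMap.ker (s - 1) → cS σ.toRingEquiv (g5 w) = g5 w := by
    intro w hw
    rw [LinearMap.mem_ker, LinearMap.sub_apply, sub_eq_zero] at hw
    have := congrArg g5 hw
    rwa [hs, g5_f5] at this
  obtain ⟨h2, h4⟩ := la_main hn hd h3 (by omega) (by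
    obtain ⟨v, hv⟩ := h.W0
    refine finrank_le_one_of_zpowers _ v fun w hw => hv _ (g5_pow w) (ker w hw.2) ?_
    have := (g5_eig (cS δ) 1 w).1 (by exact_mod_cast hw.1)
    rwa [pow_one] at this)
  have he : h.ck.eU ∈ nT K L := by
    by_contra he
    obtain ⟨v, hv⟩ := h.W1 he
    have := finrank_le_one_of_zpowers (End.eigenspace D 2 ⊓ LinearMap.ker (s - 1)) v fun w hw => hv _ (g5_pow w) (ker w hw.2)
      ((g5_eig (cS δ) 2 w).1 (by exact_mod_cast hw.1))
    omega
  have hV : ∀ c : ClassGroup (𝓞 L), c^5 = 1 → cS δ c = c⁻¹ → c = 1 := by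
    intro c h5 hc
    have : mk5 c h5 ∈ End.eigenspace D 4 := by
      have := (g5_eig (cS δ) 4 (mk5 c h5)).2 (by
        rw [g5_mk, hc]
        rw [inv_eq_iff_mul_eq_one, ← pow_succ', h5])
      exact_mod_cast this
    rw [h4, Submodule.mem_bot] at this
    rw [← g5_mk c h5, this, g5_zero]
  obtain ⟨π, hπ, hπN⟩ := h.ck.exists_prime h.hN
  obtain ⟨p, hp, hp4, hp25, g, hg, hgp, hnot⟩ := hana π hπ hπN
  exact hnot (h.final_F5 he hV hp hp4 hp25 hg hgp hπ hπN)
end LD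
end St14

namespace St14
section
variable {R : Type} [Field R] [NumberField R]

noncomputable def an (R : Type) [Field R] [NumberField R] (n : ℕ) : ℕ := Nat.card {I : Ideal (𝓞 R) // Ideal.absNorm I = n}

lemma fin_norm (n : ℕ) (hn : n ≠ 0) : Finite {I : Ideal (𝓞 R) // Ideal.absNorm I = n} :=
  (Ideal.finite_setOf_absNorm_eq n).to_subtype

lemma finset_le (x : ℝ) (hs : Summable fun n : ℕ => (an R n : ℝ) / (n : ℝ)^x) (U : Finset (Ideal (𝓞 R))) (hU : ∀ I ∈ U, I ≠ ⊥) :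
    ∑ I ∈ U, 1 / (Ideal.absNorm I : ℝ)^x ≤ ∑' n : ℕ, (an R n : ℝ) / (n : ℝ)^x := by
  classical
  refine le_trans ?_ (hs.sum_le_tsum (U.image Ideal.absNorm) (fun n _ => by positivity))
  rw [← Finset.sum_fiberwise_of_maps_to (s := U) (t := U.image Ideal.absNorm) (g := Ideal.absNorm)
    (fun I hI => Finset.mem_image_of_mem _ hI)]
  refine Finset.sum_le_sum fun n hn => ?_
  have h1 : ∀ I ∈ U.filter (fun I => Ideal.absNorm I = n), 1 / (Ideal.absNorm I : ℝ)^x = 1 / (n : ℝ)^x := by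
    intro I hI
    rw [(Finset.mem_filter.1 hI).2]
  rw [Finset.sum_congr rfl h1, Finset.sum_const, nsmul_eq_mul, mul_one_div]
  have hn0 : n ≠ 0 := by
    obtain ⟨I, hI, rfl⟩ := Finset.mem_image.1 hn
    exact fun h0 => hU I hI (Ideal.absNorm_eq_zero_iff.1 h0)
  gcongr
  unfold an
  haveI := fin_norm (R := R) n hn0
  have e : (U.filter (fun I => Ideal.absNorm I = n)).card = Nat.card {I // I ∈ U.filter (fun I => Ideal.absNorm I = n)} := by rw [Nat.card_eq_fintype_card, Fintype.card_coe]
  rw [e]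
  exact Nat.card_le_card_of_injective (fun I => ⟨I.1, (Finset.mem_filter.1 I.2).2⟩) (fun I J hIJ => by
    apply Subtype.ext
    exact congrArg (fun x : {I : Ideal (𝓞 R) // Ideal.absNorm I = n} => x.1) hIJ)

lemma prod_le (x : ℝ) (hs : Summable fun n : ℕ => (an R n : ℝ) / (n : ℝ)^x) (Q : Finset (Ideal (𝓞 R))) (hQ : ∀ I ∈ Q, Prime I) :
    ∏ P ∈ Q, (1 + 1 / (Ideal.absNorm P : ℝ)^x) ≤ ∑' n : ℕ, (an R n : ℝ) / (n : ℝ)^x := by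
  classical
  have inj : Set.InjOn (fun U : Finset (Ideal (𝓞 R)) => ∏ P ∈ U, P) (Q.powerset : Set _) := by
    intro U hU V hV h
    have f : ∀ W ∈ Q.powerset, UniqueFactorizationMonoid.normalizedFactors (∏ P ∈ W, P) = W.val := by
      intro W hW
      rw [Finset.prod_eq_multiset_prod, Multiset.map_id']
      exact UniqueFactorizationMonoid.normalizedFactors_prod_of_prime (fun P hP => hQ P (Finset.mem_powerset.1 hW hP))
    have := f U hU
    simp only at h
    rw [h, f V hV] at this
    exact Finset.val_inj.1 this.symm
  have := finset_le x hs (Q.powerset.image (fun U => ∏ P ∈ U, P)) (by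
    intro I hI
    obtain ⟨U, hU, rfl⟩ := Finset.mem_image.1 hI
    exact Finset.prod_ne_zero_iff.2 (fun P hP => (hQ P (Finset.mem_powerset.1 hU hP)).ne_zero))
  rw [Finset.sum_image inj] at this
  refine le_trans (le_of_eq ?_) this
  simp_rw [add_comm (1:ℝ)]
  rw [Finset.prod_add_one]
  refine Finset.sum_congr rfl fun U hU => ?_
  rw [map_prod, Nat.cast_prod, ← Real.finset_prod_rpow _ _ (fun _ _ => Nat.cast_nonneg _)]
  simp
end

section
variable (w : ℕ → Prop) [DecidablePred w]
noncomputable def GG (x : ℝ) : ℝ := ∑' n : ℕ, if w n then 1 / (n : ℝ)^x else 0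
noncomputable def AA (x : ℝ) : ℝ := ∑' n : ℕ, if w n then Real.log n / (n : ℝ)^x else 0

variable {w}
lemma G_summable {x : ℝ} (hx : 1 < x) : Summable fun n : ℕ => if w n then 1 / (n : ℝ)^x else 0 := by
  refine Summable.of_nonneg_of_le (fun n => ?_) (fun n => ?_) (Real.summable_one_div_nat_rpow.2 hx)
  · split_ifs <;> positivity
  · split_ifs <;> [exact le_rfl; positivity]

lemma step2 (hw0 : ∀ n, w n → n ≠ 0) {x x' : ℝ} (hx' : 1 < x') (hxx : x' < x) (hA : Summable fun n : ℕ => if w n then Real.log n / (n : ℝ)^x else 0) :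
    GG w x + (x - x') * AA w x ≤ GG w x' := by
  unfold GG AA
  rw [← tsum_mul_left, ← (G_summable (hx'.trans hxx)).tsum_add (hA.mul_left _)]
  refine Summable.tsum_le_tsum (fun n => ?_) ((G_summable (hx'.trans hxx)).add (hA.mul_left _)) (G_summable hx')
  split_ifs with h
  · have hn : (0:ℝ) < n := by exact_mod_cast Nat.pos_of_ne_zero (hw0 n h)
    have e : (1:ℝ) / (n:ℝ)^x' = (n:ℝ)^(x - x') / (n:ℝ)^x := by
      rw [Real.rpow_sub hn]; field_simp
    rw [e, ← mul_div_assoc, ← add_div]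
    gcongr
    rw [Real.rpow_def_of_pos hn]
    have := Real.add_one_le_exp (Real.log n * (x - x'))
    linarith
  · simp

lemma log_bound {t : ℝ} (ht : 0 ≤ t) : Real.exp (t - t^2) ≤ 1 + t := by
  have h1 : (1 + t) * Real.exp (t^2 - t) ≥ (1 + t) * (1 + (t^2 - t)) := by
    have := Real.add_one_le_exp (t^2 - t)
    gcongr; linarith
  have h2 : (1 + t) * (1 + (t^2 - t)) ≥ 1 := by
    have : 0 ≤ t^3 := by positivity
    nlinarith
  have h3 : Real.exp (t - t^2) * Real.exp (t^2 - t) = 1 := by rw [← Real.exp_add]; simp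
  have h4 := Real.exp_pos (t^2 - t)
  nlinarith
end
end St14

namespace St14
section
open ArithmeticFunction ArithmeticFunction.vonMangoldt LSeries

def wa (B : ℕ) (a : ZMod 25) (n : ℕ) : Prop := n.Prime ∧ (n : ZMod 25) = a ∧ B < n
def SS : Finset (ZMod 25) := {4, 9, 14, 19}
def ww (B : ℕ) (n : ℕ) : Prop := n.Prime ∧ (n : ZMod 25) ∈ SS ∧ B < n

open Classical in
lemma wa_le (B : ℕ) (a : ZMod 25) (x : ℝ) (n : ℕ) :
    (if wa B a n then Real.log n / (n : ℝ)^x else 0) ≤ residueClass a n / (n : ℝ)^x := by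
  have h0 := residueClass_nonneg a n
  split_ifs with h
  · gcongr
    have : residueClass a n = vonMangoldt n := by simp [residueClass, Set.indicator_apply, h.2.1]
    rw [this, vonMangoldt_apply_prime h.1]
  · positivity

lemma rc_sum (a : ZMod 25) {x : ℝ} (hx : 1 < x) : Summable fun n : ℕ => residueClass a n / (n : ℝ)^x :=
  summable_real_of_abscissaOfAbsConv_lt <|
        (abscissaOfAbsConv_residueClass_le_one a).trans_lt <| mod_cast hx

open Classical in
lemma wa_sum (B : ℕ) (a : ZMod 25) {x : ℝ} (hx : 1 < x) : Summable fun n : ℕ => if wa B a n then Real.log n / (n : ℝ)^x else 0 := by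
  refine Summable.of_nonneg_of_le (fun n => ?_) (fun n => wa_le B a x n) (rc_sum a hx)
  split_ifs
  · have := Real.log_natCast_nonneg n
    positivity
  · exact le_rfl

open Classical in
lemma wa_bound (B : ℕ) (a : ZMod 25) (ha : IsUnit a) : ∃ C : ℝ, ∀ x ∈ Set.Ioc (1:ℝ) 2,
    (1/20) / (x - 1) - C ≤ AA (wa B a) x := by
  obtain ⟨C, hC⟩ := LSeries_residueClass_lower_bound ha
  have hE : Summable fun n : ℕ => (if n.Prime then 0 else residueClass a n) / (n:ℝ) + (if n ≤ B then vonMangoldt n else 0) := by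
    refine (summable_residueClass_non_primes_div a).add ?_
    refine summable_of_ne_finset_zero (s := Finset.range (B+1)) (fun n hn => ?_)
    rw [if_neg]
    intro h
    exact hn (Finset.mem_range.2 (by omega))
  refine ⟨C + ∑' n : ℕ, ((if n.Prime then 0 else residueClass a n) / (n:ℝ) + (if n ≤ B then vonMangoldt n else 0)), fun x hx => ?_⟩
  have h1 := hC hx
  have e : ((Nat.totient 25 : ℕ) : ℝ)⁻¹ = 1/20 := by
    have : Nat.totient 25 = 20 := by decide
    rw [this]; norm_num
  rw [e] at h1
  have h2 : ∑' n, residueClass a n / (n : ℝ) ^ x ≤ AA (wa B a) x + ∑' n : ℕ, ((if n.Prime then 0 else residueClass a n) / (n:ℝ) + (if n ≤ B then vonMangoldt n else 0)) := by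
    unfold AA
    rw [← (wa_sum B a hx.1).tsum_add hE]
    refine Summable.tsum_le_tsum (fun n => ?_) (rc_sum a hx.1) ((wa_sum B a hx.1).add hE)
    have h0 := residueClass_nonneg a n
    have h0' : 0 ≤ vonMangoldt n := vonMangoldt_nonneg
    rcases n.eq_zero_or_pos with rfl | hn
    · simp [wa]
    have hp1 : (n:ℝ) ≤ (n:ℝ)^x := by
      conv_lhs => rw [← Real.rpow_one n]
      exact Real.rpow_le_rpow_of_exponent_le (by exact_mod_cast hn) hx.1.le
    have hn' : (1:ℝ) ≤ n := by exact_mod_cast hn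
    have hL : 0 ≤ Real.log n / (n:ℝ)^x := by
      have := Real.log_natCast_nonneg n
      positivity
    by_cases hp : n.Prime
    · by_cases hm : (n : ZMod 25) = a
      · have hr : residueClass a n = vonMangoldt n := by simp [residueClass, Set.indicator_apply, hm]
        by_cases hB : n ≤ B
        · rw [if_pos hp, if_pos hB, if_neg (fun h => absurd h.2.2 (by omega)), hr]
          have : vonMangoldt n / (n:ℝ)^x ≤ vonMangoldt n := div_le_self h0' (hn'.trans hp1)
          simpa using this
        · rw [if_pos hp, if_neg hB, if_pos ⟨hp, hm, by omega⟩, hr, vonMangoldt_apply_prime hp]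
          simp
      · have hr : residueClass a n = 0 := by simp [residueClass, Set.indicator_apply, hm]
        rw [hr]
        simp only [zero_div, ite_self, zero_add]
        split_ifs <;> positivity
    · rw [if_neg hp, if_neg (fun h => hp h.1)]
      have : residueClass a n / (n:ℝ)^x ≤ residueClass a n / (n:ℝ) := div_le_div_of_nonneg_left h0 (by positivity) hp1
      split_ifs <;> linarith
  linarith

open Classical in
lemma ww_eq (B n : ℕ) (t : ℝ) : (if ww B n then t else 0) = ∑ a ∈ SS, if wa B a n then t else 0 := by
  by_cases h : n.Prime ∧ B < n
  · have : ∀ a ∈ SS, (if wa B a n then t else 0) = if (n : ZMod 25) = a then t else 0 := by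
      intro a _
      simp [wa, h]
    rw [Finset.sum_congr rfl this, Finset.sum_ite_eq]
    simp [ww, h]
  · rw [if_neg (fun hh => h ⟨hh.1, hh.2.2⟩), Finset.sum_eq_zero]
    intro a _
    rw [if_neg (fun hh => h ⟨hh.1, hh.2.2⟩)]

open Classical in
lemma ww_sum (B : ℕ) {x : ℝ} (hx : 1 < x) : Summable fun n : ℕ => if ww B n then Real.log n / (n : ℝ)^x else 0 := by
  simp_rw [ww_eq]
  exact summable_sum (fun a _ => wa_sum B a hx)

open Classical in
lemma ww_bound (B : ℕ) : ∃ C : ℝ, ∀ x ∈ Set.Ioc (1:ℝ) 2, (1/5) / (x - 1) - C ≤ AA (ww B) x := by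
  have hu : ∀ a ∈ SS, IsUnit a := by
    intro a ha
    have : ∃ b, a * b = 1 := by revert a; decide
    obtain ⟨b, hb⟩ := this
    exact IsUnit.of_mul_eq_one b hb
  have : ∀ a : ZMod 25, ∃ C : ℝ, a ∈ SS → ∀ x ∈ Set.Ioc (1:ℝ) 2, (1/20) / (x - 1) - C ≤ AA (wa B a) x := by
    intro a
    by_cases h : a ∈ SS
    · obtain ⟨C, hC⟩ := wa_bound B a (hu a h)
      exact ⟨C, fun _ => hC⟩
    · exact ⟨0, fun h' => absurd h' h⟩
  choose C hC using this
  refine ⟨∑ a ∈ SS, C a, fun x hx => ?_⟩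
  have e : AA (ww B) x = ∑ a ∈ SS, AA (wa B a) x := by
    unfold AA
    simp_rw [ww_eq]
    exact Summable.tsum_finsetSum (fun a _ => wa_sum B a hx.1)
  rw [e]
  have := Finset.sum_le_sum (fun a ha => hC a ha x hx)
  refine le_trans (le_of_eq ?_) this
  rw [Finset.sum_sub_distrib, Finset.sum_const]
  have : SS.card = 4 := by decide
  rw [this]
  ring
end

section
open Classical in
lemma GG_lower (B : ℕ) : ∃ C : ℝ, ∀ k : ℕ, (k:ℝ)/10 - C ≤ GG (ww B) (1 + (1/2)^k) := by
  obtain ⟨C, hC⟩ := ww_bound B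
  have st : ∀ k : ℕ, GG (ww B) (1 + (1/2)^k) + 1/10 - |C| * (1/2)^(k+1) ≤ GG (ww B) (1 + (1/2)^(k+1)) := by
    intro k
    have p0 : (0:ℝ) < (1/2)^k := by positivity
    have p1 : ((1:ℝ)/2)^k ≤ 1 := pow_le_one₀ (by norm_num) (by norm_num)
    have h1 := hC (1 + (1/2)^k) ⟨by linarith, by linarith⟩
    have h2 := step2 (w := ww B) (fun n hn => hn.1.ne_zero) (x := 1 + (1/2)^k) (x' := 1 + (1/2)^(k+1))
      (by rw [pow_succ]; linarith) (by rw [pow_succ]; linarith) (ww_sum B (by linarith))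
    rw [pow_succ] at h2 ⊢
    have h3 : (1 + ((1:ℝ)/2)^k - (1 + (1/2)^k * (1/2))) = (1/2)^k * (1/2) := by ring
    rw [h3] at h2
    have h4 := mul_le_mul_of_nonneg_left h1 (by positivity : (0:ℝ) ≤ (1/2)^k * (1/2))
    have h5 : ((1:ℝ)/2)^k * (1/2) * ((1/5) / (1 + (1/2)^k - 1) - C) = 1/10 - C * ((1/2)^k * (1/2)) := by
      rw [add_sub_cancel_left]
      field_simp
      ring
    rw [h5] at h4
    have h6 : C * (((1:ℝ)/2)^k * (1/2)) ≤ |C| * ((1/2)^k * (1/2)) := by gcongr; exact le_abs_self C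
    linarith
  have h0 : 0 ≤ GG (ww B) 2 := by
    unfold GG
    refine tsum_nonneg fun n => ?_
    split_ifs <;> positivity
  have : ∀ k : ℕ, (k:ℝ)/10 - |C| * (1 - (1/2)^k) ≤ GG (ww B) (1 + (1/2)^k) := by
    intro k
    induction k with
    | zero =>
      have e : (1:ℝ) + (1/2)^0 = 2 := by norm_num
      rw [e]; simpa using h0
    | succ k ih =>
      have := st k
      push_cast
      rw [pow_succ] at this ⊢
      linarith
  refine ⟨|C|, fun k => le_trans ?_ (this k)⟩
  have := abs_nonneg C
  have p0 : (0:ℝ) < (1/2)^k := by positivity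
  nlinarith

variable {R : Type} [Field R] [NumberField R]

open Classical in
lemma exp_le (B : ℕ) (hB : ∀ p, ww B p → ∃ s : Finset (Ideal (𝓞 R)), s.card = 10 ∧ ∀ P ∈ s, Prime P ∧ Ideal.absNorm P = p)
   {x : ℝ} (hx : 1 < x) (hs : Summable fun n : ℕ => (an R n : ℝ) / (n : ℝ)^x) :
   Real.exp (10 * GG (ww B) x - 10 * ∑' n : ℕ, 1 / (n:ℝ)^(2:ℝ)) ≤ ∑' n : ℕ, (an R n : ℝ) / (n : ℝ)^x := by
  have hs2 : Summable fun n : ℕ => 1 / (n:ℝ)^(2:ℝ) := Real.summable_one_div_nat_rpow.2 (by norm_num)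
  have key : ∀ u : Finset ℕ, 10 * (∑ n ∈ u, if ww B n then 1 / (n:ℝ)^x else 0) - 10 * ∑' n : ℕ, 1 / (n:ℝ)^(2:ℝ) ≤
      Real.log (∑' n : ℕ, (an R n : ℝ) / (n : ℝ)^x) := by
    intro u
    choose! s hs1 hs2' using hB
    have hp := prod_le x hs ((u.filter (ww B)).biUnion s) (fun P hP => by
      obtain ⟨p, hp, hP⟩ := Finset.mem_biUnion.1 hP
      exact (hs2' p (Finset.mem_filter.1 hp).2 P hP).1)
    rw [Finset.prod_biUnion (by
      intro p hp q hq hpq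
      refine Finset.disjoint_left.2 fun P hP hQ => hpq ?_
      rw [← (hs2' p (Finset.mem_filter.1 hp).2 P hP).2, (hs2' q (Finset.mem_filter.1 hq).2 P hQ).2])] at hp
    have e1 : ∀ p ∈ u.filter (ww B), ∏ P ∈ s p, (1 + 1 / (Ideal.absNorm P : ℝ)^x) = (1 + 1/(p:ℝ)^x)^10 := by
      intro p hp
      rw [Finset.prod_congr rfl (fun P hP => by rw [(hs2' p (Finset.mem_filter.1 hp).2 P hP).2]), Finset.prod_const, hs1 p (Finset.mem_filter.1 hp).2]
    rw [Finset.prod_congr rfl e1] at hp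
    have hpos : 0 < ∏ p ∈ u.filter (ww B), (1 + 1/(p:ℝ)^x)^10 := Finset.prod_pos (fun p _ => by positivity)
    rw [Real.le_log_iff_exp_le (hpos.trans_le hp)]
    refine le_trans ?_ hp
    have h1 : 10 * (∑ n ∈ u, if ww B n then 1 / (n:ℝ)^x else 0) - 10 * ∑' n : ℕ, 1 / (n:ℝ)^(2:ℝ) ≤
       ∑ n ∈ u.filter (ww B), 10 * (1/(n:ℝ)^x - (1/(n:ℝ)^x)^2) := by
      rw [← Finset.mul_sum, Finset.sum_sub_distrib, ← Finset.sum_filter, ← mul_sub]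
      gcongr
      refine le_trans ?_ (hs2.sum_le_tsum (u.filter (ww B)) (fun n _ => by positivity))
      refine Finset.sum_le_sum fun n hn => ?_
      have hn1 : (1:ℝ) ≤ n := by exact_mod_cast (Finset.mem_filter.1 hn).2.1.one_lt.le
      rw [div_pow, one_pow]
      have : (n:ℝ)^(2:ℝ) ≤ ((n:ℝ)^x)^2 := by
        rw [Real.rpow_two]
        gcongr
        conv_lhs => rw [← Real.rpow_one n]
        exact Real.rpow_le_rpow_of_exponent_le hn1 hx.le
      gcongr
    refine le_trans (Real.exp_le_exp.2 h1) ?_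
    rw [Real.exp_sum]
    refine Finset.prod_le_prod (fun _ _ => (Real.exp_pos _).le) (fun n _ => ?_)
    have := log_bound (t := 1/(n:ℝ)^x) (by positivity)
    have e : Real.exp (10 * (1/(n:ℝ)^x - (1/(n:ℝ)^x)^2)) = Real.exp (1/(n:ℝ)^x - (1/(n:ℝ)^x)^2)^10 := by
      rw [← Real.exp_nat_mul]; norm_num
    rw [e]
    gcongr
  have hpos : 0 < ∑' n : ℕ, (an R n : ℝ) / (n : ℝ)^x := by
    have := prod_le x hs ∅ (by simp)
    simp only [Finset.prod_empty] at this
    linarith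
  rw [← Real.le_log_iff_exp_le hpos]
  have hG : GG (ww B) x ≤ (Real.log (∑' n : ℕ, (an R n : ℝ) / (n : ℝ)^x) + 10 * ∑' n : ℕ, 1 / (n:ℝ)^(2:ℝ)) / 10 := by
    refine (G_summable hx).tsum_le_of_sum_le fun u => ?_
    have := key u
    linarith
  linarith

lemma zeta_eq {x : ℝ} (hx1 : 1 < x) : dedekindZeta R (x:ℂ) = ((∑' n : ℕ, (an R n : ℝ) / (n : ℝ)^x : ℝ) : ℂ) := by
  unfold dedekindZeta LSeries
  rw [Complex.ofReal_tsum]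
  refine tsum_congr fun n => ?_
  rcases eq_or_ne n 0 with rfl | hn
  · simp [Real.zero_rpow (by linarith : x ≠ 0)]
  · rw [LSeries.term_of_ne_zero hn]
    push_cast
    rw [Complex.ofReal_cpow (Nat.cast_nonneg _)]
    simp [an]

theorem ana (B : ℕ) (hB : ∀ p, ww B p → ∃ s : Finset (Ideal (𝓞 R)), s.card = 10 ∧ ∀ P ∈ s, Prime P ∧ Ideal.absNorm P = p) : False := by
  classical
  obtain ⟨C, hC⟩ := GG_lower B
  have hr := dedekindZeta_residue_pos R
  set ρ := dedekindZeta_residue R with hρ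
  have p0 : ∀ k : ℕ, (0:ℝ) < (1/2)^k := fun k => by positivity
  have t1 : Filter.Tendsto (fun k : ℕ => (1:ℝ) + (1/2)^k) Filter.atTop (nhdsWithin 1 (Set.Ioi 1)) := by
    refine tendsto_nhdsWithin_iff.2 ⟨?_, Filter.Eventually.of_forall fun k => ?_⟩
    · have := (tendsto_pow_atTop_nhds_zero_of_lt_one (r := (1:ℝ)/2) (by norm_num) (by norm_num)).const_add 1
      simpa using this
    · have := p0 k
      simp
  have t2 := (Complex.continuous_re.tendsto _).comp ((tendsto_sub_one_mul_dedekindZeta_nhdsGT R).comp t1)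
  have t3 : Filter.Tendsto (fun k : ℕ => ((1:ℝ)/2)^k * ∑' n : ℕ, (an R n : ℝ) / (n : ℝ)^((1:ℝ) + (1/2)^k)) Filter.atTop (nhds ρ) := by
    refine t2.congr fun k => ?_
    have h1 : (1:ℝ) < 1 + (1/2)^k := by linarith [p0 k]
    simp only [Function.comp]
    rw [zeta_eq h1]
    have : ((((1:ℝ) + (1/2)^k : ℝ) : ℂ) - 1) = (((1/2)^k : ℝ) : ℂ) := by push_cast; ring
    rw [this, ← Complex.ofReal_mul, Complex.ofReal_re]
  set D := ∑' n : ℕ, 1 / (n:ℝ)^(2:ℝ) with hD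
  have e1 : (1:ℝ) < Real.exp 1 / 2 := by
    have := Real.exp_one_gt_d9
    linarith
  have ev1 := t3.eventually (lt_mem_nhds hr)
  have ev2 := t3.eventually (gt_mem_nhds (lt_add_one ρ))
  have ev3 := (tendsto_pow_atTop_atTop_of_one_lt e1).eventually (Filter.eventually_gt_atTop ((ρ + 1) * Real.exp (10 * C + 10 * D)))
  obtain ⟨k, h1, h2, h3⟩ := (ev1.and (ev2.and ev3)).exists
  have hs : Summable fun n : ℕ => (an R n : ℝ) / (n : ℝ)^((1:ℝ) + (1/2)^k) := by
    by_contra hh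
    rw [tsum_eq_zero_of_not_summable hh, mul_zero] at h1
    exact lt_irrefl _ h1
  have h4 := exp_le B hB (by linarith [p0 k]) hs
  have h5 : Real.exp ((k:ℝ) - (10 * C + 10 * D)) ≤ Real.exp (10 * GG (ww B) (1 + (1/2)^k) - 10 * D) := by
    apply Real.exp_le_exp.2
    have := hC k
    linarith
  have h6 := h5.trans h4
  rw [Real.exp_sub, div_le_iff₀ (Real.exp_pos _)] at h6
  have h7 : Real.exp (k:ℝ) = Real.exp 1 ^ k := by rw [← Real.exp_nat_mul]; simp
  rw [h7] at h6
  rw [div_pow] at h3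
  have h8 := mul_le_mul_of_nonneg_left h6 (p0 k).le
  have h9 : ((1:ℝ)/2)^k * Real.exp 1 ^ k = Real.exp 1 ^ k / 2^k := by rw [div_pow]; ring
  rw [h9, ← mul_assoc] at h8
  have h10 := mul_lt_mul_of_pos_right h2 (Real.exp_pos (10 * C + 10 * D))
  linarith
end
end St14

namespace St14
namespace CK
variable {K : Type} [Field K] [NumberField K] {z : 𝓞 K} {d : 𝓞 K ≃+* 𝓞 K}

lemma p_sqf (h : CK z d) {p : ℕ} (hp : p.Prime) (hp4 : p % 5 = 4) : Squarefree (p : 𝓞 K) := by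
  haveI := h.pid
  intro x hx
  by_contra hu
  have hp0 : (p : 𝓞 K) ≠ 0 := by exact_mod_cast hp.ne_zero
  have hx0 : x ≠ 0 := by
    rintro rfl
    rw [mul_zero, zero_dvd_iff] at hx
    exact hp0 hx
  obtain ⟨q, hq, hqx⟩ := WfDvdMonoid.exists_irreducible_factor hu hx0
  have hq' : Prime q := hq.prime
  have hqq : q * q ∣ (p : 𝓞 K) := (mul_dvd_mul hqx hqx).trans hx
  have hqp : q ∣ (p : 𝓞 K) := (dvd_mul_right q q).trans hqq
  have h1 := hqq.trans (h.frob_four hp hp4 q)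
  have h2 : q * q ∣ q^p := by rw [← pow_two]; exact pow_dvd_pow q hp.two_le
  have h3 : q * q ∣ d (d q) := (dvd_sub_right h2).1 h1
  have h4 : d (d q) ∣ q := assoc_of_dvd hq' (d_prime (d_prime hq')) (h.dvd_four hp hp4 hq' hqp)
  have h5 := h3.trans h4
  have h6 : q * q ∣ q * 1 := by simpa using h5
  exact hq'.not_unit (isUnit_of_dvd_one ((mul_dvd_mul_iff_left hq'.ne_zero).1 h6))

lemma p_dvd (h : CK z d) {p : ℕ} (hp : p.Prime) (hp4 : p % 5 = 4) {X : 𝓞 K}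
    (hX : ∀ g : 𝓞 K, Prime g → g ∣ (p : 𝓞 K) → g ∣ X) : (p : 𝓞 K) ∣ X := by
  haveI := h.pid
  obtain ⟨g, hg, hgp⟩ := h.exists_prime hp
  obtain ⟨n, hn⟩ := h.norm_int g
  have h1 : (p : ℤ) ∣ n := h.prime_int hp hg hgp (by rw [← hn, mul_assoc, mul_assoc]; exact dvd_mul_right _ _)
  have h2 : (p : 𝓞 K) ∣ (n : 𝓞 K) := by
    obtain ⟨t, rfl⟩ := h1
    push_cast
    exact dvd_mul_right _ _
  have g1 := CK.d_dvd_nat (d := d) hgp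
  have g2 := CK.d_dvd_nat (d := d) g1
  have g3 := CK.d_dvd_nat (d := d) g2
  have q1 := d_prime (d := d) hg
  have q2 := d_prime (d := d) q1
  have q3 := d_prime (d := d) q2
  have h3 : (p : 𝓞 K) ∣ X^4 := by
    refine h2.trans ?_
    rw [← hn, show X^4 = X * X * X * X by ring]
    exact mul_dvd_mul (mul_dvd_mul (mul_dvd_mul (hX _ hg hgp) (hX _ q1 g1)) (hX _ q2 g2)) (hX _ q3 g3)
  exact (h.p_sqf hp hp4).isRadical 4 X h3

lemma v_pow (h : CK z d) {p : ℕ} (hp : p.Prime) (hp4 : p % 5 = 4) {v : 𝓞 K} {n : ℤ} (hv : v * d (d v) = (n : 𝓞 K)^5)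
    (hn : ¬ (p : ℤ) ∣ n) (hF : ∀ g : 𝓞 K, Prime g → g ∣ (p : 𝓞 K) → F5 g v) : (p : 𝓞 K) ∣ v^((p+1)/5) - n := by
  refine h.p_dvd hp hp4 fun g hg hgp => ?_
  obtain ⟨k, hk⟩ := hF g hg hgp
  have hng : ¬ g ∣ (n : 𝓞 K) := fun hc => hn (h.prime_int hp hg hgp hc)
  let q : 𝓞 K →+* 𝓞 K ⧸ Ideal.span {g} := Ideal.Quotient.mk _
  have hq : ∀ x y : 𝓞 K, q x = q y ↔ g ∣ x - y := fun x y => by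
    rw [Ideal.Quotient.mk_eq_mk_iff_sub_mem, Ideal.mem_span_singleton]
  have hq0 : ∀ x, q x = 0 ↔ g ∣ x := fun x => by
    rw [Ideal.Quotient.eq_zero_iff_mem, Ideal.mem_span_singleton]
  haveI : (Ideal.span {g}).IsPrime := (Ideal.span_singleton_prime hg.ne_zero).2 hg
  rw [← hq]
  have e1 : q v = q k ^5 := by rw [← map_pow]; exact (hq _ _).2 hk
  have e2 : q k ^ p = q (d (d k)) := by rw [← map_pow]; exact (hq _ _).2 (hgp.trans (h.frob_four hp hp4 k))
  have e3 : q (d (d v)) = q (d (d k))^5 := by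
    rw [← map_pow, ← map_pow, ← map_pow]
    refine (hq _ _).2 ?_
    rw [← map_sub, ← map_sub]
    exact (h.dvd_four hp hp4 hg hgp).trans (d_dvd.2 (d_dvd.2 hk))
  obtain ⟨s, hs⟩ : ∃ s, p = 5 * s + 4 := ⟨p / 5, by omega⟩
  have e4 : (p+1)/5 = s + 1 := by omega
  set m := k * d (d k) with hm
  have e5 : q (v^((p+1)/5)) = q m := by
    rw [map_pow, e1, e4, ← pow_mul, hm, map_mul, ← e2, show 5 * (s+1) = p + 1 by omega, pow_succ, mul_comm]
  rw [e5]
  have e6 : q m ^ p = q m := by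
    rw [← map_pow]
    refine (hq _ _).2 ?_
    have := hgp.trans (h.frob_four hp hp4 m)
    have em : d (d m) = m := by rw [hm]; simp only [map_mul, h.d4]; ring
    rwa [em] at this
  have e7 : q m ^ 5 = q n ^ 5 := by
    rw [hm, map_mul, mul_pow, ← e1, ← e3, ← map_mul, hv, map_pow]
  have e8 : q n ^ p = q n := by
    haveI := Fact.mk hp
    have h1 : (p : ℤ) ∣ n^p - n := by
      rw [← ZMod.intCast_zmod_eq_zero_iff_dvd _ p]
      push_cast
      rw [ZMod.pow_card, sub_self]
    obtain ⟨t, ht⟩ := h1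
    have h2 : (n : 𝓞 K)^p - n = p * t := by exact_mod_cast congrArg (Int.cast : ℤ → 𝓞 K) ht
    rw [← map_pow]
    refine (hq _ _).2 ?_
    rw [h2]
    exact Dvd.dvd.mul_right hgp _
  have n0 : q n ≠ 0 := fun hc => hng ((hq0 _).1 hc)
  have m0 : q m ≠ 0 := fun hc => by
    rw [hc] at e7
    exact n0 ((pow_eq_zero_iff (by norm_num : (5:ℕ) ≠ 0)).1 (e7.symm.trans (zero_pow (by norm_num))))
  -- x^(3 p) = x^2 * (x^5)^(3 s + 2)
  have e9 : ∀ x : 𝓞 K ⧸ Ideal.span {g}, x^p = x → x^3 = x^2 * (x^5)^(3*s+2) := by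
    intro x hx
    rw [← pow_mul, ← pow_add, show 2 + 5 * (3*s+2) = p * 3 by omega, pow_mul, hx]
  have e10 := e9 _ e6
  have e11 := e9 _ e8
  rw [e7] at e10
  have e12 : q n = (q n ^5)^(3*s+2) := mul_left_cancel₀ (pow_ne_zero 2 n0) (by rw [← e11]; ring)
  rw [← e12] at e10
  exact mul_left_cancel₀ (pow_ne_zero 2 m0) (by rw [← e10]; ring)

lemma vp_not (h : CK z d) {N : ℕ} (hN : N.Prime) (hN1 : N % 5 = 1) {π : 𝓞 K} (hπ : Prime π) (hπN : π ∣ (N : 𝓞 K)) (b : K) :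
    b^5 ≠ ((vp d π : 𝓞 K) : K) := by
  intro hb
  obtain ⟨b', hb'⟩ := nth_root_int hb
  have h1 : π ∣ b'^5 := by rw [hb']; unfold vp; rw [mul_assoc, mul_assoc]; exact dvd_mul_right _ _
  obtain ⟨c, hc⟩ := hπ.dvd_of_dvd_pow h1
  rw [hc] at hb'
  have h2 : π^4*c^5 = (d π)^2 * (d (d π))^4 * (d (d (d π)))^3 := by
    apply mul_left_cancel₀ hπ.ne_zero
    calc π * (π^4*c^5) = (π * c)^5 := by ring
      _ = _ := by rw [hb']; unfold vp; ring
  have h3 : π ∣ (d π)^2 * (d (d π))^4 * (d (d (d π)))^3 := by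
    rw [← h2, pow_succ', mul_assoc, ]; exact dvd_mul_right _ _
  rcases hπ.dvd_or_dvd h3 with h3 | h3
  · rcases hπ.dvd_or_dvd h3 with h3 | h3
    · exact h.ndvd1 hN hN1 hπ hπN (hπ.dvd_of_dvd_pow h3)
    · exact h.ndvd_one hN hN1 hπ hπN (hπ.dvd_of_dvd_pow h3)
  · exact h.ndvd3 hN hN1 hπ hπN (hπ.dvd_of_dvd_pow h3)

lemma vp_mul (h : CK z d) (π : 𝓞 K) : ∃ n : ℤ, vp d π * d (d (vp d π)) = (n : 𝓞 K)^5 := by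
  obtain ⟨n, hn⟩ := h.norm_int π
  refine ⟨n, ?_⟩
  rw [← hn]
  unfold vp; simp only [map_mul, map_pow, h.d4]; ring
end CK

/-- If Frobenius is trivial mod `p`, then `p` splits completely. -/
lemma split_of_frob {R : Type} [Field R] [NumberField R] {p : ℕ} (hp : p.Prime) (hx : ∀ x : 𝓞 R, (p : 𝓞 R) ∣ x^p - x) :
    ∃ s : Finset (Ideal (𝓞 R)), s.card = Module.finrank ℚ R ∧ ∀ P ∈ s, Prime P ∧ Ideal.absNorm P = p := by
  classical
  have hp0 : (p : 𝓞 R) ≠ 0 := by exact_mod_cast hp.ne_zero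
  set I : Ideal (𝓞 R) := Ideal.span {(p : 𝓞 R)} with hI
  have hI0 : I ≠ 0 := by simpa [hI, Ideal.zero_eq_bot, Ideal.span_singleton_eq_bot] using hp.ne_zero
  have hx' : ∀ x : 𝓞 R, x^p - x ∈ I := fun x => Ideal.mem_span_singleton.2 (hx x)
  have hsq : Squarefree I := by
    intro J hJ
    by_contra hu
    have hJ0 : J ≠ 0 := by
      rintro rfl
      rw [mul_zero, zero_dvd_iff] at hJ
      exact hI0 hJ
    obtain ⟨P, hP, hPJ⟩ := WfDvdMonoid.exists_irreducible_factor hu hJ0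
    have hP' : Prime P := hP.prime
    have h1 : P * P ∣ I := (mul_dvd_mul hPJ hPJ).trans hJ
    have h2 : P ≤ P * P := by
      intro x hxP
      have h3 : x^p ∈ P * P := by
        obtain ⟨m, hm⟩ : ∃ m, p = m + 2 := ⟨p - 2, by have := hp.two_le; omega⟩
        rw [hm, pow_add, pow_two]
        exact Ideal.mul_mem_left _ _ (Ideal.mul_mem_mul hxP hxP)
      have h4 := Ideal.le_of_dvd h1 (hx' x)
      have := sub_mem h3 h4
      simpa using this
    have h5 : P * P ∣ P * 1 := by rw [mul_one]; exact Ideal.dvd_iff_le.2 h2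
    exact hP'.not_unit (isUnit_of_dvd_one ((mul_dvd_mul_iff_left hP'.ne_zero).1 h5))
  have hnd := (UniqueFactorizationMonoid.squarefree_iff_nodup_normalizedFactors hI0).1 hsq
  have hIn : Ideal.absNorm I = p ^ Module.finrank ℚ R := by
    have : I = Ideal.span {((p : ℤ) : 𝓞 R)} := by rw [hI]; push_cast; rfl
    rw [hI, Ideal.absNorm_span_natCast, RingOfIntegers.rank]
  have hP : ∀ P ∈ UniqueFactorizationMonoid.normalizedFactors I, Prime P ∧ Ideal.absNorm P = p := by
    intro P hP
    have hP' := UniqueFactorizationMonoid.prime_of_normalized_factor P hP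
    refine ⟨hP', ?_⟩
    have hdvd := UniqueFactorizationMonoid.dvd_of_mem_normalizedFactors hP
    have h1 : Ideal.absNorm P ∣ p ^ Module.finrank ℚ R := by rw [← hIn]; exact Ideal.absNorm_dvd_absNorm_of_le (Ideal.le_of_dvd hdvd)
    obtain ⟨k, -, hk⟩ := (Nat.dvd_prime_pow hp).1 h1
    haveI hPp : P.IsPrime := Ideal.isPrime_of_prime hP'
    haveI hPm : P.IsMaximal := hPp.isMaximal hP'.ne_zero
    letI : Field (𝓞 R ⧸ P) := Ideal.Quotient.field P
    have h2 : Ideal.absNorm P ≤ p := by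
      rw [Ideal.absNorm_apply, Submodule.cardQuot_apply]
      have hf : Finite (𝓞 R ⧸ P) := Ideal.finiteQuotientOfFreeOfNeBot P hP'.ne_zero
      haveI := Fintype.ofFinite (𝓞 R ⧸ P)
      rw [Nat.card_eq_fintype_card]
      have hne : (X^p - X : (𝓞 R ⧸ P)[X]) ≠ 0 := FiniteField.X_pow_card_sub_X_ne_zero _ hp.one_lt
      have hsub : (Finset.univ : Finset (𝓞 R ⧸ P)) ⊆ (X^p - X : (𝓞 R ⧸ P)[X]).roots.toFinset := by
        intro x _
        rw [Multiset.mem_toFinset, mem_roots hne, IsRoot]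
        obtain ⟨y, rfl⟩ := Ideal.Quotient.mk_surjective x
        simp only [eval_sub, eval_pow, eval_X]
        rw [← map_pow, ← map_sub]
        exact Ideal.Quotient.eq_zero_iff_mem.2 (Ideal.le_of_dvd hdvd (hx' y))
      rw [← Finset.card_univ]
      refine (Finset.card_le_card hsub).trans ((Multiset.toFinset_card_le _).trans ((card_roots' _).trans ?_))
      rw [FiniteField.X_pow_card_sub_X_natDegree_eq _ hp.one_lt]
    have h3 : Ideal.absNorm P ≠ 1 := fun hc => hPp.ne_top (Ideal.absNorm_eq_one_iff.1 hc)
    rw [hk] at h2 h3 ⊢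
    have : k ≤ 1 := by
      have := (Nat.pow_le_pow_iff_right hp.one_lt (n := k) (m := 1)).1 (by simpa using h2)
      exact this
    interval_cases k
    · simp at h3
    · simp
  refine ⟨(UniqueFactorizationMonoid.normalizedFactors I).toFinset, ?_, fun P h => hP P (Multiset.mem_toFinset.1 h)⟩
  rw [Multiset.toFinset_card_of_nodup hnd]
  have h1 : (UniqueFactorizationMonoid.normalizedFactors I).prod = I :=
    associated_iff_eq.1 (UniqueFactorizationMonoid.prod_normalizedFactors hI0)
  have h2 := congrArg Ideal.absNorm h1
  rw [hIn, map_multiset_prod, Multiset.map_congr rfl (fun P h => (hP P h).2), Multiset.map_const', Multiset.prod_replicate] at h2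
  exact Nat.pow_right_injective hp.two_le h2
end St14

namespace St14
section
variable {K T M : Type} [Field K] [Field T] [Algebra K T] [Field M] {a : K} {y : T}

lemma kum_irr (ha : ∀ b : K, b^5 ≠ a) : Irreducible (X^5 - C a : K[X]) :=
  X_pow_sub_C_irreducible_of_prime (by norm_num : Nat.Prime 5) ha

lemma kum_equiv (ha : ∀ b : K, b^5 ≠ a) (h5 : Module.finrank K T = 5) (hy : y^5 = algebraMap K T a) :
    ∃ e : AdjoinRoot (X^5 - C a : K[X]) ≃ₐ[K] T, e (AdjoinRoot.root _) = y := by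
  have H := kum_irr ha
  haveI : Fact (Irreducible (X^5 - C a : K[X])) := ⟨H⟩
  have hf : (X^5 - C a : K[X]) ≠ 0 := H.ne_zero
  let f : AdjoinRoot (X^5 - C a : K[X]) →ₐ[K] T := AdjoinRoot.liftAlgHom _ (Algebra.ofId K T) y (by
    simp only [eval₂_sub, eval₂_pow, eval₂_X, eval₂_C]
    rw [hy]; simp [Algebra.ofId_apply])
  haveI : FiniteDimensional K T := Module.finite_of_finrank_pos (by omega)
  have hfr : Module.finrank K (AdjoinRoot (X^5 - C a : K[X])) = Module.finrank K T := by
    rw [(AdjoinRoot.powerBasis hf).finrank, AdjoinRoot.powerBasis_dim, natDegree_X_pow_sub_C, h5]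
  haveI : FiniteDimensional K (AdjoinRoot (X^5 - C a : K[X])) := Module.finite_of_finrank_pos (by omega)
  have hb : Function.Bijective f := by
    refine ⟨f.toRingHom.injective, ?_⟩
    exact (LinearMap.injective_iff_surjective_of_finrank_eq_finrank hfr (f := f.toLinearMap)).1 f.toRingHom.injective
  exact ⟨AlgEquiv.ofBijective f hb, by simp [f]⟩

lemma kum_ext (ha : ∀ b : K, b^5 ≠ a) (h5 : Module.finrank K T = 5) (hy : y^5 = algebraMap K T a)
    (φ : K →+* M) (t : M) (ht : t^5 = φ a) : ∃ τ : T →+* M, (∀ k, τ (algebraMap K T k) = φ k) ∧ τ y = t := by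
  obtain ⟨e, he⟩ := kum_equiv ha h5 hy
  let f : AdjoinRoot (X^5 - C a : K[X]) →+* M := AdjoinRoot.lift φ t (by simp [ht])
  refine ⟨f.comp (e.symm : T →+* _), fun k => ?_, ?_⟩
  · have : e.symm (algebraMap K T k) = AdjoinRoot.of _ k := by
      rw [AlgEquiv.commutes]; rfl
    change f (e.symm (algebraMap K T k)) = _
    rw [this]
    exact AdjoinRoot.lift_of _
  · change f (e.symm y) = _
    rw [← he, AlgEquiv.symm_apply_apply]
    exact AdjoinRoot.lift_root _

lemma kum_hom_ext (ha : ∀ b : K, b^5 ≠ a) (h5 : Module.finrank K T = 5) (hy : y^5 = algebraMap K T a)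
    {f g : T →+* M} (hk : ∀ k, f (algebraMap K T k) = g (algebraMap K T k)) (hfy : f y = g y) : f = g := by
  obtain ⟨e, he⟩ := kum_equiv ha h5 hy
  have : f.comp e.toAlgHom.toRingHom = g.comp e.toAlgHom.toRingHom := by
    apply AdjoinRoot.ringHom_ext
    · ext k
      have : e (AdjoinRoot.of _ k) = algebraMap K T k := e.commutes k
      change f (e _) = g (e _)
      rw [this, hk]
    · change f (e _) = g (e _)
      rw [he, hfy]
  ext x
  have h := congrArg (fun F => F (e.symm x)) this
  simpa using h

lemma kum_pb (ha : ∀ b : K, b^5 ≠ a) (h5 : Module.finrank K T = 5) (hy : y^5 = algebraMap K T a) :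
    ∃ B : PowerBasis K T, B.gen = y := by
  obtain ⟨e, he⟩ := kum_equiv ha h5 hy
  exact ⟨(AdjoinRoot.powerBasis (kum_irr ha).ne_zero).map e, by rw [PowerBasis.map_gen, AdjoinRoot.powerBasis_gen, he]⟩
end

section
variable {K T : Type} [Field K] [NumberField K] [Field T] [NumberField T] [Algebra K T] {a : K} {y : 𝓞 T}

lemma index_bound (ha : ∀ b : K, b^5 ≠ a) (h5 : Module.finrank K T = 5) (hy : (y:T)^5 = algebraMap K T a) :
    ∃ m : ℕ, m ≠ 0 ∧ ∀ x : 𝓞 T, ∃ x' ∈ Algebra.adjoin (𝓞 K) {y}, m * x = x' := by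
  obtain ⟨B, hB⟩ := kum_pb ha h5 hy
  haveI : FiniteDimensional K T := Module.finite_of_finrank_pos (by omega)
  have hintg : IsIntegral (𝓞 K) B.gen := by
    rw [hB]
    exact IsIntegral.tower_top (R := ℤ) y.2
  have hD : IsIntegral (𝓞 K) (Algebra.discr K B.basis) := Algebra.discr_isIntegral K (fun i => by
    rw [B.coe_basis]; exact hintg.pow _)
  obtain ⟨D, hD'⟩ := IsIntegrallyClosed.isIntegral_iff.1 hD
  have hD0 : D ≠ 0 := by
    rintro rfl
    exact Algebra.discr_not_zero_of_basis K B.basis (by rw [← hD', map_zero])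
  have hmem := Ideal.absNorm_mem (Ideal.span {D})
  obtain ⟨u, hu⟩ := Ideal.mem_span_singleton.1 hmem
  refine ⟨Ideal.absNorm (Ideal.span {D}), fun h0 => hD0 (by simpa using h0), fun x => ?_⟩
  have h1 := Algebra.discr_mul_isIntegral_mem_adjoin (R := 𝓞 K) K hintg (z := (x : T)) (IsIntegral.tower_top (R := ℤ) x.2)
  rw [hB, ← hD'] at h1
  have h2 : Algebra.adjoin (𝓞 K) {(y:T)} = (Algebra.adjoin (𝓞 K) {y}).map (IsScalarTower.toAlgHom (𝓞 K) (𝓞 T) T) := by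
    rw [AlgHom.map_adjoin, Set.image_singleton]; rfl
  rw [h2] at h1
  obtain ⟨x', hx', hxx⟩ := h1
  have h3 : x' = algebraMap (𝓞 K) (𝓞 T) D * x := by
    apply RingOfIntegers.ext
    change algebraMap (𝓞 T) T x' = algebraMap (𝓞 T) T _
    rw [map_mul]
    change algebraMap (𝓞 T) T x' = algebraMap K T (algebraMap (𝓞 K) K D) * _
    rw [← Algebra.smul_def]
    exact hxx
  refine ⟨algebraMap (𝓞 K) (𝓞 T) u * x', mul_mem (Subalgebra.algebraMap_mem _ _) hx', ?_⟩
  rw [h3, ← mul_assoc, ← map_mul, mul_comm u D, ← hu, map_natCast]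
end
end St14

namespace St14

lemma ww_mod {B p : ℕ} (h : ww B p) : p % 5 = 4 ∧ p % 25 ≠ 24 := by
  have h1 : ((p % 25 : ℕ) : ZMod 25) ∈ SS := by
    rw [ZMod.natCast_mod]; exact h.2.1
  have h2 : ∀ r < 25, ((r : ℕ) : ZMod 25) ∈ SS → r % 5 = 4 ∧ r ≠ 24 := by decide
  have := h2 (p % 25) (Nat.mod_lt _ (by norm_num)) h1
  omega

/-- Frobenius congruence from generators. -/
lemma frob_all {K T : Type} [Field K] [NumberField K] [Field T] [NumberField T] [Algebra K T]
    {p m : ℕ} (hp : p.Prime) (hpm : ¬ p ∣ m) (τ : 𝓞 T →+* 𝓞 T) {y : 𝓞 T} (hm : ∀ x : 𝓞 T, ∃ x' ∈ Algebra.adjoin (𝓞 K) {y}, m * x = x')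
    (hk : ∀ k : 𝓞 K, (p : 𝓞 T) ∣ (algebraMap (𝓞 K) (𝓞 T) k)^p - τ (algebraMap (𝓞 K) (𝓞 T) k)) (hy : (p : 𝓞 T) ∣ y^p - τ y) (x : 𝓞 T) :
    (p : 𝓞 T) ∣ x^p - τ x := by
  haveI := Fact.mk hp
  have key : ∀ x' ∈ Algebra.adjoin (𝓞 K) {y}, (p : 𝓞 T) ∣ x'^p - τ x' := by
    intro x' hx'
    induction hx' using Algebra.adjoin_induction with
    | mem x h => rw [Set.mem_singleton_iff.1 h]; exact hy
    | algebraMap r => exact hk r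
    | add a b _ _ ha hb =>
      obtain ⟨c, hc⟩ := exists_add_pow_prime_eq hp a b
      rw [hc, map_add]
      have : a^p + b^p + p * a * b * c - (τ a + τ b) = (a^p - τ a) + (b^p - τ b) + p * (a * b * c) := by ring
      rw [this]
      exact dvd_add (dvd_add ha hb) (dvd_mul_right _ _)
    | mul a b _ _ ha hb =>
      have : (a * b)^p - τ (a * b) = (a^p - τ a) * b^p + τ a * (b^p - τ b) := by rw [map_mul, mul_pow]; ring
      rw [this]
      exact dvd_add (ha.mul_right _) (hb.mul_left _)
  obtain ⟨x', hx', hxx⟩ := hm x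
  have h1 := key x' hx'
  rw [← hxx, map_mul, map_natCast, mul_pow] at h1
  have h2 : (p : 𝓞 T) ∣ (m : 𝓞 T)^p - m := by
    have h1 : (p : ℤ) ∣ (m : ℤ)^p - m := by
      rw [← ZMod.intCast_zmod_eq_zero_iff_dvd _ p]
      push_cast
      rw [ZMod.pow_card, sub_self]
    obtain ⟨t, ht⟩ := h1
    exact ⟨t, by exact_mod_cast congrArg (Int.cast : ℤ → 𝓞 T) ht⟩
  have h3 : (p : 𝓞 T) ∣ m * (x^p - τ x) := by
    have : (m : 𝓞 T) * (x^p - τ x) = (m^p * x^p - m * τ x) - (m^p - m) * x^p := by ring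
    rw [this]
    exact dvd_sub h1 (h2.mul_right _)
  have hc : IsCoprime (p : 𝓞 T) (m : 𝓞 T) := by
    have := (Nat.isCoprime_iff_coprime.2 ((Nat.Prime.coprime_iff_not_dvd hp).2 hpm)).map (Int.castRingHom (𝓞 T))
    simpa using this
  exact hc.dvd_of_dvd_mul_left h3

theorem CK.hana {K : Type} [Field K] [NumberField K] {z : 𝓞 K} {d : 𝓞 K ≃+* 𝓞 K} (h : CK z d) {N : ℕ} (hN : N.Prime) (hN1 : N % 5 = 1)
    {π : 𝓞 K} (hπ : Prime π) (hπN : π ∣ (N : 𝓞 K)) :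
    ∃ p : ℕ, p.Prime ∧ p % 5 = 4 ∧ p % 25 ≠ 24 ∧ ∃ g : 𝓞 K, Prime g ∧ g ∣ (p : 𝓞 K) ∧ ¬ F5 g (vp d π) := by
  by_contra! H
  obtain ⟨n, hn⟩ := h.vp_mul π
  have hv5 := h.vp_not hN hN1 hπ hπN
  set v := vp d π with hv
  obtain ⟨T, _, _, _, σ, y, hT, hy⟩ := exists_kummer h.hz h.hK hv5
  have hv0 : v ≠ 0 := by
    intro h0
    exact hv5 0 (by rw [h0]; simp)
  have hn0 : n ≠ 0 := by
    rintro rfl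
    have : v * d (d v) = 0 := by rw [hn]; simp
    rcases mul_eq_zero.1 this with h0 | h0
    · exact hv0 h0
    · exact hv0 (by simpa using h0)
  -- extend d to K
  let D : K ≃+* K := IsFractionRing.ringEquivOfRingEquiv d
  have hD : ∀ k : 𝓞 K, D (algebraMap (𝓞 K) K k) = algebraMap (𝓞 K) K (d k) := fun k =>
    IsFractionRing.ringEquivOfRingEquiv_algebraMap d k
  have hD4 : ∀ k : K, D (D (D (D k))) = k := by
    intro k
    obtain ⟨x, w, hw, rfl⟩ := IsFractionRing.div_surjective (A := 𝓞 K) k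
    simp only [_root_.map_div₀, hD, h.d4]
  have hy0 : y ≠ 0 := hT.hy0
  have hnT : (n : T) ≠ 0 := by exact_mod_cast hn0
  obtain ⟨τ, hτk, hτy⟩ := kum_ext hv5 hT.h5 hy ((algebraMap K T).comp (D.toRingHom.comp D.toRingHom)) (n / y) (by
    rw [div_pow, hy, div_eq_iff (by rw [← hy]; exact pow_ne_zero 5 hy0)]
    change _ = algebraMap K T (D (D _)) * _
    rw [hD, hD, ← map_mul, ← map_mul, mul_comm, hn]
    simp)
  have hτk' : ∀ k : K, τ (algebraMap K T k) = algebraMap K T (D (D k)) := hτk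
  have hττ : τ.comp τ = RingHom.id T := by
    refine kum_hom_ext hv5 hT.h5 hy (fun k => ?_) ?_
    · change τ (τ _) = _
      rw [hτk', hτk', hD4]; rfl
    · change τ (τ _) = y
      rw [hτy, _root_.map_div₀, hτy, map_intCast]
      field_simp
  have hττ' : ∀ x, τ (τ x) = x := fun x => congrArg (fun f : T →+* T => f x) hττ
  let τE : T ≃ₐ[ℚ] T := AlgEquiv.ofAlgHom τ.toRatAlgHom τ.toRatAlgHom (by ext x; exact hττ' x) (by ext x; exact hττ' x)
  have hτE : ∀ x, τE x = τ x := fun x => rfl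
  have hne : τE ≠ 1 := by
    intro hc
    have h1 : τE (algebraMap K T z) = algebraMap K T z := by rw [hc]; rfl
    rw [hτE, hτk', hD, hD, h.hd, map_pow, h.hd] at h1
    have h2 : (((z^2)^2 : 𝓞 K) : K) = z := (algebraMap K T).injective h1
    have h3 : (z^2)^2 = z := RingOfIntegers.ext h2
    have h4 : z^3 = 1 := by
      apply mul_right_cancel₀ h.zunit.ne_zero
      calc z^3 * z = (z^2)^2 := by ring
        _ = 1 * z := by rw [h3, one_mul]
    have := h.hzI.dvd_of_pow_eq_one 3 h4
    norm_num at this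
  have hord : orderOf τE = 2 := orderOf_eq_prime (by ext x; exact hττ' x) hne
  let R : IntermediateField ℚ T := IntermediateField.fixedField (Subgroup.zpowers τE)
  have hR2 : Module.finrank R T = 2 := by
    rw [IntermediateField.finrank_fixedField_eq_card, Nat.card_zpowers, hord]
  have hR : Module.finrank ℚ R = 10 := by
    have h1 := Module.finrank_mul_finrank ℚ R T
    have h2 := Module.finrank_mul_finrank ℚ K T
    rw [h.hK, hT.h5] at h2
    rw [← h2, hR2] at h1
    omega
  have hRτ : ∀ x : R, τ (x : T) = x := fun x => x.2 ⟨τE, Subgroup.mem_zpowers τE⟩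
  -- integral versions
  have hyi : IsIntegral (𝓞 T) y := by
    apply IsIntegral.of_pow (n := 5) (by norm_num)
    rw [hy]
    exact isIntegral_algebraMap (R := 𝓞 T) (A := T) (x := algebraMap (𝓞 K) (𝓞 T) v)
  obtain ⟨Y, hY⟩ := IsIntegrallyClosed.isIntegral_iff.1 hyi
  have hYv : Y^5 = algebraMap (𝓞 K) (𝓞 T) v := by
    apply RingOfIntegers.ext
    change algebraMap (𝓞 T) T (Y^5) = _
    rw [map_pow, hY, hy]; rfl
  obtain ⟨m, hm0, hm⟩ := index_bound (y := Y) hv5 hT.h5 (by rw [← hy, ← hY])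
  let t : 𝓞 T →+* 𝓞 T := (oi τE.toRingEquiv : 𝓞 T →+* 𝓞 T)
  have ht : ∀ x : 𝓞 T, algebraMap (𝓞 T) T (t x) = τ x := fun x => rfl
  have htk : ∀ k : 𝓞 K, t (algebraMap (𝓞 K) (𝓞 T) k) = algebraMap (𝓞 K) (𝓞 T) (d (d k)) := by
    intro k
    apply RingOfIntegers.ext
    change τ (algebraMap K T (algebraMap (𝓞 K) K k)) = algebraMap K T (algebraMap (𝓞 K) K (d (d k)))
    rw [hτk', hD, hD]
  have hYt : Y * t Y = n := by
    apply RingOfIntegers.ext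
    change algebraMap (𝓞 T) T (Y * t Y) = algebraMap (𝓞 T) T _
    rw [map_mul, ht, map_intCast]
    change algebraMap (𝓞 T) T Y * τ (algebraMap (𝓞 T) T Y) = n
    rw [hY, hτy]
    field_simp
  refine ana (R := R) (m + n.natAbs) fun p hp => ?_
  obtain ⟨hp4, hp25⟩ := ww_mod hp
  have hpp := hp.1
  have hpB := hp.2.2
  have hpm : ¬ p ∣ m := fun hc => by have := Nat.le_of_dvd (Nat.pos_of_ne_zero hm0) hc; omega
  have hpn : ¬ (p : ℤ) ∣ n := fun hc => by
    have := Nat.le_of_dvd (Int.natAbs_pos.2 hn0) (Int.natCast_dvd.1 hc); omega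
  have hvp := h.v_pow hpp hp4 hn hpn (fun g hg hgp => H p hpp hp4 hp25 g hg hgp)
  have mapdvd : ∀ {x : 𝓞 K}, (p : 𝓞 K) ∣ x → (p : 𝓞 T) ∣ algebraMap (𝓞 K) (𝓞 T) x := by
    intro x hx
    have := _root_.map_dvd (algebraMap (𝓞 K) (𝓞 T)) hx
    rwa [map_natCast] at this
  have hall : ∀ x : 𝓞 T, (p : 𝓞 T) ∣ x^p - t x := by
    refine frob_all (K := K) hpp hpm t hm (fun k => ?_) ?_
    · rw [htk, ← map_pow, ← map_sub]
      exact mapdvd (h.frob_four hpp hp4 k)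
    · have h1 := mapdvd hvp
      rw [map_sub, map_pow, ← hYv, ← pow_mul, map_intCast, show 5 * ((p+1)/5) = p + 1 by omega] at h1
      have h2 : (p : 𝓞 T) ∣ Y * (Y^p - t Y) := by
        rw [mul_sub, hYt, ← pow_succ']; exact h1
      have hc : IsCoprime (p : 𝓞 T) (n : 𝓞 T) := by
        have h3 : IsCoprime (p : ℤ) n := (Prime.coprime_iff_not_dvd (Nat.prime_iff_prime_int.1 hpp)).2 hpn
        have := h3.map (Int.castRingHom (𝓞 T))
        simpa using this
      rw [← hYt] at hc
      exact hc.of_mul_right_left.dvd_of_dvd_mul_left h2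
  rw [← hR]
  refine split_of_frob hpp fun x => ?_
  have hxi : IsIntegral ℤ (algebraMap R T x) := by
    exact IsIntegral.algebraMap (A := R) x.2
  let x' : 𝓞 T := ⟨algebraMap R T x, hxi⟩
  obtain ⟨c, hc⟩ := hall x'
  have e1 : (algebraMap R T x)^p - algebraMap R T x = p * (c : T) := by
    have e2 := congrArg (algebraMap (𝓞 T) T) hc
    rw [map_sub, map_pow, ht, map_mul, map_natCast] at e2
    have e3 : τ (x' : T) = algebraMap R T x := hRτ x
    rw [e3] at e2
    exact e2
  have hpT : (p : T) ≠ 0 := by exact_mod_cast hpp.ne_zero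
  let c' : R := ((x : R)^p - x) / p
  have hc' : algebraMap R T c' = c := by
    have : algebraMap R T c' = ((algebraMap R T x)^p - algebraMap R T x) / p := by
      simp only [c', _root_.map_div₀, map_sub, map_pow, map_natCast]
    rw [this, e1]
    field_simp
  have hc'i : IsIntegral ℤ c' := by
    rw [← isIntegral_algebraMap_iff (algebraMap R T).injective, hc']
    exact c.2
  let c2 : 𝓞 R := ⟨c', hc'i⟩
  refine ⟨c2, ?_⟩
  apply RingOfIntegers.ext
  change algebraMap (𝓞 R) R (x^p - x) = algebraMap (𝓞 R) R ((p : 𝓞 R) * c2)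
  rw [map_sub, map_pow, map_mul, map_natCast]
  change (x:R)^p - x = p * c'
  have hpR : (p : R) ≠ 0 := by exact_mod_cast hpp.ne_zero
  simp only [c']
  field_simp
end St14

namespace St14
section
variable {F L : Type} [Field F] [NumberField F] [Field L] [NumberField L] [Algebra F L]

lemma iJ_ne {I : Ideal (𝓞 F)} (hI : I ≠ 0) : iJ F L I ≠ 0 := by
  rw [iJ_def]
  intro h
  exact hI ((Ideal.map_eq_bot_iff_of_injective (FaithfulSMul.algebraMap_injective (𝓞 F) (𝓞 L))).1 h)

lemma cl_iJ_eq {I J : Ideal (𝓞 F)} (hI : I ≠ 0) (hJ : J ≠ 0) (h : cl I = cl J) : cl (iJ F L I) = cl (iJ F L J) := by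
  obtain ⟨a, b, ha, hb, hab⟩ := (cl_eq hI hJ).1 h
  have inj := FaithfulSMul.algebraMap_injective (𝓞 F) (𝓞 L)
  refine (cl_eq (iJ_ne hI) (iJ_ne hJ)).2 ⟨algebraMap _ _ a, algebraMap _ _ b, ?_, ?_, ?_⟩
  · exact fun h => ha (inj (h.trans (map_zero _).symm))
  · exact fun h => hb (inj (h.trans (map_zero _).symm))
  · rw [← iJ_span, ← iJ_span, ← map_mul, ← map_mul, hab]

variable (F L) in
noncomputable def cJ : ClassGroup (𝓞 F) →* ClassGroup (𝓞 L) where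
  toFun c := cl (iJ F L (cl_surj c).choose)
  map_one' := by
    have h := (cl_surj (1 : ClassGroup (𝓞 F))).choose_spec
    rw [cl_iJ_eq h.1 one_ne_zero (by rw [h.2, cl_one]), map_one, cl_one]
  map_mul' c c' := by
    have h := (cl_surj c).choose_spec
    have h' := (cl_surj c').choose_spec
    have h2 := (cl_surj (c * c')).choose_spec
    rw [← cl_mul (iJ_ne h.1) (iJ_ne h'.1), ← map_mul]
    exact cl_iJ_eq h2.1 (mul_ne_zero h.1 h'.1) (by rw [h2.2, cl_mul h.1 h'.1, h.2, h'.2])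

lemma cJ_cl {I : Ideal (𝓞 F)} (hI : I ≠ 0) : cJ F L (cl I) = cl (iJ F L I) := by
  have h := (cl_surj (cl I)).choose_spec
  exact cl_iJ_eq h.1 hI h.2

lemma cJ_inj (h4 : Module.finrank F L = 4) {c : ClassGroup (𝓞 F)} (hc : c^5 = 1) (h1 : cJ F L c = 1) : c = 1 := by
  obtain ⟨I, hI, rfl⟩ := cl_surj c
  rw [cJ_cl hI, cl_eq_one (iJ_ne hI)] at h1
  obtain ⟨x, hx, hIx⟩ := h1
  have h2 := congrArg (Ideal.relNorm (𝓞 F)) hIx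
  rw [iJ_def, Ideal.relNorm_algebraMap, finrank_int, h4, Ideal.relNorm_singleton] at h2
  have h3 : cl I ^ 4 = 1 := by
    rw [← cl_pow hI, h2]
    apply cl_span
    intro h0
    rw [h0] at h2
    exact pow_ne_zero 4 hI (by rw [h2]; simp)
  calc cl I = cl I ^ 5 := by rw [pow_succ, h3, one_mul]
    _ = 1 := hc

lemma cJ_fix {δ : L ≃+* L} (hδ : ∀ x : F, δ (algebraMap F L x) = algebraMap F L x) (c : ClassGroup (𝓞 F)) :
    cS δ (cJ F L c) = cJ F L c := by
  obtain ⟨I, hI, rfl⟩ := cl_surj c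
  rw [cJ_cl hI, cS_cl _ (iJ_ne hI)]
  congr 1
  rw [iS_def, iJ_def]
  change Ideal.map (oi δ : 𝓞 L →+* 𝓞 L) _ = _
  rw [Ideal.map_map]
  congr 1
  ext x
  exact hδ _

lemma rank_F (h4 : Module.finrank F L = 4) {δ : L ≃+* L} (hδ : ∀ x : F, δ (algebraMap F L x) = algebraMap F L x) :
    Module.finrank (ZMod 5) (V5 (ClassGroup (𝓞 F))) ≤
      Module.finrank (ZMod 5) (Module.End.eigenspace (f5 (cS δ)) (1 : ZMod 5)) := by
  let φ : V5 (ClassGroup (𝓞 F)) →ₗ[ZMod 5] V5 (ClassGroup (𝓞 L)) :=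
    AddMonoidHom.toZModLinearMap 5 (M := V5 (ClassGroup (𝓞 F))) (M₁ := V5 (ClassGroup (𝓞 L)))
    { toFun := fun v => mk5 (cJ F L (g5 v)) (by rw [← map_pow, g5_pow, map_one])
      map_zero' := g5_inj (by simp)
      map_add' := fun v w => g5_inj (by simp) }
  have hφ : ∀ v, g5 (φ v) = cJ F L (g5 v) := fun v => rfl
  let ψ := φ.codRestrict (Module.End.eigenspace (f5 (cS δ)) (1 : ZMod 5)) (fun v => by
    rw [Module.End.mem_eigenspace_iff, one_smul]
    apply g5_inj
    rw [g5_f5, hφ, cJ_fix hδ])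
  apply LinearMap.finrank_le_finrank_of_injective (f := ψ)
  rw [LinearMap.injective_codRestrict_iff]
  refine (injective_iff_map_eq_zero φ).2 fun v hv => g5_inj ?_
  have := congrArg g5 hv
  rw [hφ, g5_zero] at this
  rw [g5_zero]
  exact cJ_inj h4 (g5_pow v) this
end
end St14

namespace St14

lemma rat_no_pow {N : ℕ} (hN : N.Prime) (b : ℚ) : b^5 ≠ (N : ℚ) := by
  intro hb
  have hi : IsIntegral ℤ b := by
    refine IsIntegral.of_pow (n := 5) (by norm_num) ?_
    rw [hb]; exact isIntegral_algebraMap (x := (N : ℤ))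
  obtain ⟨m, rfl⟩ := IsIntegrallyClosed.isIntegral_iff.1 hi
  have h1 : m^5 = (N : ℤ) := by
    have : ((m^5 : ℤ) : ℚ) = ((N : ℤ) : ℚ) := by push_cast; exact hb
    exact_mod_cast this
  have h2 := congrArg Int.natAbs h1
  rw [Int.natAbs_pow, Int.natAbs_natCast] at h2
  rw [← h2] at hN
  exact Nat.Prime.not_prime_pow (by norm_num) hN

lemma kum_finrank {K T : Type} [Field K] [Field T] [Algebra K T] {a : K} {y : T}
    (ha : ∀ b : K, b^5 ≠ a) (hy : y^5 = algebraMap K T a) (htop : IntermediateField.adjoin K {y} = ⊤) :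
    Module.finrank K T = 5 := by
  have h0 : aeval y (X^5 - C a : K[X]) = 0 := by simp [hy]
  have hm := minpoly.eq_of_irreducible_of_monic (kum_irr ha) h0 (monic_X_pow_sub_C a (by norm_num))
  have hi : IsIntegral K y := ⟨_, monic_X_pow_sub_C a (show (5:ℕ) ≠ 0 by norm_num), by simpa [aeval_def] using h0⟩
  have := IntermediateField.adjoin.finrank hi
  rw [htop, ← hm, natDegree_X_pow_sub_C, IntermediateField.finrank_top'] at this
  exact this

lemma no_pow4 {K : Type} [Field K] [NumberField K] (hK : Module.finrank ℚ K = 4) {N : ℕ} (hN : N.Prime) (b : K) : b^5 ≠ (N : K) := by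
  intro hb
  have ha := rat_no_pow hN
  have h0 : aeval b (X^5 - C (N : ℚ) : ℚ[X]) = 0 := by simp [hb]
  have hm := minpoly.eq_of_irreducible_of_monic (kum_irr ha) h0 (monic_X_pow_sub_C _ (by norm_num))
  have := minpoly.degree_dvd (K := ℚ) (x := b) (Algebra.IsIntegral.isIntegral b)
  rw [← hm, natDegree_X_pow_sub_C, hK] at this
  omega

lemma main_exists {N : ℕ} (hN : N.Prime) (hmod : N % 5 = 1)
    (L : Type) [Field L] [NumberField L] (ζ : L) (hζ : IsPrimitiveRoot ζ 5)
    (α : L) (hα : α ^ 5 = (N : L)) (hLgen : Algebra.adjoin ℚ {ζ, α} = (⊤ : Subalgebra ℚ L)) :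
    ∃ (K : Type) (_ : Field K) (_ : NumberField K) (_ : Algebra K L) (z : 𝓞 K) (d : 𝓞 K ≃+* 𝓞 K) (σ : L ≃ₐ[K] L)
      (a : 𝓞 L) (δ : L ≃+* L), (a : L) = α ∧ LD z d σ a δ N := by
  let K := IntermediateField.adjoin ℚ {ζ}
  haveI : NumberField K := NumberField.of_intermediateField _
  haveI : IsCyclotomicExtension {5} ℚ K := hζ.intermediateField_adjoin_isCyclotomicExtension ℚ
  have hK : Module.finrank ℚ K = 4 := by
    rw [IsCyclotomicExtension.finrank (n := 5) K (Polynomial.cyclotomic.irreducible_rat (by norm_num))]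
    decide
  let z0 : K := IntermediateField.AdjoinSimple.gen ℚ ζ
  have hz0 : IsPrimitiveRoot z0 5 := IsPrimitiveRoot.coe_submonoidClass_iff.mp hζ
  have ha : ∀ b : K, b^5 ≠ (N : K) := no_pow4 hK hN
  have hα' : α^5 = algebraMap K L (N : K) := by rw [hα, map_natCast]
  have htop : IntermediateField.adjoin K {α} = ⊤ := by
    rw [eq_top_iff]
    intro x _
    have hx : x ∈ Algebra.adjoin ℚ {ζ, α} := by rw [hLgen]; trivial
    have hle : Algebra.adjoin ℚ {ζ, α} ≤ ((IntermediateField.adjoin K {α}).restrictScalars ℚ).toSubalgebra := by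
      rw [Algebra.adjoin_le_iff]
      rintro y (rfl | rfl)
      · exact (IntermediateField.adjoin K {α}).algebraMap_mem z0
      · exact IntermediateField.mem_adjoin_simple_self K y
    exact hle hx
  have h5 : Module.finrank K L = 5 := kum_finrank ha hα' htop
  have hα0 : α ≠ 0 := by
    rintro rfl
    rw [zero_pow (by norm_num)] at hα
    exact hN.ne_zero (by exact_mod_cast hα.symm)
  -- sigma
  obtain ⟨s, hsk, hsα⟩ := kum_ext ha h5 hα' (algebraMap K L) (ζ * α) (by
    rw [mul_pow, hζ.pow_eq_one, one_mul, hα'])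
  let s' : L →ₐ[K] L := { s with commutes' := hsk }
  have hs'b : Function.Bijective s' := by
    haveI : FiniteDimensional K L := Module.finite_of_finrank_pos (by omega)
    exact Algebra.IsAlgebraic.algHom_bijective s'
  let σ : L ≃ₐ[K] L := AlgEquiv.ofBijective s' hs'b
  -- d
  let u : (ZMod 5)ˣ := ⟨2, 3, by decide, by decide⟩
  let dK : K ≃ₐ[ℚ] K := (IsCyclotomicExtension.Rat.galEquivZMod 5 K).symm u
  have hdK : dK z0 = z0^2 := by
    have := IsCyclotomicExtension.Rat.galEquivZMod_apply_of_pow_eq 5 K dK hz0.pow_eq_one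
    rw [MulEquiv.apply_symm_apply] at this
    exact this
  obtain ⟨t, htk, htα⟩ := kum_ext ha h5 hα' ((algebraMap K L).comp (dK : K →+* K)) α (by
    rw [RingHom.comp_apply, map_natCast, map_natCast, hα])
  let t' : L →ₐ[ℚ] L := RingHom.toRatAlgHom t
  have ht'b : Function.Bijective t' := Algebra.IsAlgebraic.algHom_bijective t'
  let δ : L ≃+* L := RingEquiv.ofBijective t ht'b
  have hαi : IsIntegral ℤ α := by
    refine IsIntegral.of_pow (n := 5) (by norm_num) ?_
    rw [hα]; exact_mod_cast isIntegral_algebraMap (R := ℤ) (A := L) (x := (N : ℤ))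
  let a : 𝓞 L := ⟨α, hαi⟩
  let z : 𝓞 K := ⟨z0, hz0.isIntegral (by norm_num)⟩
  let d : 𝓞 K ≃+* 𝓞 K := RingOfIntegers.mapRingEquiv dK.toRingEquiv
  refine ⟨K, inferInstance, inferInstance, inferInstance, z, d, σ, a, δ, rfl, ⟨⟨hz0, hK, ?_⟩, ⟨hz0, hK, h5, hα0, ?_⟩, ?_, hN, hmod, ?_, ?_⟩⟩
  · apply RingOfIntegers.ext
    exact hdK
  · exact hsα
  · apply RingOfIntegers.ext
    change algebraMap (𝓞 L) L (a^5) = algebraMap (𝓞 L) L N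
    rw [map_pow, map_natCast]
    exact hα
  · apply RingOfIntegers.ext
    exact htα
  · intro k
    apply RingOfIntegers.ext
    exact htk k

theorem main (N : ℕ) (hN : N.Prime) (hmod : N % 5 = 1)
    (F : Type) [Field F] [NumberField F]
    (β : F) (hβ : β ^ 5 = (N : F))
    (hFgen : Algebra.adjoin ℚ {β} = (⊤ : Subalgebra ℚ F))
    (L : Type) [Field L] [NumberField L]
    (ζ : L) (hζ : IsPrimitiveRoot ζ 5)
    (α : L) (hα : α ^ 5 = (N : L))
    (hLgen : Algebra.adjoin ℚ {ζ, α} = (⊤ : Subalgebra ℚ L)) :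
    (pRank 5 (ClassGroup (𝓞 F)) = 1 → 2 ≤ pRank 5 (ClassGroup (𝓞 L))) ∧
    (pRank 5 (ClassGroup (𝓞 F)) = 2 → 3 ≤ pRank 5 (ClassGroup (𝓞 L))) ∧
    (pRank 5 (ClassGroup (𝓞 F)) = 3 → 6 ≤ pRank 5 (ClassGroup (𝓞 L))) := by
  obtain ⟨K, i1, i2, i3, z, d, σ, a, δ, haα, h⟩ := main_exists hN hmod L ζ hζ α hα hLgen
  have hq := rat_no_pow hN
  have hβ' : β^5 = algebraMap ℚ F (N : ℚ) := by rw [hβ, map_natCast]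
  have htop : IntermediateField.adjoin ℚ {β} = ⊤ := by
    rw [eq_top_iff]
    intro x _
    have hx : x ∈ Algebra.adjoin ℚ {β} := by rw [hFgen]; trivial
    exact IntermediateField.algebra_adjoin_le_adjoin ℚ {β} hx
  have hF5 : Module.finrank ℚ F = 5 := kum_finrank hq hβ' htop
  obtain ⟨ι, -, hιβ⟩ := kum_ext hq hF5 hβ' (algebraMap ℚ L) α (by rw [hα, map_natCast])
  letI : Algebra F L := ι.toAlgebra
  have hL : Module.finrank ℚ L = 20 := by
    rw [← Module.finrank_mul_finrank ℚ K L, h.ck.hK, h.kd.h5]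
  have h4 : Module.finrank F L = 4 := by
    have := Module.finrank_mul_finrank ℚ F L
    rw [hF5, hL] at this
    omega
  have hδ : ∀ x : F, δ (algebraMap F L x) = algebraMap F L x := by
    have : (δ : L →+* L).comp ι = ι := by
      refine kum_hom_ext hq hF5 hβ' (fun k => ?_) ?_
      · rw [eq_ratCast, map_ratCast, map_ratCast]
      · rw [RingHom.comp_apply, hιβ, ← haα]
        exact h.daL
    exact fun x => RingHom.congr_fun this x
  have hr := rank_F h4 hδ
  rw [pRank_eq, pRank_eq]
  have h12 := h.rank12
  refine ⟨fun h1 => by omega, fun h1 => by omega, fun h1 => h.rank3 ?_ (by omega)⟩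
  intro π hπ hπN
  exact h.ck.hana hN hmod hπ hπN
end St14

/-- Let `N` be a prime with `N ≡ 1 (mod 5)`, `F = ℚ(N^{1/5})`, and
`L = ℚ(ζ_5, N^{1/5})`.  If `rk_5(Cl(F)) = 1` then `rk_5(Cl(L)) ≥ 2`; if
`rk_5(Cl(F)) = 2` then `rk_5(Cl(L)) ≥ 3`; if `rk_5(Cl(F)) = 3` then `rk_5(Cl(L)) ≥ 6`. -/
theorem stmt14 (N : ℕ) (hN : N.Prime) (hmod : N % 5 = 1)
    (F : Type) [Field F] [NumberField F]
    (β : F) (hβ : β ^ 5 = (N : F))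
    (hFgen : Algebra.adjoin ℚ {β} = (⊤ : Subalgebra ℚ F))
    (L : Type) [Field L] [NumberField L]
    (ζ : L) (hζ : IsPrimitiveRoot ζ 5)
    (α : L) (hα : α ^ 5 = (N : L))
    (hLgen : Algebra.adjoin ℚ {ζ, α} = (⊤ : Subalgebra ℚ L)) :
    (pRank 5 (ClassGroup (𝓞 F)) = 1 → 2 ≤ pRank 5 (ClassGroup (𝓞 L))) ∧
    (pRank 5 (ClassGroup (𝓞 F)) = 2 → 3 ≤ pRank 5 (ClassGroup (𝓞 L))) ∧
    (pRank 5 (ClassGroup (𝓞 F)) = 3 → 6 ≤ pRank 5 (ClassGroup (𝓞 L))) := by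
  exact St14.main N hN hmod F β hβ hFgen L ζ hζ α hα hLgen
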